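/- Fix a nonzero integer a and a real number u. As x → ∞, (1/x)·#{n : 1 < n ≤ x and ω(|φ(n) + a|) − log log x ≤ u·√(log log x)} tends to (1/√(2π)) ∫_{−∞}^{u} e^{−t²/2} dt (where n with φ(n) + a = 0 may be ignored without affecting the limit). -/

import Mathlib

open Filter

open Finset in
theorem sum_primeFactors_swap (N : ℕ) (f : ℕ → ℝ) :
    ∑ n ∈ Icc 1 N, ∑ p ∈ n.primeFactors, f p = ∑ p ∈ Nat.primesLE N, f p * (N / p : ℕ) := by
  have h1 : ∀ n ∈ Icc 1 N, ∑ p ∈ n.primeFactors, f p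
      = ∑ p ∈ Nat.primesLE N, if p ∣ n then f p else 0 := by
    intro n hn
    rw [mem_Icc] at hn
    rw [← sum_filter]
    refine sum_congr ?_ fun _ _ => rfl
    ext p
    simp only [Nat.mem_primeFactors, mem_filter, Nat.mem_primesLE]
    constructor
    · rintro ⟨hp, hd, h0⟩
      exact ⟨⟨(Nat.le_of_dvd (by omega) hd).trans hn.2, hp⟩, hd⟩
    · rintro ⟨⟨_, hp⟩, hd⟩
      exact ⟨hp, hd, by omega⟩
  rw [sum_congr rfl h1, sum_comm]
  refine sum_congr rfl fun p hp => ?_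
  rw [← sum_filter, sum_const, nsmul_eq_mul, mul_comm]
  congr 2
  rw [← Nat.Ioc_filter_dvd_card_eq_div]
  rfl

open Finset in
theorem sum_log_primeFactors_le {n : ℕ} (hn : n ≠ 0) :
    ∑ p ∈ n.primeFactors, Real.log p ≤ Real.log n := by
  have h0 : ∀ p ∈ n.primeFactors, (p : ℝ) ≠ 0 := fun p hp => by
    have := (Nat.prime_of_mem_primeFactors hp).pos
    positivity
  rw [← Real.log_prod h0]
  have h1 : (∏ p ∈ n.primeFactors, (p : ℝ)) = ((∏ p ∈ n.primeFactors, p : ℕ) : ℝ) := by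
    push_cast; rfl
  rw [h1]
  apply Real.log_le_log
  · rw [← h1]
    exact prod_pos fun p hp => by
      have := (Nat.prime_of_mem_primeFactors hp).pos
      positivity
  · exact_mod_cast Nat.le_of_dvd (by omega) (Nat.prod_primeFactors_dvd n)

open Finset in
theorem sum_log_div_prime_le {N : ℕ} (hN : 1 ≤ N) :
    ∑ p ∈ Nat.primesLE N, Real.log p / p ≤ Real.log N + Real.log 4 := by
  have hN' : (0 : ℝ) < N := by positivity
  have h1 : ∑ p ∈ Nat.primesLE N, Real.log p * (N / p : ℕ) ≤ N * Real.log N := by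
    rw [← sum_primeFactors_swap]
    calc _ ≤ ∑ n ∈ Icc 1 N, Real.log N := by
          refine sum_le_sum fun n hn => ?_
          rw [mem_Icc] at hn
          refine (sum_log_primeFactors_le (by omega)).trans ?_
          apply Real.log_le_log
          · exact_mod_cast hn.1
          · exact_mod_cast hn.2
      _ = _ := by simp
  have h2 : ∑ p ∈ Nat.primesLE N, Real.log p ≤ Real.log 4 * N := by
    rw [← Chebyshev.theta_eq_sum_primesLE_log]
    exact Chebyshev.theta_le_log4_mul_x hN'.le
  have h3 : N * ∑ p ∈ Nat.primesLE N, Real.log p / p ≤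
      ∑ p ∈ Nat.primesLE N, Real.log p * (N / p : ℕ) + ∑ p ∈ Nat.primesLE N, Real.log p := by
    rw [mul_sum, ← sum_add_distrib]
    refine sum_le_sum fun p hp => ?_
    have hp' := (Nat.mem_primesLE.1 hp).2
    have h4 : (N : ℝ) / p ≤ (N / p : ℕ) + 1 := by
      have := Nat.lt_floor_add_one ((N : ℝ) / p)
      rw [Nat.floor_div_eq_div] at this
      exact this.le
    have h5 : 0 ≤ Real.log p := Real.log_natCast_nonneg p
    calc (N : ℝ) * (Real.log p / p) = Real.log p * (N / p) := by ring
      _ ≤ Real.log p * ((N / p : ℕ) + 1) := by gcongr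
      _ = _ := by ring
  have h6 : (N : ℝ) * ∑ p ∈ Nat.primesLE N, Real.log p / p ≤ N * (Real.log N + Real.log 4) := by
    linarith
  exact le_of_mul_le_mul_left h6 hN'

theorem primesLE_succ (N : ℕ) : Nat.primesLE (N + 1) =
    if (N + 1).Prime then insert (N + 1) (Nat.primesLE N) else Nat.primesLE N := by
  rw [Nat.primesLE_eq_filter_range, Finset.range_add_one, Finset.filter_insert,
    Nat.primesLE_eq_filter_range]

theorem sum_primesLE_succ (N : ℕ) (f : ℕ → ℝ) : ∑ p ∈ Nat.primesLE (N + 1), f p =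
    ∑ p ∈ Nat.primesLE N, f p + if (N + 1).Prime then f (N + 1) else 0 := by
  rw [primesLE_succ]
  split_ifs
  · rw [Finset.sum_insert (by simp [Nat.mem_primesLE]), add_comm]
  · simp

theorem sum_inv_prime_le_aux {N : ℕ} (hN : 2 ≤ N) :
    ∑ p ∈ Nat.primesLE N, (p : ℝ)⁻¹ -
      (∑ p ∈ Nat.primesLE N, Real.log p / p - Real.log N - Real.log 4) / Real.log N
      - Real.log (Real.log N) ≤ 
    ∑ p ∈ Nat.primesLE 2, (p : ℝ)⁻¹ -
      (∑ p ∈ Nat.primesLE 2, Real.log p / p - Real.log (2 : ℕ) - Real.log 4) / Real.log (2 : ℕ)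
      - Real.log (Real.log (2 : ℕ)) := by
  induction N, hN using Nat.le_induction with
  | base => exact le_rfl
  | succ N hN ih =>
    refine le_trans ?_ ih
    rw [sum_primesLE_succ, sum_primesLE_succ]
    have hA := sum_log_div_prime_le (N := N) (by omega)
    set A := ∑ p ∈ Nat.primesLE N, Real.log p / p
    set S := ∑ p ∈ Nat.primesLE N, (p : ℝ)⁻¹
    have hN2 : (2 : ℝ) ≤ N := by exact_mod_cast hN
    set l := Real.log N with hl
    set l' := Real.log (N + 1 : ℕ) with hl'
    have hl0 : 0 < l := Real.log_pos (by linarith)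
    have hll : l ≤ l' := Real.log_le_log (by linarith) (by push_cast; linarith)
    have hl'0 : 0 < l' := by linarith
    have key : 1 - l / l' ≤ Real.log l' - Real.log l := by
      have := Real.one_sub_inv_le_log_of_pos (x := l' / l) (by positivity)
      rw [Real.log_div hl'0.ne' hl0.ne', inv_div] at this
      exact this
    have hB : (A - l - Real.log 4) * (1 / l - 1 / l') ≤ 0 := by
      apply mul_nonpos_of_nonpos_of_nonneg
      · linarith
      · have : 1 / l' ≤ 1 / l := one_div_le_one_div_of_le hl0 hll
        linarith
    have e : ∀ a : ℝ, (S + a) - (A + l' * a - l' - Real.log 4) / l' - Real.log l'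
        = S - (A - l - Real.log 4) / l - Real.log l + (A - l - Real.log 4) * (1 / l - 1 / l')
          + (1 - l / l') - (Real.log l' - Real.log l) := by
      intro a
      field_simp
      ring
    have h2 : (if (N + 1).Prime then l' / ((N + 1 : ℕ) : ℝ) else 0)
        = l' * (if (N + 1).Prime then (((N + 1 : ℕ) : ℝ))⁻¹ else 0) := by
      split_ifs <;> simp [div_eq_mul_inv]
    rw [h2, e]
    linarith

theorem exists_sum_inv_prime_le : ∃ C : ℝ, ∀ N : ℕ, 2 ≤ N →
    ∑ p ∈ Nat.primesLE N, (p : ℝ)⁻¹ ≤ Real.log (Real.log N) + C := by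
  refine ⟨∑ p ∈ Nat.primesLE 2, (p : ℝ)⁻¹ -
      (∑ p ∈ Nat.primesLE 2, Real.log p / p - Real.log (2 : ℕ) - Real.log 4) / Real.log (2 : ℕ)
      - Real.log (Real.log (2 : ℕ)), fun N hN => ?_⟩
  have h := sum_inv_prime_le_aux hN
  have hA := sum_log_div_prime_le (N := N) (by omega)
  have hl0 : 0 < Real.log N := Real.log_pos (by exact_mod_cast hN)
  have : (∑ p ∈ Nat.primesLE N, Real.log p / p - Real.log N - Real.log 4) / Real.log N ≤ 0 :=
    div_nonpos_of_nonpos_of_nonneg (by linarith) hl0.le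
  linarith

open Finset in
theorem harmonic_le_prod_primesLE (N : ℕ) :
    ∑ n ∈ Icc 1 N, (n : ℝ)⁻¹ ≤ ∏ p ∈ Nat.primesLE N, (1 - (p : ℝ)⁻¹)⁻¹ := by
  let f : ℕ →* ℝ := ⟨⟨fun n => (n : ℝ)⁻¹, by simp⟩, fun m n => by simp [mul_comm]⟩
  have hf : ∀ {p : ℕ}, p.Prime → ‖f p‖ < 1 := by
    intro p hp
    have : (1 : ℝ) < p := by exact_mod_cast hp.one_lt
    change ‖(p : ℝ)⁻¹‖ < 1
    rw [norm_inv, Real.norm_natCast]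
    exact inv_lt_one_of_one_lt₀ this
  obtain ⟨hs, hh⟩ := EulerProduct.summable_and_hasSum_smoothNumbers_prod_primesBelow_geometric
    (f := f) hf (N + 1)
  have hmem : ∀ n ∈ Icc 1 N, n ∈ (N + 1).smoothNumbers := by
    intro n hn
    rw [mem_Icc] at hn
    exact Nat.mem_smoothNumbers_of_lt (by omega) (by omega)
  let e : {n // n ∈ Icc 1 N} → (N + 1).smoothNumbers := fun n => ⟨n.1, hmem n.1 n.2⟩
  have he : Function.Injective e := fun a b h => by
    apply Subtype.ext; exact congrArg (fun z : (N + 1).smoothNumbers => (z : ℕ)) h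
  have := sum_le_hasSum ((univ : Finset {n // n ∈ Icc 1 N}).map ⟨e, he⟩)
    (fun i _ => by change 0 ≤ ((i : ℕ) : ℝ)⁻¹; positivity) hh
  rw [sum_map] at this
  change ∑ x : {n // n ∈ Icc 1 N}, ((x.1 : ℕ) : ℝ)⁻¹ ≤ _ at this
  rw [sum_coe_sort (Icc 1 N) (fun n => (n : ℝ)⁻¹)] at this
  exact this

theorem log_le_sum_Icc_inv (N : ℕ) : Real.log N ≤ ∑ n ∈ Finset.Icc 1 N, (n : ℝ)⁻¹ := by
  have h := log_add_one_le_harmonic N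
  rw [harmonic_eq_sum_Icc] at h
  push_cast at h
  refine le_trans ?_ h
  rcases Nat.eq_zero_or_pos N with rfl | hN
  · simp
  · exact Real.log_le_log (by positivity) (by linarith)

theorem sum_Icc_inv_le (N : ℕ) : ∑ n ∈ Finset.Icc 1 N, (n : ℝ)⁻¹ ≤ 1 + Real.log N := by
  have h := harmonic_le_one_add_log N
  rw [harmonic_eq_sum_Icc] at h
  push_cast at h
  exact h

open Finset in
/-- The tail `∑_{n > m} 1/n²` is at most `1/m`. -/
theorem sum_Ioc_inv_sq_le {m : ℕ} (hm : 1 ≤ m) (N : ℕ) :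
    ∑ n ∈ Ioc m N, ((n : ℝ) ^ 2)⁻¹ ≤ (m : ℝ)⁻¹ := by
  rcases le_or_gt m N with h | h
  · have := sum_Ioc_inv_sq_le_sub (α := ℝ) (by omega : m ≠ 0) h
    have h2 : (0 : ℝ) ≤ (N : ℝ)⁻¹ := by positivity
    linarith
  · rw [Ioc_eq_empty (by omega)]
    simp

open Finset in
theorem log_log_le_sum_inv_prime {N : ℕ} (hN : 2 ≤ N) :
    Real.log (Real.log N) ≤ ∑ p ∈ Nat.primesLE N, (p : ℝ)⁻¹ + 2 := by
  have hl0 : 0 < Real.log N := Real.log_pos (by exact_mod_cast hN)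
  have h1 := (log_le_sum_Icc_inv N).trans (harmonic_le_prod_primesLE N)
  have hp2 : ∀ p ∈ Nat.primesLE N, (2 : ℝ) ≤ p := fun p hp => by
    exact_mod_cast (Nat.mem_primesLE.1 hp).2.two_le
  have hpos : ∀ p ∈ Nat.primesLE N, 0 < (1 - (p : ℝ)⁻¹) := fun p hp => by
    have := inv_anti₀ (by norm_num) (hp2 p hp)
    linarith
  have h2 := Real.log_le_log hl0 h1
  rw [Real.log_prod (fun p hp => (inv_pos.2 (hpos p hp)).ne')] at h2
  have h3 : ∀ p ∈ Nat.primesLE N, Real.log (1 - (p : ℝ)⁻¹)⁻¹ ≤ (p : ℝ)⁻¹ + 2 * ((p : ℝ) ^ 2)⁻¹ := by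
    intro p hp
    have h4 := Real.log_le_sub_one_of_pos (inv_pos.2 (hpos p hp))
    refine h4.trans ?_
    have h5 := hp2 p hp
    have h6 := hpos p hp
    have e : (1 - (p : ℝ)⁻¹)⁻¹ - 1 = 1 / ((p : ℝ) - 1) := by
      have : (p : ℝ) - 1 ≠ 0 := by linarith
      field_simp
      ring
    rw [e, div_le_iff₀ (by linarith)]
    have : (p : ℝ) ≠ 0 := by linarith
    have e2 : ((p : ℝ)⁻¹ + 2 * ((p : ℝ) ^ 2)⁻¹) * (p - 1) = 1 + (p : ℝ)⁻¹ * (1 - 2 * (p : ℝ)⁻¹) := by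
      field_simp
      ring
    rw [e2]
    have h7 := inv_anti₀ (by norm_num) h5
    have : 0 ≤ (p : ℝ)⁻¹ * (1 - 2 * (p : ℝ)⁻¹) := by
      apply mul_nonneg
      · positivity
      · linarith
    linarith
  have h4 : ∑ p ∈ Nat.primesLE N, 2 * ((p : ℝ) ^ 2)⁻¹ ≤ 2 * 1 := by
    rw [← mul_sum]
    gcongr
    calc ∑ p ∈ Nat.primesLE N, ((p : ℝ) ^ 2)⁻¹ ≤ ∑ p ∈ Ioc 1 N, ((p : ℝ) ^ 2)⁻¹ := by
          apply sum_le_sum_of_subset_of_nonneg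
          · intro p hp
            rw [Nat.mem_primesLE] at hp
            exact mem_Ioc.2 ⟨hp.2.one_lt, hp.1⟩
          · intros; positivity
      _ ≤ ((1 : ℕ) : ℝ)⁻¹ := sum_Ioc_inv_sq_le le_rfl N
      _ = 1 := by simp
  have h5 := sum_le_sum h3
  rw [sum_add_distrib] at h5
  linarith

open Finset in
theorem abs_card_modEq_sub_le {A B m : ℕ} (hAB : A ≤ B) (hm : 0 < m) (v : ℕ) :
    |(#{x ∈ Ico A B | x ≡ v [MOD m]} : ℝ) - ((B : ℝ) - A) / m| ≤ 1 := by
  have h := Nat.Ico_filter_modEq_card A B hm v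
  have hm' : (0 : ℚ) < m := by exact_mod_cast hm
  have hAB' : (A : ℚ) ≤ B := by exact_mod_cast hAB
  have hle : ((A : ℚ) - v) / m ≤ ((B : ℚ) - v) / m := by gcongr
  rw [max_eq_left (by have := Int.ceil_mono hle; linarith)] at h
  have h1 := Int.le_ceil (((B : ℚ) - v) / m)
  have h2 := Int.ceil_lt_add_one (((B : ℚ) - v) / m)
  have h3 := Int.le_ceil (((A : ℚ) - v) / m)
  have h4 := Int.ceil_lt_add_one (((A : ℚ) - v) / m)
  have h5 : ((#{x ∈ Ico A B | x ≡ v [MOD m]} : ℤ) : ℚ) =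
      (⌈((B : ℚ) - v) / m⌉ : ℤ) - (⌈((A : ℚ) - v) / m⌉ : ℤ) := by
    rw [h]; push_cast; rfl
  have e : ((B : ℚ) - A) / m = ((B : ℚ) - v) / m - ((A : ℚ) - v) / m := by ring
  have h6 : |(#{x ∈ Ico A B | x ≡ v [MOD m]} : ℚ) - ((B : ℚ) - A) / m| ≤ 1 := by
    rw [e, abs_le]
    push_cast at h5
    constructor <;> linarith
  have h7 := (Rat.cast_le (K := ℝ)).2 h6
  push_cast at h7
  exact h7

open Finset in
theorem abs_card_modEq_modEq_sub_le {A B m k : ℕ} (hAB : A ≤ B) (hm : 0 < m) (hk : 0 < k)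
    (hmk : m.Coprime k) (v w : ℕ) :
    |(#{x ∈ Ico A B | x ≡ v [MOD m] ∧ x ≡ w [MOD k]} : ℝ) - ((B : ℝ) - A) / (m * k)| ≤ 1 := by
  have h := abs_card_modEq_sub_le hAB (Nat.mul_pos hm hk) (Nat.chineseRemainder hmk v w : ℕ)
  have hc := (Nat.chineseRemainder hmk v w).2
  push_cast at h
  convert h using 7 with x
  constructor
  · rintro ⟨h1, h2⟩
    exact (Nat.modEq_and_modEq_iff_modEq_mul hmk).1 ⟨h1.trans hc.1.symm, h2.trans hc.2.symm⟩
  · intro h1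
    have := (Nat.modEq_and_modEq_iff_modEq_mul hmk).2 h1
    exact ⟨this.1.trans hc.1, this.2.trans hc.2⟩

/-- The sum of the Möbius function over the multiples of `g` dividing a squarefree `k`. -/
theorem sum_moebius_multiples {k g : ℕ} (hk : Squarefree k) (hg : g ∣ k) :
    ∑ e ∈ k.divisors.filter (g ∣ ·), ArithmeticFunction.moebius e
      = if g = k then ArithmeticFunction.moebius k else 0 := by
  obtain ⟨t, rfl⟩ := hg
  have hg0 : g ≠ 0 := fun h => by simp [h] at hk
  have ht0 : t ≠ 0 := fun h => by simp [h] at hk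
  have hcop : g.Coprime t := Nat.coprime_of_squarefree_mul hk
  have h1 : (g * t).divisors.filter (g ∣ ·) = t.divisors.image (g * ·) := by
    ext e
    simp only [Finset.mem_filter, Nat.mem_divisors, Finset.mem_image]
    constructor
    · rintro ⟨⟨h1, _⟩, ⟨s, rfl⟩⟩
      exact ⟨s, ⟨Nat.dvd_of_mul_dvd_mul_left (by omega) h1, ht0⟩, rfl⟩
    · rintro ⟨s, ⟨h1, _⟩, rfl⟩
      exact ⟨⟨Nat.mul_dvd_mul_left g h1, by positivity⟩, dvd_mul_right _ _⟩
  rw [h1, Finset.sum_image (fun a _ b _ h => Nat.eq_of_mul_eq_mul_left (by omega) h)]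
  have h2 : ∀ s ∈ t.divisors, ArithmeticFunction.moebius (g * s)
      = ArithmeticFunction.moebius g * ArithmeticFunction.moebius s := fun s hs =>
    ArithmeticFunction.isMultiplicative_moebius.map_mul_of_coprime
      (hcop.coprime_dvd_right (Nat.dvd_of_mem_divisors hs))
  rw [Finset.sum_congr rfl h2, ← Finset.mul_sum]
  have h3 : ∑ s ∈ t.divisors, ArithmeticFunction.moebius s = if t = 1 then 1 else 0 := by
    rw [← ArithmeticFunction.coe_mul_zeta_apply, ArithmeticFunction.moebius_mul_coe_zeta,
      ArithmeticFunction.one_apply]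
  rw [h3]
  by_cases ht : t = 1
  · simp [ht]
  · rw [if_neg ht, if_neg, mul_zero]
    intro h
    exact ht (Nat.eq_of_mul_eq_mul_left (by omega : 0 < g) (by omega))

theorem sum_moebius_mul_moebius_mul_gcd {k k' : ℕ} (hk : Squarefree k) (hk' : Squarefree k') :
    ∑ e ∈ k.divisors, ∑ e' ∈ k'.divisors,
      ArithmeticFunction.moebius e * ArithmeticFunction.moebius e' * (e.gcd e' : ℤ)
      = if k = k' then (k.totient : ℤ) else 0 := by
  have hk0 := hk.ne_zero
  have hk0' := hk'.ne_zero
  have h1 : ∀ e ∈ k.divisors, ∀ e' ∈ k'.divisors,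
      ArithmeticFunction.moebius e * ArithmeticFunction.moebius e' * (e.gcd e' : ℤ)
      = ∑ g ∈ (k.gcd k').divisors, (g.totient : ℤ) *
        ((if g ∣ e then ArithmeticFunction.moebius e else 0) *
         (if g ∣ e' then ArithmeticFunction.moebius e' else 0)) := by
    intro e he e' he'
    have hs : (e.gcd e').divisors = (k.gcd k').divisors.filter fun g => g ∣ e ∧ g ∣ e' := by
      rw [Nat.mem_divisors] at he he'
      ext g
      simp only [Nat.mem_divisors, Finset.mem_filter, Nat.dvd_gcd_iff, ne_eq, Nat.gcd_eq_zero_iff]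
      constructor
      · rintro ⟨⟨h1, h2⟩, _⟩
        exact ⟨⟨⟨h1.trans he.1, h2.trans he'.1⟩, fun h => hk0 h.1⟩, h1, h2⟩
      · rintro ⟨_, h⟩
        refine ⟨h, fun h => ?_⟩
        rw [h.1] at he
        exact hk0 (Nat.eq_zero_of_zero_dvd he.1)
    rw [← Nat.sum_totient (e.gcd e'), hs, Finset.sum_filter]
    push_cast
    rw [Finset.mul_sum]
    refine Finset.sum_congr rfl fun g _ => ?_
    by_cases a : g ∣ e <;> by_cases b : g ∣ e' <;> simp [a, b]
    ring
  calc _ = ∑ e ∈ k.divisors, ∑ e' ∈ k'.divisors, ∑ g ∈ (k.gcd k').divisors, (g.totient : ℤ) *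
        ((if g ∣ e then ArithmeticFunction.moebius e else 0) *
         (if g ∣ e' then ArithmeticFunction.moebius e' else 0)) :=
        Finset.sum_congr rfl fun e he => Finset.sum_congr rfl fun e' he' => h1 e he e' he'
    _ = ∑ g ∈ (k.gcd k').divisors, (g.totient : ℤ) *
        ((∑ e ∈ k.divisors, if g ∣ e then ArithmeticFunction.moebius e else 0) *
         (∑ e' ∈ k'.divisors, if g ∣ e' then ArithmeticFunction.moebius e' else 0)) := by
        simp_rw [Finset.sum_mul_sum, Finset.mul_sum]
        refine (Finset.sum_congr rfl fun e _ => Finset.sum_comm).trans ?_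
        exact Finset.sum_comm
    _ = ∑ g ∈ (k.gcd k').divisors, (g.totient : ℤ) *
        ((if g = k then ArithmeticFunction.moebius k else 0) *
         (if g = k' then ArithmeticFunction.moebius k' else 0)) := by
        refine Finset.sum_congr rfl fun g hg => ?_
        rw [Nat.mem_divisors, Nat.dvd_gcd_iff] at hg
        rw [← Finset.sum_filter, ← Finset.sum_filter, sum_moebius_multiples hk hg.1.1,
          sum_moebius_multiples hk' hg.1.2]
    _ = _ := by
        split_ifs with h
        · subst h
          rw [Nat.gcd_self, Finset.sum_eq_single k]
          · have := ArithmeticFunction.moebius_sq_eq_one_of_squarefree hk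
            simp only [if_true]
            rw [← sq, this, mul_one]
          · intro b _ hb; simp [hb]
          · intro h; simp [hk0] at h
        · refine Finset.sum_eq_zero fun g _ => ?_
          by_cases h1 : g = k
          · rw [if_neg (fun h2 => h (h1.symm.trans h2))]; simp
          · simp [h1]

theorem sum_filter_sq_indicator {ι : Type*} (I : Finset ι) (T : Finset ℕ) (c : ι → ℝ)
    (e : ι → ℕ) :
    ∑ n ∈ T, (∑ i ∈ I, if e i ∣ n then c i else 0) ^ 2
      = ∑ i ∈ I, ∑ j ∈ I, c i * c j * ((T.filter fun n => (e i).lcm (e j) ∣ n).card : ℝ) := by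
  simp_rw [sq, Finset.sum_mul_sum]
  rw [Finset.sum_comm]
  refine Finset.sum_congr rfl fun i _ => ?_
  rw [Finset.sum_comm]
  refine Finset.sum_congr rfl fun j _ => ?_
  rw [Finset.card_filter, Nat.cast_sum, Finset.mul_sum]
  refine Finset.sum_congr rfl fun n _ => ?_
  simp only [Nat.lcm_dvd_iff]
  by_cases a : e i ∣ n <;> by_cases b : e j ∣ n <;> simp [a, b]

/-- Selberg's upper bound sieve for primes in an arithmetic progression to a prime modulus. -/
theorem card_prime_modEq_mul_sq_le {q : ℕ} (hq : q.Prime) (r X R : ℕ) (K : Finset ℕ)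
    (hK : ∀ k ∈ K, Squarefree k ∧ ¬ q ∣ k ∧ k ≤ R) (hKR : K.card ≤ R) :
    (((Finset.Ico 1 (X + 1)).filter fun P => P.Prime ∧ R < P ∧ P ≡ r [MOD q]).card : ℝ)
      * (∑ k ∈ K, (k.totient : ℝ)⁻¹) ^ 2
      ≤ X / q * ∑ k ∈ K, (k.totient : ℝ)⁻¹ + (R : ℝ) ^ 6 := by
  classical
  set J := ∑ k ∈ K, (k.totient : ℝ)⁻¹ with hJ
  set T := (Finset.Ico 1 (X + 1)).filter fun n => n ≡ r [MOD q] with hT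
  set I := K.sigma fun k => k.divisors with hI
  set c : (Σ _ : ℕ, ℕ) → ℝ := fun i => (ArithmeticFunction.moebius i.2 : ℝ) * i.2 *
    (i.1.totient : ℝ)⁻¹ with hc
  set e : (Σ _ : ℕ, ℕ) → ℕ := fun i => i.2 with he
  have hmain := sum_filter_sq_indicator I T c e
  have hIm : ∀ i ∈ I, i.1 ∈ K ∧ i.2 ∣ i.1 ∧ i.2 ≠ 0 := by
    intro i hi
    rw [hI, Finset.mem_sigma, Nat.mem_divisors] at hi
    exact ⟨hi.1, hi.2.1, fun h => hi.2.2 (by rw [h] at hi; exact Nat.eq_zero_of_zero_dvd hi.2.1)⟩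
  -- lower bound
  have hlow : (((Finset.Ico 1 (X + 1)).filter fun P => P.Prime ∧ R < P ∧ P ≡ r [MOD q]).card : ℝ)
      * J ^ 2 ≤ ∑ n ∈ T, (∑ i ∈ I, if e i ∣ n then c i else 0) ^ 2 := by
    rw [← nsmul_eq_mul, ← Finset.sum_const]
    have hsub : ((Finset.Ico 1 (X + 1)).filter fun P => P.Prime ∧ R < P ∧ P ≡ r [MOD q]) ⊆ T := by
      intro P hP
      rw [Finset.mem_filter] at hP
      exact Finset.mem_filter.2 ⟨hP.1, hP.2.2.2⟩
    refine le_trans (Finset.sum_le_sum fun P hP => le_of_eq ?_)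
      (Finset.sum_le_sum_of_subset_of_nonneg hsub fun _ _ _ => sq_nonneg _)
    rw [Finset.mem_filter] at hP
    congr 1
    rw [hI, Finset.sum_sigma, hJ]
    refine Finset.sum_congr rfl fun k hk => ?_
    obtain ⟨hk1, hk2, hk3⟩ := hK k hk
    rw [Finset.sum_eq_single 1]
    · simp [he, hc]
    · intro d hd hd1
      have hdk := Nat.mem_divisors.1 hd
      rw [if_neg]
      intro hdP
      rcases (Nat.dvd_prime hP.2.1).1 hdP with h | h
      · exact hd1 h
      · have := Nat.le_of_dvd (Nat.pos_of_ne_zero hdk.2) hdk.1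
        have h3 := hP.2.2.1
        change d = P at h
        omega
    · intro h
      exact absurd (Nat.mem_divisors.2 ⟨one_dvd _, hk1.ne_zero⟩) h
  -- the count
  have hcount : ∀ i ∈ I, ∀ j ∈ I, |((T.filter fun n => (e i).lcm (e j) ∣ n).card : ℝ)
      - X / (q * ((e i).lcm (e j) : ℕ))| ≤ 1 := by
    intro i hi j hj
    obtain ⟨hi1, hi2, hi3⟩ := hIm i hi
    obtain ⟨hj1, hj2, hj3⟩ := hIm j hj
    have hcop : q.Coprime ((e i).lcm (e j)) := by
      rw [Nat.Prime.coprime_iff_not_dvd hq]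
      intro h
      have h2 : q ∣ e i * e j := h.trans (Nat.lcm_dvd_mul _ _)
      rcases hq.dvd_mul.1 h2 with h3 | h3
      · exact (hK _ hi1).2.1 (h3.trans hi2)
      · exact (hK _ hj1).2.1 (h3.trans hj2)
    have h := abs_card_modEq_modEq_sub_le (A := 1) (B := X + 1) (by omega) hq.pos
      (Nat.pos_of_ne_zero (Nat.lcm_ne_zero hi3 hj3)) hcop r 0
    rw [hT, Finset.filter_filter]
    convert h using 4
    · congr 2
      ext x
      rw [Nat.modEq_zero_iff_dvd]
    · push_cast; ring
  have hsum : ∑ i ∈ I, ∑ j ∈ I, c i * c j * ((T.filter fun n => (e i).lcm (e j) ∣ n).card : ℝ)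
      ≤ ∑ i ∈ I, ∑ j ∈ I, c i * c j * (X / (q * ((e i).lcm (e j) : ℕ)))
        + (∑ i ∈ I, |c i|) ^ 2 := by
    rw [sq, Finset.sum_mul_sum, ← Finset.sum_add_distrib]
    refine Finset.sum_le_sum fun i hi => ?_
    rw [← Finset.sum_add_distrib]
    refine Finset.sum_le_sum fun j hj => ?_
    have h1 := hcount i hi j hj
    have h2 : |c i * c j * (((T.filter fun n => (e i).lcm (e j) ∣ n).card : ℝ)
      - X / (q * ((e i).lcm (e j) : ℕ)))| ≤ |c i| * |c j| := by
      rw [abs_mul, abs_mul]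
      exact mul_le_of_le_one_right (by positivity) h1
    have h3 := (abs_le.1 h2).2
    linarith
  have hdiag : ∑ i ∈ I, ∑ j ∈ I, c i * c j * (X / (q * ((e i).lcm (e j) : ℕ))) = X / q * J := by
    have h1 : ∀ i ∈ I, ∀ j ∈ I, c i * c j * (X / (q * ((e i).lcm (e j) : ℕ)))
        = X / q * ((i.1.totient : ℝ)⁻¹ * (j.1.totient : ℝ)⁻¹ *
          ((ArithmeticFunction.moebius i.2 * ArithmeticFunction.moebius j.2 *
            (i.2.gcd j.2 : ℤ) : ℤ) : ℝ)) := by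
      intro i hi j hj
      obtain ⟨hi1, hi2, hi3⟩ := hIm i hi
      obtain ⟨hj1, hj2, hj3⟩ := hIm j hj
      have hl := Nat.lcm_ne_zero hi3 hj3
      have hg : ((i.2.gcd j.2 : ℕ) : ℝ) * (i.2.lcm j.2 : ℕ) = i.2 * j.2 := by
        exact_mod_cast Nat.gcd_mul_lcm i.2 j.2
      have hl' : ((i.2.lcm j.2 : ℕ) : ℝ) ≠ 0 := by exact_mod_cast hl
      simp only [hc, he]
      push_cast
      rw [eq_div_of_mul_eq hl' hg]
      ring
    rw [Finset.sum_congr rfl fun i hi => Finset.sum_congr rfl fun j hj => h1 i hi j hj]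
    simp_rw [← Finset.mul_sum]
    congr 1
    rw [hI]
    simp_rw [Finset.sum_sigma]
    rw [hJ]
    refine Finset.sum_congr rfl fun k hk => ?_
    rw [Finset.sum_comm]
    have h2 : ∀ k' ∈ K, ∑ x ∈ k.divisors, ∑ y ∈ k'.divisors,
        ((k.totient : ℝ)⁻¹ * (k'.totient : ℝ)⁻¹ *
          ((ArithmeticFunction.moebius x * ArithmeticFunction.moebius y *
            (x.gcd y : ℤ) : ℤ) : ℝ)) = if k = k' then (k.totient : ℝ)⁻¹ else 0 := by
      intro k' hk'
      simp_rw [← Finset.mul_sum]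
      have := congrArg (fun z : ℤ => (z : ℝ))
        (sum_moebius_mul_moebius_mul_gcd (hK k hk).1 (hK k' hk').1)
      simp only [Int.cast_sum] at this
      rw [this]
      split_ifs with h
      · subst h
        have : (k.totient : ℝ) ≠ 0 := by
          have := Nat.totient_pos.2 (Nat.pos_of_ne_zero (hK k hk).1.ne_zero)
          positivity
        push_cast
        field_simp
      · simp
    rw [Finset.sum_congr rfl h2]
    simp [hk]
  have herr : ∑ i ∈ I, |c i| ≤ (R : ℝ) ^ 3 := by
    have h1 : ∀ i ∈ I, |c i| ≤ R := by
      intro i hi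
      obtain ⟨hi1, hi2, hi3⟩ := hIm i hi
      have hk0 := (hK _ hi1).1.ne_zero
      have hm : |((ArithmeticFunction.moebius i.2 : ℤ) : ℝ)| ≤ 1 := by
        exact_mod_cast ArithmeticFunction.abs_moebius_le_one
      have h2 : (1 : ℝ) ≤ i.1.totient := by
        exact_mod_cast Nat.totient_pos.2 (Nat.pos_of_ne_zero hk0)
      have h3 : (i.2 : ℝ) ≤ R := by
        exact_mod_cast (Nat.le_of_dvd (Nat.pos_of_ne_zero hk0) hi2).trans (hK _ hi1).2.2
      simp only [hc]
      rw [abs_mul, abs_mul, abs_of_nonneg (by positivity : (0 : ℝ) ≤ (i.1.totient : ℝ)⁻¹),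
        abs_of_nonneg (by positivity : (0 : ℝ) ≤ (i.2 : ℝ))]
      have h4 : ((i.1.totient : ℝ))⁻¹ ≤ 1 := inv_le_one_of_one_le₀ h2
      calc _ ≤ 1 * (R : ℝ) * 1 := by gcongr
        _ = R := by ring
    have h2 : (I.card : ℝ) ≤ R * R := by
      rw [hI, Finset.card_sigma]
      have : ∑ k ∈ K, k.divisors.card ≤ ∑ k ∈ K, R :=
        Finset.sum_le_sum fun k hk => (Nat.card_divisors_le_self k).trans (hK k hk).2.2
      rw [Finset.sum_const, smul_eq_mul] at this
      exact_mod_cast this.trans (Nat.mul_le_mul_right _ hKR)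
    calc _ ≤ ∑ i ∈ I, (R : ℝ) := Finset.sum_le_sum h1
      _ = I.card * R := by simp
      _ ≤ R * R * R := by gcongr
      _ = _ := by ring
  have herr2 : (∑ i ∈ I, |c i|) ^ 2 ≤ (R : ℝ) ^ 6 := by
    calc _ ≤ ((R : ℝ) ^ 3) ^ 2 := by gcongr
      _ = _ := by ring
  linarith

open Finset in
theorem sum_inv_le_two_mul_squarefree (R : ℕ) :
    ∑ n ∈ Icc 1 R, (n : ℝ)⁻¹ ≤ 2 * ∑ k ∈ (Icc 1 R).filter Squarefree, (k : ℝ)⁻¹ := by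
  have h1 : ∀ n ∈ Icc 1 R, (n : ℝ)⁻¹ ≤ ∑ z ∈ ((Icc 1 R).filter Squarefree ×ˢ Icc 1 R).filter
      (fun z => z.2 ^ 2 * z.1 = n), (z.1 : ℝ)⁻¹ * ((z.2 : ℝ) ^ 2)⁻¹ := by
    intro n hn
    rw [mem_Icc] at hn
    obtain ⟨k, b, hb, hk⟩ := Nat.sq_mul_squarefree n
    have hk0 : k ≠ 0 := hk.ne_zero
    have hb0 : b ≠ 0 := fun h => by rw [h] at hb; simp at hb; omega
    have hkn : k ≤ n := by rw [← hb]; exact Nat.le_mul_of_pos_left _ (by positivity)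
    have hbn : b ≤ n := by
      rw [← hb, sq, mul_assoc]
      exact Nat.le_mul_of_pos_right _ (Nat.pos_of_ne_zero (mul_ne_zero hb0 hk0))
    have hmem : (k, b) ∈ ((Icc 1 R).filter Squarefree ×ˢ Icc 1 R).filter
        (fun z => z.2 ^ 2 * z.1 = n) := by
      simp only [mem_filter, mem_product, mem_Icc]
      exact ⟨⟨⟨⟨by omega, by omega⟩, hk⟩, by omega, by omega⟩, hb⟩
    refine le_trans (le_of_eq ?_) (single_le_sum (fun _ _ => by positivity) hmem)
    rw [← hb]
    push_cast
    rw [mul_inv, mul_comm]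
  calc _ ≤ ∑ n ∈ Icc 1 R, ∑ z ∈ ((Icc 1 R).filter Squarefree ×ˢ Icc 1 R).filter
          (fun z => z.2 ^ 2 * z.1 = n), (z.1 : ℝ)⁻¹ * ((z.2 : ℝ) ^ 2)⁻¹ := sum_le_sum h1
    _ ≤ ∑ z ∈ ((Icc 1 R).filter Squarefree ×ˢ Icc 1 R), (z.1 : ℝ)⁻¹ * ((z.2 : ℝ) ^ 2)⁻¹ := by
        have h2 : ∀ n ∈ Icc 1 R, ∑ z ∈ ((Icc 1 R).filter Squarefree ×ˢ Icc 1 R).filter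
            (fun z => z.2 ^ 2 * z.1 = n), (z.1 : ℝ)⁻¹ * ((z.2 : ℝ) ^ 2)⁻¹ =
            ∑ z ∈ (((Icc 1 R).filter Squarefree ×ˢ Icc 1 R).filter
              (fun z => z.2 ^ 2 * z.1 ∈ Icc 1 R)).filter
            (fun z => z.2 ^ 2 * z.1 = n), (z.1 : ℝ)⁻¹ * ((z.2 : ℝ) ^ 2)⁻¹ := by
          intro n hn
          rw [filter_filter]
          refine sum_congr (filter_congr fun z _ => ?_) fun _ _ => rfl
          constructor
          · rintro rfl; exact ⟨hn, rfl⟩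
          · exact fun h => h.2
        rw [sum_congr rfl h2, sum_fiberwise_of_maps_to]
        · exact sum_le_sum_of_subset_of_nonneg (filter_subset _ _) fun _ _ _ => by positivity
        · intro z hz
          exact (mem_filter.1 hz).2
    _ = (∑ k ∈ (Icc 1 R).filter Squarefree, (k : ℝ)⁻¹) * ∑ b ∈ Icc 1 R, ((b : ℝ) ^ 2)⁻¹ := by
        rw [sum_product, sum_mul_sum]
    _ ≤ (∑ k ∈ (Icc 1 R).filter Squarefree, (k : ℝ)⁻¹) * 2 := by
        gcongr
        rcases Nat.eq_zero_or_pos R with rfl | hR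
        · simp
        · have h3 : Icc 1 R = insert 1 (Ioc 1 R) := by
            ext x; simp only [mem_Icc, mem_insert, mem_Ioc]; omega
          rw [h3, sum_insert (by simp)]
          have := sum_Ioc_inv_sq_le (m := 1) le_rfl R
          norm_num at this ⊢
          linarith
    _ = _ := mul_comm _ _

open Finset in
theorem log_le_four_mul_sum_inv_totient {q : ℕ} (hq : q.Prime) (R : ℕ) :
    Real.log R ≤ 4 * ∑ k ∈ (Icc 1 R).filter (fun k => Squarefree k ∧ ¬ q ∣ k),
      (k.totient : ℝ)⁻¹ := by
  set K := (Icc 1 R).filter (fun k => Squarefree k ∧ ¬ q ∣ k) with hK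
  have h1 := (log_le_sum_Icc_inv R).trans (sum_inv_le_two_mul_squarefree R)
  have h2 : ∑ k ∈ (Icc 1 R).filter Squarefree, (k : ℝ)⁻¹ ≤
      ∑ k ∈ K, (k : ℝ)⁻¹ + ∑ k ∈ K, (k : ℝ)⁻¹ := by
    rw [← sum_filter_add_sum_filter_not ((Icc 1 R).filter Squarefree) (fun k => ¬ q ∣ k),
      filter_filter, filter_filter]
    refine add_le_add le_rfl ?_
    have h3 : (Icc 1 R).filter (fun k => Squarefree k ∧ ¬ ¬ q ∣ k) ⊆ K.image (q * ·) := by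
      intro k hk
      simp only [mem_filter, mem_Icc, not_not] at hk
      obtain ⟨⟨h4, h5⟩, h6, ⟨t, rfl⟩⟩ := hk
      refine mem_image.2 ⟨t, ?_, rfl⟩
      simp only [hK, mem_filter, mem_Icc]
      have ht : t ≠ 0 := fun h => by simp [h] at h4
      refine ⟨⟨by omega, ?_⟩, h6.squarefree_of_dvd (dvd_mul_left _ _), ?_⟩
      · exact (Nat.le_mul_of_pos_left _ hq.pos).trans h5
      · rw [← Nat.Prime.coprime_iff_not_dvd hq]
        exact Nat.coprime_of_squarefree_mul h6
    refine (sum_le_sum_of_subset_of_nonneg h3 fun _ _ _ => by positivity).trans ?_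
    rw [sum_image (fun a _ b _ h => Nat.eq_of_mul_eq_mul_left hq.pos h)]
    refine sum_le_sum fun k hk => ?_
    have hk0 : 1 ≤ k := (mem_Icc.1 (mem_filter.1 hk).1).1
    apply inv_anti₀
    · positivity
    · exact_mod_cast Nat.le_mul_of_pos_left _ hq.pos
  have h4 : ∑ k ∈ K, (k : ℝ)⁻¹ ≤ ∑ k ∈ K, (k.totient : ℝ)⁻¹ := by
    refine sum_le_sum fun k hk => ?_
    have hk0 : 1 ≤ k := (mem_Icc.1 (mem_filter.1 hk).1).1
    apply inv_anti₀
    · exact_mod_cast Nat.totient_pos.2 hk0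
    · exact_mod_cast Nat.totient_le k
  linarith

/-- A Brun–Titchmarsh type bound. -/
theorem card_prime_modEq_le {q : ℕ} (hq : q.Prime) (r X : ℕ) {R : ℕ} (hR : 2 ≤ R) :
    (((Finset.Ico 1 (X + 1)).filter fun P => P.Prime ∧ R < P ∧ P ≡ r [MOD q]).card : ℝ)
      ≤ 4 * X / (q * Real.log R) + (R : ℝ) ^ 6 := by
  have h := card_prime_modEq_mul_sq_le hq r X R
    ((Finset.Icc 1 R).filter (fun k => Squarefree k ∧ ¬ q ∣ k))
    (fun k hk => by
      rw [Finset.mem_filter, Finset.mem_Icc] at hk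
      exact ⟨hk.2.1, hk.2.2, hk.1.2⟩)
    ((Finset.card_filter_le _ _).trans (by simp))
  have hl := log_le_four_mul_sum_inv_totient hq R
  have h1 : 1 ≤ ∑ k ∈ (Finset.Icc 1 R).filter (fun k => Squarefree k ∧ ¬ q ∣ k),
      (k.totient : ℝ)⁻¹ := by
    have hm : 1 ∈ (Finset.Icc 1 R).filter (fun k => Squarefree k ∧ ¬ q ∣ k) := by
      simp only [Finset.mem_filter, Finset.mem_Icc]
      exact ⟨⟨le_rfl, by omega⟩, squarefree_one, fun h => hq.one_lt.ne' (Nat.dvd_one.1 h)⟩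
    have := Finset.single_le_sum (f := fun k : ℕ => (k.totient : ℝ)⁻¹)
      (fun _ _ => by positivity) hm
    simpa using this
  set J := ∑ k ∈ (Finset.Icc 1 R).filter (fun k => Squarefree k ∧ ¬ q ∣ k), (k.totient : ℝ)⁻¹
  set c := (((Finset.Ico 1 (X + 1)).filter fun P => P.Prime ∧ R < P ∧ P ≡ r [MOD q]).card : ℝ)
  have hq0 : (0 : ℝ) < q := by exact_mod_cast hq.pos
  have hlog : 0 < Real.log R := Real.log_pos (by exact_mod_cast hR)
  have h2 : c ≤ X / q / J + (R : ℝ) ^ 6 / J ^ 2 := by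
    have : c ≤ (X / q * J + (R : ℝ) ^ 6) / J ^ 2 := by
      rw [le_div_iff₀ (by positivity)]
      exact h
    refine this.trans (le_of_eq ?_)
    field_simp
  have h3 : (R : ℝ) ^ 6 / J ^ 2 ≤ (R : ℝ) ^ 6 :=
    div_le_self (by positivity) (one_le_pow₀ h1)
  have h4 : X / q / J ≤ 4 * X / (q * Real.log R) := by
    rw [div_div, div_le_div_iff₀ (by positivity) (by positivity)]
    have : (X : ℝ) * q * Real.log R ≤ X * q * (4 * J) := by gcongr
    linarith
  linarith

theorem eq_sum_range_of_periodic {F : ℕ → ℝ} {d : ℕ} (hd : 0 < d) (hF : Function.Periodic F d)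
    (n : ℕ) : F n = ∑ t ∈ Finset.range d, if n ≡ t [MOD d] then F t else 0 := by
  rw [Finset.sum_eq_single (n % d)]
  · rw [if_pos (Nat.mod_modEq n d).symm, hF.map_mod_nat]
  · intro t ht h
    rw [if_neg]
    intro h2
    rw [Finset.mem_range] at ht
    rw [Nat.ModEq, Nat.mod_eq_of_lt ht] at h2
    exact h h2.symm
  · intro h
    exact absurd (Finset.mem_range.2 (Nat.mod_lt n hd)) h

theorem abs_sum_mul_periodic_le {F F' : ℕ → ℝ} {d d' : ℕ} (hd : 0 < d) (hd' : 0 < d')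
    (hF : Function.Periodic F d) (hF' : Function.Periodic F' d') (hdd : d.Coprime d')
    (h0 : ∑ t ∈ Finset.range d, F t = 0) {A B : ℕ} (hAB : A ≤ B) :
    |∑ n ∈ Finset.Ico A B, F n * F' n|
      ≤ (∑ t ∈ Finset.range d, |F t|) * ∑ t ∈ Finset.range d', |F' t| := by
  set C : ℕ → ℕ → ℝ := fun t t' =>
    (((Finset.Ico A B).filter fun n => n ≡ t [MOD d] ∧ n ≡ t' [MOD d']).card : ℝ) with hC
  have h1 : ∑ n ∈ Finset.Ico A B, F n * F' n = ∑ t ∈ Finset.range d, ∑ t' ∈ Finset.range d',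
      F t * F' t' * C t t' := by
    have : ∀ n ∈ Finset.Ico A B, F n * F' n = ∑ t ∈ Finset.range d, ∑ t' ∈ Finset.range d',
        F t * F' t' * (if n ≡ t [MOD d] ∧ n ≡ t' [MOD d'] then 1 else 0) := by
      intro n _
      rw [eq_sum_range_of_periodic hd hF n, eq_sum_range_of_periodic hd' hF' n,
        Finset.sum_mul_sum]
      refine Finset.sum_congr rfl fun t _ => Finset.sum_congr rfl fun t' _ => ?_
      by_cases a : n ≡ t [MOD d] <;> by_cases b : n ≡ t' [MOD d'] <;> simp [a, b]
    rw [Finset.sum_congr rfl this, Finset.sum_comm]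
    refine Finset.sum_congr rfl fun t _ => ?_
    rw [Finset.sum_comm]
    refine Finset.sum_congr rfl fun t' _ => ?_
    rw [← Finset.mul_sum, hC]
    simp
  have h2 : ∑ t ∈ Finset.range d, ∑ t' ∈ Finset.range d',
      F t * F' t' * (((B : ℝ) - A) / (d * d')) = 0 := by
    simp_rw [← Finset.sum_mul]
    rw [← Finset.sum_mul_sum, h0]
    simp
  rw [h1, ← sub_zero (∑ t ∈ Finset.range d, _), ← h2, ← Finset.sum_sub_distrib, Finset.sum_mul_sum]
  refine (Finset.abs_sum_le_sum_abs _ _).trans (Finset.sum_le_sum fun t _ => ?_)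
  rw [← Finset.sum_sub_distrib]
  refine (Finset.abs_sum_le_sum_abs _ _).trans (Finset.sum_le_sum fun t' _ => ?_)
  rw [← mul_sub, abs_mul, abs_mul]
  exact mul_le_of_le_one_right (by positivity)
    (abs_card_modEq_modEq_sub_le hAB hd hd' hdd t t')

/-- The deviation of the indicator of `s ≡ -a (mod d)` from its mean over reduced residues. -/
noncomputable def residueDefect (a : ℤ) (d s : ℕ) : ℝ :=
  (if (d : ℤ) ∣ s + a then 1 else 0) - (if d.Coprime s then (d.totient : ℝ)⁻¹ else 0)

theorem coprime_of_dvd_add {a : ℤ} {d s : ℕ} (ha : IsCoprime (d : ℤ) a) (h : (d : ℤ) ∣ s + a) :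
    d.Coprime s := by
  rw [← Nat.isCoprime_iff_coprime]
  obtain ⟨t, ht⟩ := h
  have : (s : ℤ) = -a + d * t := by linarith
  rw [this]
  exact (IsCoprime.add_mul_left_right ha.neg_right t)

theorem modEq_of_dvd_add {a : ℤ} {d k n n' : ℕ} (ha : IsCoprime (d : ℤ) a)
    (h : (d : ℤ) ∣ (k * n : ℕ) + a) (h' : (d : ℤ) ∣ (k * n' : ℕ) + a) : n ≡ n' [MOD d] := by
  have hk : d.Coprime k := Nat.Coprime.coprime_mul_right_right (coprime_of_dvd_add ha h)
  have h2 : (d : ℤ) ∣ k * ((n' : ℤ) - n) := by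
    have := dvd_sub h' h
    push_cast at this
    have e : (k : ℤ) * ((n' : ℤ) - n) = k * n' + a - (k * n + a) := by ring
    rw [e]
    exact this
  rw [Nat.modEq_iff_dvd]
  exact (Nat.isCoprime_iff_coprime.2 hk).dvd_of_dvd_mul_left h2

theorem residueDefect_periodic (a : ℤ) (d k : ℕ) :
    Function.Periodic (fun n => residueDefect a d (k * n)) d := by
  intro n
  simp only [residueDefect]
  congr 2
  · have : (((k * (n + d) : ℕ) : ℤ) + a) = ((k * n : ℕ) : ℤ) + a + d * k := by push_cast; ring
    rw [this]
    exact propext (dvd_add_left (dvd_mul_right _ _))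
  · have : k * (n + d) = k * n + k * d := by ring
    rw [this]
    exact propext (Nat.coprime_add_mul_right_right d (k * n) k)

theorem residueDefect_eq_zero {a : ℤ} {d k : ℕ} (ha : IsCoprime (d : ℤ) a) (hk : ¬ d.Coprime k)
    (n : ℕ) : residueDefect a d (k * n) = 0 := by
  have h2 : ¬ d.Coprime (k * n) := fun h => hk (Nat.Coprime.coprime_mul_right_right h)
  rw [residueDefect, if_neg h2, if_neg (fun h => h2 (coprime_of_dvd_add ha h)), sub_zero]

theorem card_range_dvd_add {a : ℤ} {d k : ℕ} (hd : 0 < d) (hk : d.Coprime k) :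
    ((Finset.range d).filter fun n => (d : ℤ) ∣ (k * n : ℕ) + a).card = 1 := by
  obtain ⟨r, s, hrs⟩ := Nat.isCoprime_iff_coprime.2 hk
  have hd' : (0 : ℤ) < d := by exact_mod_cast hd
  have hv0 := Int.emod_nonneg (-a * s) hd'.ne'
  have hv1 := Int.emod_lt_of_pos (-a * s) hd'
  rw [Finset.card_eq_one]
  refine ⟨((-a * s) % d).toNat, ?_⟩
  have hv2 : (d : ℤ) ∣ (((-a * s) % d).toNat : ℤ) - (-a * s) := by
    rw [Int.toNat_of_nonneg hv0]
    have := Int.dvd_sub_self_of_emod_eq (a := -a * s) (b := d) rfl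
    exact this
  set v := ((-a * s) % d).toNat
  have hvd : v < d := by omega
  ext n
  simp only [Finset.mem_filter, Finset.mem_range, Finset.mem_singleton]
  have key : ((d : ℤ) ∣ (k * n : ℕ) + a) ↔ (d : ℤ) ∣ (n : ℤ) - v := by
    obtain ⟨t, ht⟩ := hv2
    constructor
    · rintro ⟨w, hw⟩
      push_cast at hw
      refine ⟨s * w + r * n - t, ?_⟩
      have : (n : ℤ) - v = n * (r * d + s * k) - v := by rw [hrs]; ring
      rw [this]
      linear_combination s * hw - ht
    · rintro ⟨w, hw⟩
      push_cast
      refine ⟨k * w + k * t + a * r, ?_⟩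
      linear_combination k * hw + k * ht - a * hrs
  constructor
  · rintro ⟨h1, h2⟩
    obtain ⟨w, hw⟩ := key.1 h2
    have : w = 0 := by
      by_contra h
      rcases lt_or_gt_of_ne h with h | h
      · nlinarith
      · nlinarith
    rw [this] at hw
    omega
  · rintro rfl
    exact ⟨hvd, key.2 (by simp)⟩

theorem card_range_coprime_mul {d k : ℕ} (hk : d.Coprime k) :
    ((Finset.range d).filter fun n => d.Coprime (k * n)).card = d.totient := by
  rw [Nat.totient]
  congr 1
  refine Finset.filter_congr fun n _ => ?_
  rw [Nat.coprime_mul_iff_right]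
  exact ⟨fun h => h.2, fun h => ⟨hk, h⟩⟩

theorem sum_range_residueDefect {a : ℤ} {d k : ℕ} (ha : IsCoprime (d : ℤ) a) (hd : 0 < d) :
    ∑ n ∈ Finset.range d, residueDefect a d (k * n) = 0 := by
  by_cases hk : d.Coprime k
  · simp only [residueDefect]
    rw [Finset.sum_sub_distrib, ← Finset.sum_filter, ← Finset.sum_filter, Finset.sum_const,
      Finset.sum_const, card_range_dvd_add hd hk, card_range_coprime_mul hk]
    have : (d.totient : ℝ) ≠ 0 := by exact_mod_cast (Nat.totient_pos.2 hd).ne'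
    simp [this]
  · exact Finset.sum_eq_zero fun n _ => residueDefect_eq_zero ha hk n

theorem sum_range_abs_residueDefect_le {a : ℤ} {d k : ℕ} (ha : IsCoprime (d : ℤ) a) (hd : 0 < d) :
    ∑ n ∈ Finset.range d, |residueDefect a d (k * n)| ≤ 2 := by
  by_cases hk : d.Coprime k
  · have h1 : ∀ n ∈ Finset.range d, |residueDefect a d (k * n)| ≤
        (if (d : ℤ) ∣ (k * n : ℕ) + a then 1 else 0) +
          (if d.Coprime (k * n) then (d.totient : ℝ)⁻¹ else 0) := by
      intro n _
      rw [residueDefect]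
      refine (abs_sub _ _).trans (le_of_eq ?_)
      rw [abs_of_nonneg (by positivity), abs_of_nonneg (by positivity)]
    refine (Finset.sum_le_sum h1).trans (le_of_eq ?_)
    rw [Finset.sum_add_distrib, ← Finset.sum_filter, ← Finset.sum_filter, Finset.sum_const,
      Finset.sum_const, card_range_dvd_add hd hk, card_range_coprime_mul hk]
    have : (d.totient : ℝ) ≠ 0 := by exact_mod_cast (Nat.totient_pos.2 hd).ne'
    simp [this]
    norm_num
  · rw [Finset.sum_eq_zero fun n _ => by rw [residueDefect_eq_zero ha hk n, abs_zero]]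
    norm_num

theorem card_le_of_pairwise_modEq {A B m : ℕ} (hAB : A ≤ B) (hm : 0 < m) {S : Finset ℕ}
    (hS : S ⊆ Finset.Ico A B) (h : ∀ n ∈ S, ∀ n' ∈ S, n ≡ n' [MOD m]) :
    (S.card : ℝ) ≤ ((B : ℝ) - A) / m + 1 := by
  have hAB' : (A : ℝ) ≤ B := by exact_mod_cast hAB
  rcases S.eq_empty_or_nonempty with rfl | ⟨v, hv⟩
  · have : 0 ≤ ((B : ℝ) - A) / m := div_nonneg (by linarith) (by positivity)
    simp
    linarith
  · have h1 : S ⊆ (Finset.Ico A B).filter fun n => n ≡ v [MOD m] := fun n hn =>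
      Finset.mem_filter.2 ⟨hS hn, h n hn v hv⟩
    have h2 : (S.card : ℝ) ≤ ((Finset.Ico A B).filter fun n => n ≡ v [MOD m]).card := by
      exact_mod_cast Finset.card_le_card h1
    have h3 := (abs_le.1 (abs_card_modEq_sub_le hAB hm v)).2
    linarith

theorem abs_residueDefect_le (a : ℤ) {d : ℕ} (s : ℕ) (hd : 0 < d) (h2 : d ≤ 2 * d.totient) :
    |residueDefect a d s| ≤ (if (d : ℤ) ∣ s + a then 1 else 0) + 2 / d := by
  have hφ : (0 : ℝ) < d.totient := by exact_mod_cast Nat.totient_pos.2 hd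
  have hd' : (0 : ℝ) < d := by exact_mod_cast hd
  have h3 : (d.totient : ℝ)⁻¹ ≤ 2 / d := by
    rw [inv_eq_one_div, div_le_div_iff₀ hφ hd']
    have : (d : ℝ) ≤ 2 * d.totient := by exact_mod_cast h2
    linarith
  rw [residueDefect]
  refine (abs_sub _ _).trans ?_
  rw [abs_of_nonneg (by positivity), abs_of_nonneg (by positivity)]
  gcongr
  split_ifs
  · exact h3
  · positivity

theorem card_dvd_add_le {a : ℤ} {d k : ℕ} (ha : IsCoprime (d : ℤ) a) (hd : 0 < d) {A B : ℕ}
    (hAB : A ≤ B) :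
    (((Finset.Ico A B).filter fun n => (d : ℤ) ∣ (k * n : ℕ) + a).card : ℝ)
      ≤ ((B : ℝ) - A) / d + 1 :=
  card_le_of_pairwise_modEq hAB hd (Finset.filter_subset _ _) fun _ hn _ hn' =>
    modEq_of_dvd_add ha (Finset.mem_filter.1 hn).2 (Finset.mem_filter.1 hn').2

theorem card_dvd_add_and_dvd_add_le {a : ℤ} {d d' c q q' : ℕ} (ha : IsCoprime (d : ℤ) a)
    (ha' : IsCoprime (d' : ℤ) a) (hd : 0 < d) (hd' : 0 < d') {A B : ℕ} (hAB : A ≤ B) :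
    (((Finset.Ico A B).filter fun n => (d : ℤ) ∣ (c * q * n : ℕ) + a ∧
      (d' : ℤ) ∣ (c * q' * n : ℕ) + a).card : ℝ)
      ≤ if q ≡ q' [MOD d.gcd d'] then ((B : ℝ) - A) * d.gcd d' / (d * d') + 1 else 0 := by
  split_ifs with h
  · have h1 := card_le_of_pairwise_modEq (S := (Finset.Ico A B).filter fun n =>
        (d : ℤ) ∣ (c * q * n : ℕ) + a ∧ (d' : ℤ) ∣ (c * q' * n : ℕ) + a) hAB
      (Nat.pos_of_ne_zero (Nat.lcm_ne_zero hd.ne' hd'.ne')) (Finset.filter_subset _ _)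
      (fun n hn n' hn' => by
        have h1 := (Finset.mem_filter.1 hn).2
        have h2 := (Finset.mem_filter.1 hn').2
        have h3 := modEq_of_dvd_add ha h1.1 h2.1
        have h4 := modEq_of_dvd_add ha' h1.2 h2.2
        rw [Nat.modEq_iff_dvd, Int.natCast_dvd] at h3 h4 ⊢
        exact Nat.lcm_dvd h3 h4)
    refine h1.trans (le_of_eq ?_)
    have hg : ((d.gcd d' : ℕ) : ℝ) * (d.lcm d' : ℕ) = d * d' := by
      exact_mod_cast Nat.gcd_mul_lcm d d'
    have hl : ((d.lcm d' : ℕ) : ℝ) ≠ 0 := by exact_mod_cast Nat.lcm_ne_zero hd.ne' hd'.ne'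
    have hg0 : ((d.gcd d' : ℕ) : ℝ) ≠ 0 := by exact_mod_cast (Nat.gcd_pos_of_pos_left _ hd).ne'
    rw [← hg]
    field_simp
  · have : ((Finset.Ico A B).filter fun n => (d : ℤ) ∣ (c * q * n : ℕ) + a ∧
      (d' : ℤ) ∣ (c * q' * n : ℕ) + a) = ∅ := by
      rw [Finset.filter_eq_empty_iff]
      rintro n _ ⟨h1, h2⟩
      apply h
      have hg : IsCoprime ((d.gcd d' : ℕ) : ℤ) a :=
        ha.of_isCoprime_of_dvd_left (by exact_mod_cast Nat.gcd_dvd_left d d')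
      have h3 : ((d.gcd d' : ℕ) : ℤ) ∣ ((c * n * q : ℕ) : ℤ) + a := by
        rw [show c * n * q = c * q * n by ring]
        exact dvd_trans (by exact_mod_cast Nat.gcd_dvd_left d d') h1
      have h4 : ((d.gcd d' : ℕ) : ℤ) ∣ ((c * n * q' : ℕ) : ℤ) + a := by
        rw [show c * n * q' = c * q' * n by ring]
        exact dvd_trans (by exact_mod_cast Nat.gcd_dvd_right d d') h2
      exact modEq_of_dvd_add hg h3 h4
    rw [this]
    simp

theorem abs_sum_residueDefect_mul_le {a : ℤ} {d d' c q q' : ℕ} (ha : IsCoprime (d : ℤ) a)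
    (ha' : IsCoprime (d' : ℤ) a) (hd : 0 < d) (hd' : 0 < d') (hφ : d ≤ 2 * d.totient)
    (hφ' : d' ≤ 2 * d'.totient) {A B : ℕ} (hAB : A ≤ B) :
    |∑ n ∈ Finset.Ico A B, residueDefect a d (c * q * n) * residueDefect a d' (c * q' * n)|
      ≤ (if q ≡ q' [MOD d.gcd d'] then ((B : ℝ) - A) * d.gcd d' / (d * d') + 1 else 0)
        + 8 * ((B : ℝ) - A) / (d * d') + 4 := by
  have hdR : (1 : ℝ) ≤ d := by exact_mod_cast hd
  have hdR' : (1 : ℝ) ≤ d' := by exact_mod_cast hd'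
  have hAB' : (A : ℝ) ≤ B := by exact_mod_cast hAB
  have h1 : ∀ n ∈ Finset.Ico A B,
      |residueDefect a d (c * q * n) * residueDefect a d' (c * q' * n)| ≤
      (if (d : ℤ) ∣ (c * q * n : ℕ) + a ∧ (d' : ℤ) ∣ (c * q' * n : ℕ) + a then 1 else 0) +
      (if (d : ℤ) ∣ (c * q * n : ℕ) + a then 1 else 0) * (2 / d') +
      (if (d' : ℤ) ∣ (c * q' * n : ℕ) + a then 1 else 0) * (2 / d) + (2 / d) * (2 / d') := by
    intro n _
    rw [abs_mul]
    refine (mul_le_mul (abs_residueDefect_le a _ hd hφ) (abs_residueDefect_le a _ hd' hφ')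
      (abs_nonneg _) (by positivity)).trans (le_of_eq ?_)
    by_cases h1 : (d : ℤ) ∣ (c * q * n : ℕ) + a <;> by_cases h2 : (d' : ℤ) ∣ (c * q' * n : ℕ) + a
      <;> simp only [h1, h2, if_true, if_false, and_true, and_false] <;> ring
  refine (Finset.abs_sum_le_sum_abs _ _).trans ((Finset.sum_le_sum h1).trans ?_)
  rw [Finset.sum_add_distrib, Finset.sum_add_distrib, Finset.sum_add_distrib, ← Finset.sum_mul,
    ← Finset.sum_mul, Finset.sum_boole, Finset.sum_boole, Finset.sum_boole, Finset.sum_const,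
    Nat.card_Ico, nsmul_eq_mul, Nat.cast_sub hAB]
  have b1 := card_dvd_add_and_dvd_add_le (c := c) (q := q) (q' := q') ha ha' hd hd' hAB
  have b2 := card_dvd_add_le (k := c * q) ha hd hAB
  have b3 := card_dvd_add_le (k := c * q') ha' hd' hAB
  have b2' := mul_le_mul_of_nonneg_right b2 (by positivity : (0 : ℝ) ≤ 2 / d')
  have b3' := mul_le_mul_of_nonneg_right b3 (by positivity : (0 : ℝ) ≤ 2 / d)
  have e : (((B : ℝ) - A) / d + 1) * (2 / d') + (((B : ℝ) - A) / d' + 1) * (2 / d)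
      + ((B : ℝ) - A) * (2 / d * (2 / d')) = 8 * ((B : ℝ) - A) / (d * d') + 2 / d' + 2 / d := by
    field_simp
    ring
  have i1 : 2 / (d : ℝ) ≤ 2 := div_le_self (by norm_num) hdR
  have i2 : 2 / (d' : ℝ) ≤ 2 := div_le_self (by norm_num) hdR'
  linarith

theorem sum_range_modEq_le (B g : ℕ) (hg : 0 < g) :
    ∑ q ∈ Finset.range B, ∑ q' ∈ Finset.range B, (if q ≡ q' [MOD g] then (1 : ℝ) else 0)
      ≤ B * (B / g + 1) := by
  calc _ ≤ ∑ q ∈ Finset.range B, ((B : ℝ) / g + 1) := by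
        refine Finset.sum_le_sum fun q _ => ?_
        rw [Finset.sum_boole]
        have := card_le_of_pairwise_modEq (A := 0) (B := B) (Nat.zero_le _) hg
          (S := (Finset.range B).filter fun q' => q ≡ q' [MOD g])
          (by rw [Finset.range_eq_Ico]; exact Finset.filter_subset _ _)
          (fun n hn n' hn' => (Finset.mem_filter.1 hn).2.symm.trans (Finset.mem_filter.1 hn').2)
        simpa using this
    _ = _ := by rw [Finset.sum_const, Finset.card_range, nsmul_eq_mul]

theorem sum_sum_residueDefect_le {a : ℤ} {d d' c : ℕ} (ha : IsCoprime (d : ℤ) a)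
    (ha' : IsCoprime (d' : ℤ) a) (hd : 0 < d) (hd' : 0 < d') (hφ : d ≤ 2 * d.totient)
    (hφ' : d' ≤ 2 * d'.totient) (A B u : ℕ) (w : ℕ → ℕ → ℕ)
    (hw : ∀ q q', u ≤ w q q' ∧ w q q' ≤ u + A) :
    ∑ q ∈ Finset.range B, ∑ q' ∈ Finset.range B, |∑ n ∈ Finset.Ico u (w q q'),
      residueDefect a d (c * q * n) * residueDefect a d' (c * q' * n)|
      ≤ 6 * (B : ℝ) ^ 2 + A * B + if d.Coprime d' then 0 else 9 * (A : ℝ) * B ^ 2 / (d * d') := by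
  have hdR : (1 : ℝ) ≤ d := by exact_mod_cast hd
  have hdR' : (1 : ℝ) ≤ d' := by exact_mod_cast hd'
  split_ifs with hdd
  · have h1 : ∀ q ∈ Finset.range B, ∀ q' ∈ Finset.range B, |∑ n ∈ Finset.Ico u (w q q'),
        residueDefect a d (c * q * n) * residueDefect a d' (c * q' * n)| ≤ 4 := by
      intro q _ q' _
      refine (abs_sum_mul_periodic_le hd hd' (residueDefect_periodic a d (c * q))
        (residueDefect_periodic a d' (c * q')) hdd (sum_range_residueDefect ha hd)
        (hw q q').1).trans ?_
      calc _ ≤ (2 : ℝ) * 2 := mul_le_mul (sum_range_abs_residueDefect_le ha hd)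
            (sum_range_abs_residueDefect_le ha' hd')
            (Finset.sum_nonneg fun _ _ => abs_nonneg _) (by norm_num)
        _ = 4 := by norm_num
    refine (Finset.sum_le_sum fun q hq => Finset.sum_le_sum fun q' hq' => h1 q hq q' hq').trans ?_
    simp only [Finset.sum_const, Finset.card_range, nsmul_eq_mul]
    have : (0 : ℝ) ≤ (A : ℝ) * B := by positivity
    nlinarith [sq_nonneg (B : ℝ)]
  · set g := d.gcd d' with hg
    have hg0 : 0 < g := Nat.gcd_pos_of_pos_left _ hd
    have hgR : (1 : ℝ) ≤ g := by exact_mod_cast hg0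
    have hgd : (g : ℝ) ≤ d * d' := by
      have : g ≤ d * d' := (Nat.le_of_dvd hd (Nat.gcd_dvd_left d d')).trans
        (Nat.le_mul_of_pos_right _ hd')
      exact_mod_cast this
    have h1 : ∀ q ∈ Finset.range B, ∀ q' ∈ Finset.range B, |∑ n ∈ Finset.Ico u (w q q'),
        residueDefect a d (c * q * n) * residueDefect a d' (c * q' * n)| ≤
        (if q ≡ q' [MOD g] then (1 : ℝ) else 0) * ((A : ℝ) * g / (d * d') + 1) +
        (8 * A / (d * d') + 4) := by
      intro q _ q' _
      have h2 := abs_sum_residueDefect_mul_le (c := c) (q := q) (q' := q') ha ha' hd hd' hφ hφ'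
        (hw q q').1
      have h3 : (w q q' : ℝ) - u ≤ A := by
        have : (w q q' : ℝ) ≤ u + A := by exact_mod_cast (hw q q').2
        linarith
      refine h2.trans ?_
      rw [← hg, add_assoc]
      gcongr
      split_ifs
      · rw [one_mul]; gcongr
      · simp
    refine (Finset.sum_le_sum fun q hq => Finset.sum_le_sum fun q' hq' => h1 q hq q' hq').trans ?_
    simp_rw [Finset.sum_add_distrib, ← Finset.sum_mul]
    have h4 := mul_le_mul_of_nonneg_right (sum_range_modEq_le B g hg0)
      (by positivity : (0 : ℝ) ≤ (A : ℝ) * g / (d * d') + 1)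
    simp only [Finset.sum_const, Finset.card_range, nsmul_eq_mul]
    have e : (B : ℝ) * (B / g + 1) * (A * g / (d * d') + 1) =
        A * B ^ 2 / (d * d') + B ^ 2 / g + A * B * (g / (d * d')) + B := by
      field_simp
      ring
    have i1 : (B : ℝ) ^ 2 / g ≤ B ^ 2 := div_le_self (by positivity) hgR
    have i2 : (g : ℝ) / (d * d') ≤ 1 := div_le_one_of_le₀ hgd (by positivity)
    have i3 : (A : ℝ) * B * (g / (d * d')) ≤ A * B * 1 := by gcongr
    have i4 : (B : ℝ) ≤ B ^ 2 := by
      have : B ≤ B ^ 2 := Nat.le_self_pow (by norm_num) B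
      exact_mod_cast this
    have e2 : (B : ℝ) * (B * (8 * A / (d * d'))) + B * (B * 4) = 8 * (A * B ^ 2 / (d * d')) + 4 * B ^ 2 := by
      ring
    have e3 : 9 * (A : ℝ) * B ^ 2 / (d * d') = 9 * (A * B ^ 2 / (d * d')) := by ring
    rw [e3]
    linarith

/-- A finite set of moduli at most `D`, coprime to `a`, with all prime factors above `y`. -/
structure RoughModuli (a : ℤ) (M : Finset ℕ) (D y : ℕ) : Prop where
  pos : ∀ d ∈ M, 0 < d
  le : ∀ d ∈ M, d ≤ D
  coprime : ∀ d ∈ M, IsCoprime (d : ℤ) a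
  le_totient : ∀ d ∈ M, d ≤ 2 * d.totient
  rough : ∀ d ∈ M, ∀ p : ℕ, p.Prime → p ∣ d → y < p

open Finset in
theorem sum_Icc_inv_filter_dvd_le (D : ℕ) {l : ℕ} (hl : 0 < l) :
    ∑ d ∈ (Icc 1 D).filter (l ∣ ·), (d : ℝ)⁻¹ ≤ (1 + Real.log D) * (l : ℝ)⁻¹ := by
  have hsub : (Icc 1 D).filter (l ∣ ·) ⊆ (Icc 1 D).image (l * ·) := by
    intro d hd
    rw [mem_filter, mem_Icc] at hd
    obtain ⟨⟨h1, h2⟩, ⟨t, rfl⟩⟩ := hd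
    have ht : t ≠ 0 := fun h => by simp [h] at h1
    refine mem_image.2 ⟨t, mem_Icc.2 ⟨by omega, ?_⟩, rfl⟩
    exact (Nat.le_mul_of_pos_left _ hl).trans h2
  refine (sum_le_sum_of_subset_of_nonneg hsub fun _ _ _ => by positivity).trans ?_
  rw [sum_image (fun a _ b _ h => Nat.eq_of_mul_eq_mul_left hl h)]
  calc ∑ m ∈ Icc 1 D, ((l * m : ℕ) : ℝ)⁻¹ = (∑ m ∈ Icc 1 D, (m : ℝ)⁻¹) * (l : ℝ)⁻¹ := by
        rw [sum_mul]
        refine sum_congr rfl fun m _ => ?_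
        push_cast
        rw [mul_inv, mul_comm]
    _ ≤ _ := by
        gcongr
        exact sum_Icc_inv_le D

theorem RoughModuli.sum_not_coprime_le {a : ℤ} {M : Finset ℕ} {D y : ℕ}
    (hM : RoughModuli a M D y) (hy : 1 ≤ y) :
    ∑ d ∈ M, ∑ d' ∈ M, (if d.Coprime d' then 0 else ((d : ℝ) * d')⁻¹)
      ≤ (1 + Real.log D) ^ 2 / y := by
  have h1 : ∀ d ∈ M, ∀ d' ∈ M, (if d.Coprime d' then 0 else ((d : ℝ) * d')⁻¹) ≤
      ∑ l ∈ Finset.Ioc y D, (if l ∣ d then (d : ℝ)⁻¹ else 0) *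
        (if l ∣ d' then (d' : ℝ)⁻¹ else 0) := by
    intro d hd d' hd'
    have hn : ∀ l ∈ Finset.Ioc y D, 0 ≤ (if l ∣ d then (d : ℝ)⁻¹ else 0) *
        (if l ∣ d' then (d' : ℝ)⁻¹ else 0) := fun l _ => by positivity
    split_ifs with h
    · exact Finset.sum_nonneg hn
    · obtain ⟨l, hl, h2, h3⟩ := Nat.Prime.not_coprime_iff_dvd.1 h
      have hmem : l ∈ Finset.Ioc y D := Finset.mem_Ioc.2
        ⟨hM.rough d hd l hl h2, (Nat.le_of_dvd (hM.pos d hd) h2).trans (hM.le d hd)⟩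
      refine le_trans (le_of_eq ?_) (Finset.single_le_sum hn hmem)
      rw [if_pos h2, if_pos h3, mul_inv]
  have hsub : M ⊆ Finset.Icc 1 D := fun d hd =>
    Finset.mem_Icc.2 ⟨hM.pos d hd, hM.le d hd⟩
  calc _ ≤ ∑ d ∈ M, ∑ d' ∈ M, ∑ l ∈ Finset.Ioc y D, (if l ∣ d then (d : ℝ)⁻¹ else 0) *
        (if l ∣ d' then (d' : ℝ)⁻¹ else 0) :=
        Finset.sum_le_sum fun d hd => Finset.sum_le_sum fun d' hd' => h1 d hd d' hd'
    _ = ∑ l ∈ Finset.Ioc y D, (∑ d ∈ M.filter (l ∣ ·), (d : ℝ)⁻¹) ^ 2 := by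
        simp_rw [sq, Finset.sum_filter, Finset.sum_mul_sum]
        rw [Finset.sum_comm]
        refine (Finset.sum_congr rfl fun e _ => Finset.sum_comm).trans ?_
        rw [Finset.sum_comm]
        refine Finset.sum_congr rfl fun l _ => Finset.sum_comm
    _ ≤ ∑ l ∈ Finset.Ioc y D, ((1 + Real.log D) * (l : ℝ)⁻¹) ^ 2 := by
        refine Finset.sum_le_sum fun l hl => ?_
        have hl0 : 0 < l := by rw [Finset.mem_Ioc] at hl; omega
        refine pow_le_pow_left₀ (by positivity) ?_ 2
        refine le_trans ?_ (sum_Icc_inv_filter_dvd_le D hl0)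
        exact Finset.sum_le_sum_of_subset_of_nonneg (Finset.filter_subset_filter _ hsub)
          fun _ _ _ => by positivity
    _ = (1 + Real.log D) ^ 2 * ∑ l ∈ Finset.Ioc y D, ((l : ℝ) ^ 2)⁻¹ := by
        rw [Finset.mul_sum]
        refine Finset.sum_congr rfl fun l _ => ?_
        rw [mul_pow, inv_pow]
    _ ≤ (1 + Real.log D) ^ 2 * (y : ℝ)⁻¹ := by
        gcongr
        exact sum_Ioc_inv_sq_le hy D
    _ = _ := by rw [div_eq_mul_inv]

/-- The sum of the residue defects over a set of moduli. -/
noncomputable def totalDefect (a : ℤ) (M : Finset ℕ) (s : ℕ) : ℝ := ∑ d ∈ M, residueDefect a d s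

theorem RoughModuli.bilinear_block {a : ℤ} {M : Finset ℕ} {D y : ℕ}
    (hM : RoughModuli a M D y) (hy : 1 ≤ y) (c A B X u : ℕ) {S Q : Finset ℕ}
    (hS : S ⊆ Finset.Ico u (u + A)) (hQ : Q ⊆ Finset.range B) :
    (∑ n ∈ S, ∑ q ∈ Q, if (n + 1) * (q + 1) ≤ X then totalDefect a M (c * q * n) else 0) ^ 2
      ≤ A * (9 * A * B ^ 2 * ((1 + Real.log D) ^ 2 / y) + D ^ 2 * (6 * B ^ 2 + A * B)) := by
  set G : ℕ → ℝ := fun n =>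
    ∑ q ∈ Q, if (n + 1) * (q + 1) ≤ X then totalDefect a M (c * q * n) else 0 with hG
  set w : ℕ → ℕ → ℕ := fun q q' => max u (min (u + A) (min (X / (q + 1)) (X / (q' + 1)))) with hw
  have hw1 : ∀ q q', u ≤ w q q' ∧ w q q' ≤ u + A := by
    intro q q'
    exact ⟨le_max_left _ _, max_le (by omega) (min_le_left _ _)⟩
  have hcauchy : (∑ n ∈ S, G n) ^ 2 ≤ A * ∑ n ∈ Finset.Ico u (u + A), G n ^ 2 := by
    refine (sq_sum_le_card_mul_sum_sq (s := S) (f := G)).trans ?_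
    have h1 : (S.card : ℝ) ≤ A := by
      have := Finset.card_le_card hS
      rw [Nat.card_Ico] at this
      exact_mod_cast this.trans (by omega)
    have h2 : ∑ n ∈ S, G n ^ 2 ≤ ∑ n ∈ Finset.Ico u (u + A), G n ^ 2 :=
      Finset.sum_le_sum_of_subset_of_nonneg hS fun _ _ _ => sq_nonneg _
    exact mul_le_mul h1 h2 (Finset.sum_nonneg fun _ _ => sq_nonneg _) (by positivity)
  have hexp : ∑ n ∈ Finset.Ico u (u + A), G n ^ 2 = ∑ d ∈ M, ∑ d' ∈ M, ∑ q ∈ Q, ∑ q' ∈ Q,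
      ∑ n ∈ Finset.Ico u (w q q'),
        residueDefect a d (c * q * n) * residueDefect a d' (c * q' * n) := by
    have h1 : ∀ n ∈ Finset.Ico u (u + A), G n ^ 2 =
        ∑ d ∈ M, ∑ d' ∈ M, ∑ q ∈ Q, ∑ q' ∈ Q, (if n ∈ Finset.Ico u (w q q') then
        residueDefect a d (c * q * n) * residueDefect a d' (c * q' * n) else 0) := by
      intro n hn
      have h2 : G n = ∑ d ∈ M, ∑ q ∈ Q,
          if (n + 1) * (q + 1) ≤ X then residueDefect a d (c * q * n) else 0 := by
        rw [Finset.sum_comm]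
        refine Finset.sum_congr rfl fun q _ => ?_
        split_ifs
        · rfl
        · simp
      rw [sq, h2, Finset.sum_mul_sum]
      refine Finset.sum_congr rfl fun d _ => Finset.sum_congr rfl fun d' _ => ?_
      rw [Finset.sum_mul_sum]
      refine Finset.sum_congr rfl fun q _ => Finset.sum_congr rfl fun q' _ => ?_
      have h3 : n ∈ Finset.Ico u (w q q') ↔ (n + 1) * (q + 1) ≤ X ∧ (n + 1) * (q' + 1) ≤ X := by
        rw [Finset.mem_Ico] at hn ⊢
        rw [← Nat.le_div_iff_mul_le (by omega), ← Nat.le_div_iff_mul_le (by omega)]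
        simp only [hw]
        omega
      by_cases a1 : (n + 1) * (q + 1) ≤ X <;> by_cases a2 : (n + 1) * (q' + 1) ≤ X <;>
        simp only [h3, a1, a2, and_self, and_true, and_false, if_true, if_false, zero_mul, mul_zero]
    rw [Finset.sum_congr rfl h1, Finset.sum_comm]
    refine Finset.sum_congr rfl fun d _ => ?_
    rw [Finset.sum_comm]
    refine Finset.sum_congr rfl fun d' _ => ?_
    rw [Finset.sum_comm]
    refine Finset.sum_congr rfl fun q _ => ?_
    rw [Finset.sum_comm]
    refine Finset.sum_congr rfl fun q' _ => ?_
    rw [← Finset.sum_filter]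
    refine Finset.sum_congr ?_ fun _ _ => rfl
    ext n
    have := hw1 q q'
    simp only [Finset.mem_filter, Finset.mem_Ico]
    omega
  have hbound : ∑ n ∈ Finset.Ico u (u + A), G n ^ 2 ≤
      9 * A * B ^ 2 * ((1 + Real.log D) ^ 2 / y) + D ^ 2 * (6 * B ^ 2 + A * B) := by
    rw [hexp]
    calc _ ≤ ∑ d ∈ M, ∑ d' ∈ M, (6 * (B : ℝ) ^ 2 + A * B +
          9 * A * B ^ 2 * if d.Coprime d' then 0 else ((d : ℝ) * d')⁻¹) := by
          refine Finset.sum_le_sum fun d hd => Finset.sum_le_sum fun d' hd' => ?_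
          have h1 := sum_sum_residueDefect_le (c := c) (hM.coprime d hd) (hM.coprime d' hd')
            (hM.pos d hd) (hM.pos d' hd') (hM.le_totient d hd) (hM.le_totient d' hd') A B u w hw1
          have h2 : (9 * (A : ℝ) * B ^ 2 * if d.Coprime d' then 0 else ((d : ℝ) * d')⁻¹) =
              if d.Coprime d' then 0 else 9 * (A : ℝ) * B ^ 2 / (d * d') := by
            split_ifs
            · simp
            · rw [div_eq_mul_inv]
          rw [h2]
          refine le_trans ?_ h1
          refine (Finset.sum_le_sum fun q _ => (Finset.sum_le_sum fun q' _ => le_abs_self _).trans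
            (Finset.sum_le_sum_of_subset_of_nonneg hQ fun _ _ _ => abs_nonneg _)).trans ?_
          exact Finset.sum_le_sum_of_subset_of_nonneg hQ
            fun _ _ _ => Finset.sum_nonneg fun _ _ => abs_nonneg _
      _ = (M.card : ℝ) ^ 2 * (6 * (B : ℝ) ^ 2 + A * B) + 9 * A * B ^ 2 *
          ∑ d ∈ M, ∑ d' ∈ M, if d.Coprime d' then 0 else ((d : ℝ) * d')⁻¹ := by
          simp_rw [Finset.sum_add_distrib, ← Finset.mul_sum]
          simp only [Finset.sum_const, nsmul_eq_mul]
          ring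
      _ ≤ (D : ℝ) ^ 2 * (6 * (B : ℝ) ^ 2 + A * B) + 9 * A * B ^ 2 *
          ((1 + Real.log D) ^ 2 / y) := by
          have hcard : (M.card : ℝ) ≤ D := by
            have : M ⊆ Finset.Icc 1 D := fun d hd =>
              Finset.mem_Icc.2 ⟨hM.pos d hd, hM.le d hd⟩
            have := Finset.card_le_card this
            rw [Nat.card_Icc, Nat.add_sub_cancel] at this
            exact_mod_cast this
          gcongr
          exact hM.sum_not_coprime_le hy
      _ = _ := by ring
  refine hcauchy.trans ?_
  gcongr

/-- The primes in `(w, N]`. -/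
def primesIoc (w N : ℕ) : Finset ℕ := (Finset.Ioc w N).filter Nat.Prime

theorem mem_primesIoc {w N p : ℕ} : p ∈ primesIoc w N ↔ (w < p ∧ p ≤ N) ∧ p.Prime := by
  rw [primesIoc, Finset.mem_filter, Finset.mem_Ioc]

/-- The saving in the bilinear estimate. -/
noncomputable def bilinearSaving (D y w : ℕ) : ℝ :=
  Real.sqrt (9 * ((1 + Real.log D) ^ 2 / y) + 13 * D ^ 2 / w)

theorem RoughModuli.bilinear_dyadic {a : ℤ} {M : Finset ℕ} {D y : ℕ}
    (hM : RoughModuli a M D y) (hy : 1 ≤ y) {w : ℕ} (hw : 1 ≤ w) (c N X j : ℕ) :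
    |∑ P ∈ (primesIoc w N).filter (fun P => Nat.log 2 P = j), ∑ Q ∈ primesIoc w N,
      if P * Q ≤ X then totalDefect a M (c * (Q - 1) * (P - 1)) else 0|
      ≤ X * bilinearSaving D y w := by
  set S := ((primesIoc w N).filter (fun P => Nat.log 2 P = j)).image (· - 1) with hS
  set A := 2 ^ j with hA
  set B := X / A with hB
  have hA0 : 0 < A := by positivity
  set T := ((primesIoc w N).filter (fun Q => Q ≤ B)).image (· - 1) with hT
  have hinj : ∀ s : Finset ℕ, (∀ p ∈ s, p.Prime) → Set.InjOn (· - 1 : ℕ → ℕ) s := by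
    intro s hs p hp q hq h
    have h1 := (hs p hp).pos
    have h2 := (hs q hq).pos
    simp only at h
    omega
  have hrange : ∀ P ∈ (primesIoc w N).filter (fun P => Nat.log 2 P = j), A ≤ P ∧ P < 2 * A := by
    intro P hP
    rw [Finset.mem_filter, mem_primesIoc] at hP
    have := (Nat.log_eq_iff (Or.inr ⟨by norm_num, hP.1.2.ne_zero⟩)).1 hP.2
    rw [pow_succ] at this
    omega
  have heq : ∑ P ∈ (primesIoc w N).filter (fun P => Nat.log 2 P = j), ∑ Q ∈ primesIoc w N,
      (if P * Q ≤ X then totalDefect a M (c * (Q - 1) * (P - 1)) else 0) =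
      ∑ n ∈ S, ∑ q ∈ T, if (n + 1) * (q + 1) ≤ X then totalDefect a M (c * q * n) else 0 := by
    rw [hS, Finset.sum_image (hinj _ fun p hp => (mem_primesIoc.1 (Finset.mem_filter.1 hp).1).2)]
    refine Finset.sum_congr rfl fun P hP => ?_
    have hP2 := hrange P hP
    rw [Finset.mem_filter, mem_primesIoc] at hP
    rw [hT, Finset.sum_image (hinj _ fun p hp => (mem_primesIoc.1 (Finset.mem_filter.1 hp).1).2),
      Finset.sum_filter]
    refine Finset.sum_congr rfl fun Q hQ => ?_
    rw [mem_primesIoc] at hQ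
    rw [Nat.sub_add_cancel hP.1.2.pos, Nat.sub_add_cancel hQ.2.pos]
    by_cases h1 : P * Q ≤ X
    · have h2 : Q ≤ B := by
        rw [hB, Nat.le_div_iff_mul_le hA0]
        calc Q * A ≤ Q * P := Nat.mul_le_mul_left _ hP2.1
          _ ≤ X := by rwa [mul_comm]
      simp [h1, h2]
    · simp [h1]
  rw [heq]
  have hSsub : S ⊆ Finset.Ico (A - 1) (A - 1 + A) := by
    intro n hn
    rw [hS, Finset.mem_image] at hn
    obtain ⟨P, hP, rfl⟩ := hn
    have := hrange P hP
    rw [Finset.mem_Ico]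
    omega
  have hTsub : T ⊆ Finset.range B := by
    intro n hn
    rw [hT, Finset.mem_image] at hn
    obtain ⟨P, hP, rfl⟩ := hn
    rw [Finset.mem_filter, mem_primesIoc] at hP
    have := hP.1.2.pos
    rw [Finset.mem_range]
    omega
  have hpos : 0 ≤ (X : ℝ) * bilinearSaving D y w := by
    have := Real.sqrt_nonneg (9 * ((1 + Real.log D) ^ 2 / y) + 13 * D ^ 2 / w)
    rw [bilinearSaving]
    positivity
  rcases S.eq_empty_or_nonempty with h0 | ⟨n, hn⟩
  · rw [h0]; simpa using hpos
  rcases T.eq_empty_or_nonempty with h0 | ⟨q, hq⟩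
  · rw [h0]; simpa using hpos
  have hAw : w ≤ 2 * A := by
    rw [hS, Finset.mem_image] at hn
    obtain ⟨P, hP, rfl⟩ := hn
    have := hrange P hP
    rw [Finset.mem_filter, mem_primesIoc] at hP
    omega
  have hBw : w ≤ B := by
    rw [hT, Finset.mem_image] at hq
    obtain ⟨P, hP, rfl⟩ := hq
    rw [Finset.mem_filter, mem_primesIoc] at hP
    omega
  have hABX : A * B ≤ X := Nat.mul_div_le X A
  have hblock := hM.bilinear_block hy c A B X (A - 1) hSsub hTsub
  rw [← Real.sqrt_sq_eq_abs]
  rw [bilinearSaving] at hpos ⊢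
  refine Real.sqrt_le_iff.2 ⟨hpos, ?_⟩
  rw [mul_pow, Real.sq_sqrt (by positivity)]
  refine hblock.trans ?_
  have hwR : (1 : ℝ) ≤ w := by exact_mod_cast hw
  have hAR : (w : ℝ) ≤ 2 * A := by exact_mod_cast hAw
  have hBR : (w : ℝ) ≤ B := by exact_mod_cast hBw
  have hX : (A : ℝ) * B ≤ X := by exact_mod_cast hABX
  have hA1 : (0 : ℝ) < A := by exact_mod_cast hA0
  have hB1 : (0 : ℝ) < B := by linarith
  set δ := (1 + Real.log D) ^ 2 / (y : ℝ) with hδ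
  have hδ0 : 0 ≤ δ := by positivity
  have e : (A : ℝ) * (9 * A * B ^ 2 * δ + D ^ 2 * (6 * B ^ 2 + A * B)) =
      (A * B) ^ 2 * (9 * δ + D ^ 2 * (6 / A + 1 / B)) := by
    field_simp
  rw [e]
  have i1 : 6 / (A : ℝ) ≤ 12 / w := by
    rw [div_le_div_iff₀ hA1 (by linarith)]
    linarith
  have i2 : 1 / (B : ℝ) ≤ 1 / w := one_div_le_one_div_of_le (by linarith) hBR
  have i3 : (D : ℝ) ^ 2 * (6 / A + 1 / B) ≤ 13 * D ^ 2 / w := by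
    have : (D : ℝ) ^ 2 * (6 / A + 1 / B) ≤ D ^ 2 * (12 / w + 1 / w) := by gcongr
    refine this.trans (le_of_eq ?_)
    ring
  have i4 : (0 : ℝ) ≤ D ^ 2 * (6 / A + 1 / B) := by positivity
  gcongr

theorem RoughModuli.bilinear_sum {a : ℤ} {M : Finset ℕ} {D y : ℕ}
    (hM : RoughModuli a M D y) (hy : 1 ≤ y) {w : ℕ} (hw : 1 ≤ w) (c N X : ℕ) :
    |∑ P ∈ primesIoc w N, ∑ Q ∈ primesIoc w N,
      if P * Q ≤ X then totalDefect a M (c * (Q - 1) * (P - 1)) else 0|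
      ≤ (Nat.log 2 N + 1) * (X * bilinearSaving D y w) := by
  have hmaps : ∀ P ∈ primesIoc w N, Nat.log 2 P ∈ Finset.range (Nat.log 2 N + 1) := by
    intro P hP
    rw [mem_primesIoc] at hP
    have := Nat.log_mono_right (b := 2) hP.1.2
    rw [Finset.mem_range]
    omega
  rw [← Finset.sum_fiberwise_of_maps_to hmaps]
  refine (Finset.abs_sum_le_sum_abs _ _).trans ?_
  refine (Finset.sum_le_sum fun j _ => hM.bilinear_dyadic hy hw c N X j).trans (le_of_eq ?_)
  rw [Finset.sum_const, Finset.card_range, nsmul_eq_mul]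
  push_cast
  rfl

theorem sum_filter_dvd_eq (N : ℕ) {k : ℕ} (hk : 0 < k) (g : ℕ → ℝ) :
    ∑ n ∈ Finset.Icc 1 N, (if k ∣ n then g n else 0)
      = ∑ m ∈ Finset.Icc 1 N, if m * k ≤ N then g (m * k) else 0 := by
  rw [← Finset.sum_filter, ← Finset.sum_filter]
  refine Finset.sum_bij' (fun n _ => n / k) (fun m _ => m * k) ?_ ?_ ?_ ?_ ?_
  · intro n hn
    rw [Finset.mem_filter, Finset.mem_Icc] at hn ⊢
    rw [Nat.div_mul_cancel hn.2]
    exact ⟨⟨Nat.div_pos (Nat.le_of_dvd (by omega) hn.2) hk, (Nat.div_le_self _ _).trans hn.1.2⟩,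
      hn.1.2⟩
  · intro m hm
    rw [Finset.mem_filter, Finset.mem_Icc] at hm ⊢
    exact ⟨⟨Nat.mul_pos (by omega) hk, hm.2⟩, dvd_mul_left _ _⟩
  · intro n hn
    rw [Finset.mem_filter] at hn
    exact Nat.div_mul_cancel hn.2
  · intro m _
    exact Nat.mul_div_cancel m hk
  · intro n hn
    rw [Finset.mem_filter] at hn
    rw [Nat.div_mul_cancel hn.2]

/-- The number of pairs of primes `P, Q ∈ (w, N]` with `P * Q ∣ n`. -/
noncomputable def pairWeight (w N n : ℕ) : ℝ :=
  ∑ P ∈ primesIoc w N, ∑ Q ∈ primesIoc w N, if P * Q ∣ n then 1 else 0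

theorem abs_residueDefect_le_one {a : ℤ} {d : ℕ} (s : ℕ) (hd : 0 < d) :
    |residueDefect a d s| ≤ 1 := by
  have h1 : (1 : ℝ) ≤ d.totient := by exact_mod_cast Nat.totient_pos.2 hd
  have h2 : ((d.totient : ℝ))⁻¹ ≤ 1 := inv_le_one_of_one_le₀ h1
  have h3 : 0 ≤ ((d.totient : ℝ))⁻¹ := by positivity
  rw [residueDefect, abs_le]
  split_ifs <;> constructor <;> linarith

theorem RoughModuli.abs_totalDefect_le {a : ℤ} {M : Finset ℕ} {D y : ℕ}
    (hM : RoughModuli a M D y) (s : ℕ) : |totalDefect a M s| ≤ D := by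
  have hcard : (M.card : ℝ) ≤ D := by
    have : M ⊆ Finset.Icc 1 D := fun d hd =>
      Finset.mem_Icc.2 ⟨hM.pos d hd, hM.le d hd⟩
    have := Finset.card_le_card this
    rw [Nat.card_Icc, Nat.add_sub_cancel] at this
    exact_mod_cast this
  refine le_trans ?_ hcard
  rw [totalDefect]
  refine (Finset.abs_sum_le_sum_abs _ _).trans ?_
  refine (Finset.sum_le_sum fun d hd => abs_residueDefect_le_one s (hM.pos d hd)).trans ?_
  simp

theorem sum_filter_dvd_one_le (N : ℕ) {k : ℕ} (_hk : 0 < k) :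
    ∑ n ∈ Finset.Icc 1 N, (if k ∣ n then (1 : ℝ) else 0) ≤ N * (k : ℝ)⁻¹ := by
  rw [Finset.sum_boole]
  have := Nat.Ioc_filter_dvd_card_eq_div N k
  have e : Finset.Icc 1 N = Finset.Ioc 0 N := rfl
  rw [e, this, ← div_eq_mul_inv]
  exact Nat.cast_div_le

theorem sum_primesIoc_inv_sq_le {w : ℕ} (hw : 1 ≤ w) (N : ℕ) :
    ∑ P ∈ primesIoc w N, ((P : ℝ) ^ 2)⁻¹ ≤ (w : ℝ)⁻¹ :=
  (Finset.sum_le_sum_of_subset_of_nonneg (Finset.filter_subset _ _)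
    fun _ _ _ => by positivity).trans (sum_Ioc_inv_sq_le hw N)

theorem sum_primesIoc_inv_le (w N : ℕ) :
    ∑ P ∈ primesIoc w N, (P : ℝ)⁻¹ ≤ 1 + Real.log N := by
  refine le_trans (Finset.sum_le_sum_of_subset_of_nonneg ?_ fun _ _ _ => by positivity)
    (sum_Icc_inv_le N)
  intro P hP
  rw [mem_primesIoc] at hP
  exact Finset.mem_Icc.2 ⟨hP.2.pos, hP.1.2⟩

theorem totient_mul_prime_mul_prime {m P Q : ℕ} (hP : P.Prime) (hQ : Q.Prime) (hPQ : P ≠ Q)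
    (hPm : ¬ P ∣ m) (hQm : ¬ Q ∣ m) :
    (m * (P * Q)).totient = m.totient * (Q - 1) * (P - 1) := by
  have h1 : m.Coprime (P * Q) := by
    rw [Nat.coprime_mul_iff_right]
    exact ⟨((Nat.Prime.coprime_iff_not_dvd hP).2 hPm).symm,
      ((Nat.Prime.coprime_iff_not_dvd hQ).2 hQm).symm⟩
  rw [Nat.totient_mul h1, Nat.totient_mul ((Nat.coprime_primes hP hQ).2 hPQ),
    Nat.totient_prime hP, Nat.totient_prime hQ]
  ring

theorem RoughModuli.abs_sum_pairWeight_mul_le {a : ℤ} {M : Finset ℕ} {D y : ℕ}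
    (hM : RoughModuli a M D y) (hy : 1 ≤ y) {w : ℕ} (hw : 1 ≤ w) (N : ℕ) :
    |∑ n ∈ Finset.Icc 1 N, pairWeight w N n * totalDefect a M n.totient|
      ≤ N * (1 + Real.log N) * ((Nat.log 2 N + 1) * bilinearSaving D y w + 6 * D / w) := by
  set I := primesIoc w N with hI
  set F := totalDefect a M with hF
  have hIp : ∀ P ∈ I, P.Prime := fun P hP => (mem_primesIoc.1 hP).2
  have hpq : ∀ P ∈ I, ∀ Q ∈ I, 0 < P * Q := fun P hP Q hQ =>
    Nat.mul_pos (hIp P hP).pos (hIp Q hQ).pos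
  -- the main part
  have hA : |∑ n ∈ Finset.Icc 1 N, ∑ P ∈ I, ∑ Q ∈ I, if P * Q ∣ n then
      F ((n / (P * Q)).totient * (Q - 1) * (P - 1)) else 0| ≤
      N * (1 + Real.log N) * ((Nat.log 2 N + 1) * bilinearSaving D y w) := by
    have h1 : ∑ n ∈ Finset.Icc 1 N, ∑ P ∈ I, ∑ Q ∈ I, (if P * Q ∣ n then
        F ((n / (P * Q)).totient * (Q - 1) * (P - 1)) else 0) =
        ∑ m ∈ Finset.Icc 1 N, ∑ P ∈ I, ∑ Q ∈ I, if P * Q ≤ N / m then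
          F (m.totient * (Q - 1) * (P - 1)) else 0 := by
      rw [Finset.sum_comm]
      conv_rhs => rw [Finset.sum_comm]
      refine Finset.sum_congr rfl fun P hP => ?_
      rw [Finset.sum_comm]
      conv_rhs => rw [Finset.sum_comm]
      refine Finset.sum_congr rfl fun Q hQ => ?_
      have h0 := hpq P hP Q hQ
      rw [sum_filter_dvd_eq N h0
        (fun n => F ((n / (P * Q)).totient * (Q - 1) * (P - 1)))]
      refine Finset.sum_congr rfl fun m hm => ?_
      rw [Finset.mem_Icc] at hm
      rw [Nat.mul_div_cancel m h0]
      simp only [Nat.le_div_iff_mul_le (by omega : 0 < m), mul_comm m]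
    rw [h1]
    refine (Finset.abs_sum_le_sum_abs _ _).trans ?_
    refine (Finset.sum_le_sum fun m _ => hM.bilinear_sum hy hw m.totient N (N / m)).trans ?_
    have hs : 0 ≤ bilinearSaving D y w := Real.sqrt_nonneg _
    calc _ ≤ ∑ m ∈ Finset.Icc 1 N, (Nat.log 2 N + 1) * (N * (m : ℝ)⁻¹ * bilinearSaving D y w) := by
          refine Finset.sum_le_sum fun m _ => ?_
          have : ((N / m : ℕ) : ℝ) ≤ N * (m : ℝ)⁻¹ := by
            rw [← div_eq_mul_inv]; exact Nat.cast_div_le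
          gcongr
      _ = (Nat.log 2 N + 1) * (N * (∑ m ∈ Finset.Icc 1 N, (m : ℝ)⁻¹) * bilinearSaving D y w) := by
          rw [← Finset.mul_sum, ← Finset.sum_mul, ← Finset.mul_sum]
      _ ≤ (Nat.log 2 N + 1) * (N * (1 + Real.log N) * bilinearSaving D y w) := by
          gcongr
          exact sum_Icc_inv_le N
      _ = _ := by ring
  -- the exceptional part
  have hB : |∑ n ∈ Finset.Icc 1 N, pairWeight w N n * F n.totient -
      ∑ n ∈ Finset.Icc 1 N, ∑ P ∈ I, ∑ Q ∈ I, if P * Q ∣ n then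
        F ((n / (P * Q)).totient * (Q - 1) * (P - 1)) else 0| ≤
      N * (1 + Real.log N) * (6 * D / w) := by
    have h1 : ∀ n ∈ Finset.Icc 1 N, |pairWeight w N n * F n.totient - ∑ P ∈ I, ∑ Q ∈ I,
        if P * Q ∣ n then F ((n / (P * Q)).totient * (Q - 1) * (P - 1)) else 0| ≤
        ∑ P ∈ I, ∑ Q ∈ I, 2 * D * ((if P = Q then (if P ^ 2 ∣ n then (1 : ℝ) else 0) else 0) +
          (if P ^ 2 * Q ∣ n then (1 : ℝ) else 0) + if Q ^ 2 * P ∣ n then (1 : ℝ) else 0) := by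
      intro n hn
      rw [Finset.mem_Icc] at hn
      rw [pairWeight, Finset.sum_mul, ← Finset.sum_sub_distrib]
      refine (Finset.abs_sum_le_sum_abs _ _).trans (Finset.sum_le_sum fun P hP => ?_)
      rw [Finset.sum_mul, ← Finset.sum_sub_distrib]
      refine (Finset.abs_sum_le_sum_abs _ _).trans (Finset.sum_le_sum fun Q hQ => ?_)
      by_cases hd : P * Q ∣ n
      · rw [if_pos hd, if_pos hd, one_mul]
        obtain ⟨m, rfl⟩ := hd
        rw [Nat.mul_div_cancel_left m (hpq P hP Q hQ), mul_comm (P * Q) m]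
        have hbd : |F (m * (P * Q)).totient - F (m.totient * (Q - 1) * (P - 1))| ≤ 2 * D := by
          have i1 := hM.abs_totalDefect_le (m * (P * Q)).totient
          have i2 := hM.abs_totalDefect_le (m.totient * (Q - 1) * (P - 1))
          refine (abs_sub _ _).trans ?_
          linarith
        by_cases c1 : P = Q
        · subst c1
          have : P ^ 2 ∣ m * (P * P) := by rw [sq]; exact dvd_mul_left _ _
          rw [if_pos rfl, if_pos this]
          refine hbd.trans ?_
          have h0 : (0 : ℝ) ≤ D := by positivity
          have h2 : (0 : ℝ) ≤ if P ^ 2 * P ∣ m * (P * P) then (1 : ℝ) else 0 := by positivity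
          nlinarith
        by_cases c2 : P ∣ m
        · have : P ^ 2 * Q ∣ m * (P * Q) := by
            rw [sq, mul_assoc]; exact Nat.mul_dvd_mul c2 (dvd_refl _)
          rw [if_neg c1, if_pos this]
          refine hbd.trans ?_
          have h0 : (0 : ℝ) ≤ D := by positivity
          have h2 : (0 : ℝ) ≤ if Q ^ 2 * P ∣ m * (P * Q) then (1 : ℝ) else 0 := by positivity
          nlinarith
        by_cases c3 : Q ∣ m
        · have : Q ^ 2 * P ∣ m * (P * Q) := by
            rw [sq, mul_assoc, mul_comm P Q]; exact Nat.mul_dvd_mul c3 (dvd_refl _)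
          rw [if_neg c1, if_pos this]
          refine hbd.trans ?_
          have h0 : (0 : ℝ) ≤ D := by positivity
          have h2 : (0 : ℝ) ≤ if P ^ 2 * Q ∣ m * (P * Q) then (1 : ℝ) else 0 := by positivity
          nlinarith
        · rw [totient_mul_prime_mul_prime (hIp P hP) (hIp Q hQ) c1 c2 c3, sub_self, abs_zero]
          positivity
      · rw [if_neg hd, if_neg hd, zero_mul, sub_zero, abs_zero]
        positivity
    rw [← Finset.sum_sub_distrib]
    refine (Finset.abs_sum_le_sum_abs _ _).trans ((Finset.sum_le_sum h1).trans ?_)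
    have hx : ∀ k : ℕ, 0 < k → ∑ n ∈ Finset.Icc 1 N, (if k ∣ n then (1 : ℝ) else 0)
        ≤ N * (k : ℝ)⁻¹ := fun k hk => sum_filter_dvd_one_le N hk
    calc _ = ∑ P ∈ I, ∑ Q ∈ I, 2 * (D : ℝ) * ((if P = Q then
            (∑ n ∈ Finset.Icc 1 N, if P ^ 2 ∣ n then (1 : ℝ) else 0) else 0) +
          (∑ n ∈ Finset.Icc 1 N, if P ^ 2 * Q ∣ n then (1 : ℝ) else 0) +
          ∑ n ∈ Finset.Icc 1 N, if Q ^ 2 * P ∣ n then (1 : ℝ) else 0) := by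
          rw [Finset.sum_comm]
          refine Finset.sum_congr rfl fun P _ => ?_
          rw [Finset.sum_comm]
          refine Finset.sum_congr rfl fun Q _ => ?_
          rw [← Finset.mul_sum, Finset.sum_add_distrib, Finset.sum_add_distrib]
          congr 3
          split_ifs
          · rfl
          · simp
      _ ≤ ∑ P ∈ I, ∑ Q ∈ I, 2 * (D : ℝ) * ((if P = Q then N * ((P : ℝ) ^ 2)⁻¹ else 0) +
          N * (((P : ℝ) ^ 2)⁻¹ * (Q : ℝ)⁻¹) + N * (((Q : ℝ) ^ 2)⁻¹ * (P : ℝ)⁻¹)) := by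
          refine Finset.sum_le_sum fun P hP => Finset.sum_le_sum fun Q hQ => ?_
          have p0 := (hIp P hP).pos
          have q0 := (hIp Q hQ).pos
          have i1 := hx (P ^ 2) (by positivity)
          have i2 := hx (P ^ 2 * Q) (by positivity)
          have i3 := hx (Q ^ 2 * P) (by positivity)
          push_cast at i1 i2 i3
          rw [mul_inv] at i2 i3
          gcongr
          split_ifs
          · exact i1
          · exact le_rfl
      _ = 2 * D * (N * (∑ P ∈ I, ((P : ℝ) ^ 2)⁻¹) +
          2 * (N * ((∑ P ∈ I, ((P : ℝ) ^ 2)⁻¹) * ∑ P ∈ I, (P : ℝ)⁻¹))) := by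
          simp_rw [← Finset.mul_sum, Finset.sum_add_distrib, ← Finset.mul_sum, ← Finset.sum_mul]
          rw [Finset.sum_congr rfl fun P hP => Finset.sum_ite_eq I P _]
          simp only [Finset.sum_ite_mem, Finset.inter_self, ← Finset.mul_sum]
          ring
      _ ≤ 2 * D * (N * ((w : ℝ)⁻¹ * (1 + Real.log N)) +
          2 * (N * ((w : ℝ)⁻¹ * (1 + Real.log N)))) := by
          have j1 := sum_primesIoc_inv_sq_le hw N
          have j2 := sum_primesIoc_inv_le w N
          have j3 : 0 ≤ Real.log N := Real.log_natCast_nonneg N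
          have j4 : ∑ P ∈ I, ((P : ℝ) ^ 2)⁻¹ ≤ (w : ℝ)⁻¹ * (1 + Real.log N) :=
            j1.trans (le_mul_of_one_le_right (by positivity) (by linarith))
          gcongr
      _ = _ := by ring
  have := abs_add_le (∑ n ∈ Finset.Icc 1 N, pairWeight w N n * F n.totient -
      ∑ n ∈ Finset.Icc 1 N, ∑ P ∈ I, ∑ Q ∈ I, if P * Q ∣ n then
        F ((n / (P * Q)).totient * (Q - 1) * (P - 1)) else 0)
      (∑ n ∈ Finset.Icc 1 N, ∑ P ∈ I, ∑ Q ∈ I, if P * Q ∣ n then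
        F ((n / (P * Q)).totient * (Q - 1) * (P - 1)) else 0)
  rw [sub_add_cancel] at this
  refine this.trans ((add_le_add hB hA).trans (le_of_eq ?_))
  ring

/-- The number of primes `P ∈ (w, N]` dividing `n`. -/
noncomputable def primeWeight (w N n : ℕ) : ℝ := ∑ P ∈ primesIoc w N, if P ∣ n then 1 else 0

/-- The sum of the reciprocals of the primes in `(w, N]`. -/
noncomputable def primeMass (w N : ℕ) : ℝ := ∑ P ∈ primesIoc w N, (P : ℝ)⁻¹

theorem primeWeight_nonneg (w N n : ℕ) : 0 ≤ primeWeight w N n :=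
  Finset.sum_nonneg fun _ _ => by split_ifs <;> norm_num

theorem pairWeight_nonneg (w N n : ℕ) : 0 ≤ pairWeight w N n :=
  Finset.sum_nonneg fun _ _ => Finset.sum_nonneg fun _ _ => by split_ifs <;> norm_num

theorem primeMass_nonneg (w N : ℕ) : 0 ≤ primeMass w N :=
  Finset.sum_nonneg fun _ _ => by positivity

theorem le_sum_filter_dvd_one (N k : ℕ) (hk : 0 < k) :
    N * (k : ℝ)⁻¹ - 1 ≤ ∑ n ∈ Finset.Icc 1 N, (if k ∣ n then (1 : ℝ) else 0) := by
  rw [Finset.sum_boole]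
  have := Nat.Ioc_filter_dvd_card_eq_div N k
  have e : Finset.Icc 1 N = Finset.Ioc 0 N := rfl
  rw [e, this]
  have h : N < k * (N / k + 1) := Nat.lt_mul_div_succ N hk
  have h' : (N : ℝ) < k * ((N / k : ℕ) + 1) := by exact_mod_cast h
  have hk' : (0 : ℝ) < k := by exact_mod_cast hk
  rw [← div_eq_mul_inv]
  have : (N : ℝ) / k < (N / k : ℕ) + 1 := by
    rw [div_lt_iff₀ hk']
    linarith
  linarith

theorem sum_primeWeight_le (w N : ℕ) :
    ∑ n ∈ Finset.Icc 1 N, primeWeight w N n ≤ N * primeMass w N := by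
  simp only [primeWeight, primeMass]
  rw [Finset.sum_comm, Finset.mul_sum]
  exact Finset.sum_le_sum fun P hP => sum_filter_dvd_one_le N (mem_primesIoc.1 hP).2.pos

theorem le_sum_primeWeight (w N : ℕ) :
    N * primeMass w N - N ≤ ∑ n ∈ Finset.Icc 1 N, primeWeight w N n := by
  have hc : ((primesIoc w N).card : ℝ) ≤ N := by
    have : primesIoc w N ⊆ Finset.Icc 1 N := fun P hP => by
      rw [mem_primesIoc] at hP
      exact Finset.mem_Icc.2 ⟨hP.2.pos, hP.1.2⟩
    have := Finset.card_le_card this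
    rw [Nat.card_Icc, Nat.add_sub_cancel] at this
    exact_mod_cast this
  have h : ∑ P ∈ primesIoc w N, (N * (P : ℝ)⁻¹ - 1) ≤
      ∑ n ∈ Finset.Icc 1 N, primeWeight w N n := by
    simp only [primeWeight]
    rw [Finset.sum_comm]
    exact Finset.sum_le_sum fun P hP => le_sum_filter_dvd_one N P (mem_primesIoc.1 hP).2.pos
  rw [Finset.sum_sub_distrib, ← Finset.mul_sum, Finset.sum_const, nsmul_eq_mul, mul_one] at h
  rw [primeMass]
  linarith

theorem ite_dvd_mul_ite_dvd_le {P Q : ℕ} (hP : P.Prime) (hQ : Q.Prime) (n : ℕ) :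
    ((if P ∣ n then (1 : ℝ) else 0) * if Q ∣ n then 1 else 0) ≤
      (if P * Q ∣ n then 1 else 0) + if P = Q then (if P ∣ n then (1 : ℝ) else 0) else 0 := by
  by_cases hPQ : P = Q
  · subst hPQ
    rw [if_pos rfl]
    split_ifs <;> norm_num
  · rw [if_neg hPQ, add_zero]
    by_cases h1 : P ∣ n
    · by_cases h2 : Q ∣ n
      · rw [if_pos (Nat.Coprime.mul_dvd_of_dvd_of_dvd ((Nat.coprime_primes hP hQ).2 hPQ) h1 h2)]
        simp [h1, h2]
      · simp only [h2, if_false, mul_zero]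
        split_ifs <;> norm_num
    · simp only [h1, if_false, zero_mul]
      split_ifs <;> norm_num

theorem primeWeight_sq_le (w N n : ℕ) :
    primeWeight w N n ^ 2 ≤ pairWeight w N n + primeWeight w N n := by
  rw [sq]
  have h2 : ∀ P ∈ primesIoc w N, (if P ∣ n then (1 : ℝ) else 0) =
      ∑ Q ∈ primesIoc w N, if P = Q then (if P ∣ n then (1 : ℝ) else 0) else 0 := fun P hP => by
    rw [Finset.sum_ite_eq, if_pos hP]
  have h3 : primeWeight w N n = ∑ P ∈ primesIoc w N, ∑ Q ∈ primesIoc w N,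
      if P = Q then (if P ∣ n then (1 : ℝ) else 0) else 0 := Finset.sum_congr rfl h2
  rw [pairWeight]
  nth_rw 3 [h3]
  rw [primeWeight, Finset.sum_mul_sum, ← Finset.sum_add_distrib]
  refine Finset.sum_le_sum fun P hP => ?_
  rw [← Finset.sum_add_distrib]
  exact Finset.sum_le_sum fun Q hQ =>
    ite_dvd_mul_ite_dvd_le (mem_primesIoc.1 hP).2 (mem_primesIoc.1 hQ).2 n

theorem pairWeight_le_sq (w N n : ℕ) : pairWeight w N n ≤ primeWeight w N n ^ 2 := by
  rw [sq, pairWeight, primeWeight, Finset.sum_mul_sum]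
  refine Finset.sum_le_sum fun P _ => Finset.sum_le_sum fun Q _ => ?_
  by_cases h : P * Q ∣ n
  · rw [if_pos h, if_pos (dvd_of_mul_right_dvd h), if_pos (dvd_of_mul_left_dvd h), mul_one]
  · rw [if_neg h]
    split_ifs <;> norm_num

theorem sum_pairWeight_le (w N : ℕ) :
    ∑ n ∈ Finset.Icc 1 N, pairWeight w N n ≤ N * primeMass w N ^ 2 := by
  simp only [pairWeight, primeMass]
  rw [Finset.sum_comm, sq, Finset.sum_mul_sum, Finset.mul_sum]
  refine Finset.sum_le_sum fun P hP => ?_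
  rw [Finset.sum_comm, Finset.mul_sum]
  refine Finset.sum_le_sum fun Q hQ => ?_
  have := sum_filter_dvd_one_le N
    (Nat.mul_pos (mem_primesIoc.1 hP).2.pos (mem_primesIoc.1 hQ).2.pos)
  push_cast at this
  rwa [mul_inv] at this

/-- The Turán–Kubilius inequality for the primes in `(w, N]`. -/
theorem sum_primeWeight_sub_sq_le (w N : ℕ) :
    ∑ n ∈ Finset.Icc 1 N, (primeWeight w N n - primeMass w N) ^ 2 ≤ 3 * N * primeMass w N := by
  have h1 := sum_primeWeight_le w N
  have h2 := le_sum_primeWeight w N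
  have h3 := sum_pairWeight_le w N
  have h0 := primeMass_nonneg w N
  set M := primeMass w N
  calc ∑ n ∈ Finset.Icc 1 N, (primeWeight w N n - M) ^ 2
      ≤ ∑ n ∈ Finset.Icc 1 N,
        (pairWeight w N n + primeWeight w N n - 2 * M * primeWeight w N n + M ^ 2) := by
        refine Finset.sum_le_sum fun n _ => ?_
        linarith [primeWeight_sq_le w N n, sub_sq (primeWeight w N n) M]
    _ = ∑ n ∈ Finset.Icc 1 N, pairWeight w N n + ∑ n ∈ Finset.Icc 1 N, primeWeight w N n
        - 2 * M * ∑ n ∈ Finset.Icc 1 N, primeWeight w N n + N * M ^ 2 := by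
        rw [Finset.sum_add_distrib, Finset.sum_sub_distrib, Finset.sum_add_distrib,
          ← Finset.mul_sum, Finset.sum_const, Nat.card_Icc, Nat.add_sub_cancel, nsmul_eq_mul]
    _ ≤ _ := by nlinarith [mul_le_mul_of_nonneg_left h2 h0]

theorem sum_abs_primeWeight_sub_le (w N : ℕ) :
    ∑ n ∈ Finset.Icc 1 N, |primeWeight w N n - primeMass w N| ≤
      N * √(3 * primeMass w N) := by
  have h := sq_sum_le_card_mul_sum_sq (s := Finset.Icc 1 N)
    (f := fun n => |primeWeight w N n - primeMass w N|)
  simp only [sq_abs, Nat.card_Icc, Nat.add_sub_cancel] at h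
  have h2 := h.trans (mul_le_mul_of_nonneg_left (sum_primeWeight_sub_sq_le w N) (Nat.cast_nonneg N))
  have h0 := primeMass_nonneg w N
  refine abs_le_of_sq_le_sq' ?_ (by positivity) |>.2
  rw [mul_pow, Real.sq_sqrt (by positivity)]
  linarith

theorem sum_abs_pairWeight_sub_le (w N : ℕ) :
    ∑ n ∈ Finset.Icc 1 N, |pairWeight w N n - primeMass w N ^ 2| ≤
      N * (4 * primeMass w N + 2 * primeMass w N * √(3 * primeMass w N)) := by
  have h1 := sum_abs_primeWeight_sub_le w N
  have h2 := sum_primeWeight_sub_sq_le w N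
  have h3 := sum_primeWeight_le w N
  have h0 := primeMass_nonneg w N
  set M := primeMass w N
  calc ∑ n ∈ Finset.Icc 1 N, |pairWeight w N n - M ^ 2|
      ≤ ∑ n ∈ Finset.Icc 1 N, (primeWeight w N n + (primeWeight w N n - M) ^ 2
        + 2 * M * |primeWeight w N n - M|) := by
        refine Finset.sum_le_sum fun n _ => ?_
        have i1 := primeWeight_sq_le w N n
        have i2 := pairWeight_le_sq w N n
        have i3 := primeWeight_nonneg w N n
        have i4 : |primeWeight w N n ^ 2 - M ^ 2| ≤
            (primeWeight w N n - M) ^ 2 + 2 * M * |primeWeight w N n - M| := by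
          have e : primeWeight w N n ^ 2 - M ^ 2 =
            (primeWeight w N n - M) ^ 2 + 2 * M * (primeWeight w N n - M) := by ring
          rw [e]
          refine (abs_add_le _ _).trans ?_
          rw [abs_mul, abs_of_nonneg (sq_nonneg _), abs_of_nonneg (by positivity : 0 ≤ 2 * M)]
        have i5 : |pairWeight w N n - M ^ 2| ≤ primeWeight w N n +
            |primeWeight w N n ^ 2 - M ^ 2| := by
          have := abs_sub_le (pairWeight w N n) (primeWeight w N n ^ 2) (M ^ 2)
          refine this.trans (add_le_add_left ?_ _)
          rw [abs_le]
          constructor <;> linarith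
        linarith
    _ = ∑ n ∈ Finset.Icc 1 N, primeWeight w N n + ∑ n ∈ Finset.Icc 1 N,
        (primeWeight w N n - M) ^ 2 + 2 * M * ∑ n ∈ Finset.Icc 1 N, |primeWeight w N n - M| := by
        rw [Finset.sum_add_distrib, Finset.sum_add_distrib, ← Finset.mul_sum]
    _ ≤ _ := by nlinarith [mul_le_mul_of_nonneg_left h1 h0]

/-- The number of primes `p ≤ y` not dividing `a` with `p ∣ s + a`. -/
noncomputable def smallCount (a : ℤ) (y s : ℕ) : ℝ :=
  ∑ p ∈ (Nat.primesLE y).filter fun p : ℕ => ¬ (p : ℤ) ∣ a, if (p : ℤ) ∣ s + a then 1 else 0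

theorem smallCount_nonneg (a : ℤ) (y s : ℕ) : 0 ≤ smallCount a y s :=
  Finset.sum_nonneg fun _ _ => by split_ifs <;> norm_num

theorem card_prime_dvd_totient_mul_add_le {a : ℤ} {p : ℕ} (hp : p.Prime) (ha : ¬ (p : ℤ) ∣ a)
    (m X : ℕ) {R w : ℕ} (hR : 2 ≤ R) (hRw : R ≤ w) :
    ∑ P ∈ primesIoc w X, (if (p : ℤ) ∣ ((m * P).totient : ℤ) + a then (1 : ℝ) else 0) ≤
      ∑ P ∈ primesIoc w X, (if P ∣ m then (1 : ℝ) else 0) +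
        (4 * X / (p * Real.log R) + (R : ℝ) ^ 6) := by
  have hcop : IsCoprime (p : ℤ) a :=
    (Prime.coprime_iff_not_dvd (Nat.prime_iff_prime_int.1 hp)).2 ha
  set T := (primesIoc w X).filter fun P => ¬ P ∣ m ∧ (p : ℤ) ∣ ((m * P).totient : ℤ) + a with hT
  have h1 : ∑ P ∈ primesIoc w X, (if (p : ℤ) ∣ ((m * P).totient : ℤ) + a then (1 : ℝ) else 0) ≤
      ∑ P ∈ primesIoc w X, (if P ∣ m then (1 : ℝ) else 0) + T.card := by
    rw [hT, ← Finset.sum_boole, ← Finset.sum_add_distrib]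
    refine Finset.sum_le_sum fun P _ => ?_
    by_cases i1 : P ∣ m <;> by_cases i2 : (p : ℤ) ∣ ((m * P).totient : ℤ) + a <;> simp [i1, i2]
  refine h1.trans (add_le_add_right ?_ _)
  have hlog : 0 < Real.log R := Real.log_pos (by exact_mod_cast hR)
  rcases T.eq_empty_or_nonempty with he | ⟨P₀, hP₀⟩
  · rw [he, Finset.card_empty, Nat.cast_zero]
    positivity
  · refine le_trans ?_ (card_prime_modEq_le hp P₀ X hR)
    refine Nat.cast_le.2 (Finset.card_le_card fun P hP => ?_)
    have key : ∀ P ∈ T, P.Prime ∧ (w < P ∧ P ≤ X) ∧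
        (p : ℤ) ∣ ((m.totient * (P - 1) : ℕ) : ℤ) + a := by
      intro P hP
      rw [hT, Finset.mem_filter, mem_primesIoc] at hP
      obtain ⟨⟨hX, hPp⟩, hPm, hd⟩ := hP
      refine ⟨hPp, hX, ?_⟩
      rwa [Nat.totient_mul ((Nat.Prime.coprime_iff_not_dvd hPp).2 hPm).symm,
        Nat.totient_prime hPp] at hd
    obtain ⟨hPp, hX, hd⟩ := key P hP
    obtain ⟨hPp₀, hX₀, hd₀⟩ := key P₀ hP₀
    have hmod := modEq_of_dvd_add hcop hd hd₀
    have hmod' : P ≡ P₀ [MOD p] := by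
      have := hmod.add_right 1
      rwa [Nat.sub_add_cancel hPp.one_le, Nat.sub_add_cancel hPp₀.one_le] at this
    exact Finset.mem_filter.2 ⟨Finset.mem_Ico.2 ⟨hPp.one_le, Nat.lt_succ_of_le hX.2⟩, hPp,
      hRw.trans_lt hX.1, hmod'⟩

theorem sum_primeWeight_mul_smallCount_le (a : ℤ) (N y : ℕ) {R w : ℕ} (hR : 2 ≤ R) (hRw : R ≤ w) :
    ∑ n ∈ Finset.Icc 1 N, primeWeight w N n * smallCount a y n.totient ≤
      N * (4 * (1 + Real.log N) * (∑ p ∈ Nat.primesLE y, (p : ℝ)⁻¹) / Real.log R +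
        y * (R : ℝ) ^ 6 / w + y * (1 + Real.log N) / w) := by
  set A := (Nat.primesLE y).filter fun p : ℕ => ¬ (p : ℤ) ∣ a with hA
  set I := primesIoc w N with hI
  set N' := N / w with hN'
  have hw : 0 < w := by omega
  have hlog : 0 < Real.log R := Real.log_pos (by exact_mod_cast hR)
  have hAp : ∀ p ∈ A, p.Prime ∧ ¬ (p : ℤ) ∣ a := fun p hp => by
    rw [hA, Finset.mem_filter, Nat.mem_primesLE] at hp
    exact ⟨hp.1.2, hp.2⟩
  have hAy : (A.card : ℝ) ≤ y := by
    have : A ⊆ Finset.Icc 1 y := fun p hp => by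
      rw [hA, Finset.mem_filter, Nat.mem_primesLE] at hp
      exact Finset.mem_Icc.2 ⟨hp.1.2.pos, hp.1.1⟩
    have := Finset.card_le_card this
    rw [Nat.card_Icc, Nat.add_sub_cancel] at this
    exact_mod_cast this
  have hN'w : (N' : ℝ) ≤ N / w := Nat.cast_div_le
  have h1 : ∑ n ∈ Finset.Icc 1 N, primeWeight w N n * smallCount a y n.totient =
      ∑ P ∈ I, ∑ m ∈ Finset.Icc 1 (N / P), smallCount a y (m * P).totient := by
    simp only [primeWeight, Finset.sum_mul]
    rw [Finset.sum_comm]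
    refine Finset.sum_congr rfl fun P hP => ?_
    have hP0 := (mem_primesIoc.1 hP).2.pos
    simp only [ite_mul, one_mul, zero_mul]
    rw [sum_filter_dvd_eq N hP0 (fun n => smallCount a y n.totient), ← Finset.sum_filter]
    refine Finset.sum_congr ?_ fun _ _ => rfl
    ext m
    rw [Finset.mem_filter, Finset.mem_Icc, Finset.mem_Icc, Nat.le_div_iff_mul_le hP0]
    exact ⟨fun h => ⟨h.1.1, h.2⟩, fun h => ⟨⟨h.1, (Nat.le_mul_of_pos_right _ hP0).trans h.2⟩, h.2⟩⟩
  have h2 : ∑ P ∈ I, ∑ m ∈ Finset.Icc 1 (N / P), smallCount a y (m * P).totient ≤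
      ∑ m ∈ Finset.Icc 1 N', ∑ P ∈ primesIoc w (N / m), smallCount a y (m * P).totient := by
    refine le_of_eq (Finset.sum_comm' ?_)
    intro P m
    simp only [Finset.mem_Icc, hI, mem_primesIoc, hN']
    constructor
    · rintro ⟨⟨⟨i1, i2⟩, i3⟩, i4, i5⟩
      have i6 : m * P ≤ N := (Nat.le_div_iff_mul_le i3.pos).1 i5
      refine ⟨⟨⟨i1, ?_⟩, i3⟩, i4, ?_⟩
      · rw [Nat.le_div_iff_mul_le i4, mul_comm]
        exact i6
      · exact i5.trans (Nat.div_le_div_left i1.le hw)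
    · rintro ⟨⟨⟨i1, i2⟩, i3⟩, i4, i5⟩
      have i6 : P * m ≤ N := (Nat.le_div_iff_mul_le i4).1 i2
      refine ⟨⟨⟨i1, i2.trans (Nat.div_le_self _ _)⟩, i3⟩, i4, ?_⟩
      rw [Nat.le_div_iff_mul_le i3.pos, mul_comm]
      exact i6
  have h3 : ∀ m ∈ Finset.Icc 1 N', ∑ P ∈ primesIoc w (N / m), smallCount a y (m * P).totient ≤
      y * ∑ P ∈ I, (if P ∣ m then (1 : ℝ) else 0) +
      (4 * N * (∑ p ∈ Nat.primesLE y, (p : ℝ)⁻¹) / Real.log R * (m : ℝ)⁻¹ + y * (R : ℝ) ^ 6) := by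
    intro m hm
    have hm1 : 0 < m := (Finset.mem_Icc.1 hm).1
    have hm' : (0 : ℝ) < m := by exact_mod_cast hm1
    simp only [smallCount]
    rw [Finset.sum_comm]
    have i0 : ∑ P ∈ primesIoc w (N / m), (if P ∣ m then (1 : ℝ) else 0) ≤
        ∑ P ∈ I, (if P ∣ m then (1 : ℝ) else 0) := by
      refine Finset.sum_le_sum_of_subset_of_nonneg (fun P hP => ?_)
        fun _ _ _ => by split_ifs <;> norm_num
      rw [mem_primesIoc] at hP
      rw [hI, mem_primesIoc]
      exact ⟨⟨hP.1.1, hP.1.2.trans (Nat.div_le_self _ _)⟩, hP.2⟩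
    have i0' : 0 ≤ ∑ P ∈ I, (if P ∣ m then (1 : ℝ) else 0) :=
      Finset.sum_nonneg fun _ _ => by split_ifs <;> norm_num
    calc ∑ p ∈ A, ∑ P ∈ primesIoc w (N / m),
          (if (p : ℤ) ∣ ((m * P).totient : ℤ) + a then (1 : ℝ) else 0)
        ≤ ∑ p ∈ A, (∑ P ∈ I, (if P ∣ m then (1 : ℝ) else 0) +
          (4 * N / Real.log R * (m : ℝ)⁻¹ * (p : ℝ)⁻¹ + (R : ℝ) ^ 6)) := by
          refine Finset.sum_le_sum fun p hp => ?_
          refine (card_prime_dvd_totient_mul_add_le (hAp p hp).1 (hAp p hp).2 m (N / m)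
            hR hRw).trans ?_
          refine add_le_add i0 (add_le_add_left ?_ _)
          have hp0 : (0 : ℝ) < p := by exact_mod_cast (hAp p hp).1.pos
          have : ((N / m : ℕ) : ℝ) ≤ N / m := Nat.cast_div_le
          calc 4 * ((N / m : ℕ) : ℝ) / (p * Real.log R) ≤ 4 * (N / m) / (p * Real.log R) := by
                gcongr
            _ = _ := by field_simp
      _ = A.card * ∑ P ∈ I, (if P ∣ m then (1 : ℝ) else 0) +
          (4 * N / Real.log R * (m : ℝ)⁻¹ * ∑ p ∈ A, (p : ℝ)⁻¹ + A.card * (R : ℝ) ^ 6) := by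
          rw [Finset.sum_add_distrib, Finset.sum_add_distrib, ← Finset.mul_sum, Finset.sum_const,
            Finset.sum_const, nsmul_eq_mul, nsmul_eq_mul]
      _ ≤ y * ∑ P ∈ I, (if P ∣ m then (1 : ℝ) else 0) +
          (4 * N / Real.log R * (m : ℝ)⁻¹ * (∑ p ∈ Nat.primesLE y, (p : ℝ)⁻¹)
            + y * (R : ℝ) ^ 6) := by
          have : ∑ p ∈ A, (p : ℝ)⁻¹ ≤ ∑ p ∈ Nat.primesLE y, (p : ℝ)⁻¹ :=
            Finset.sum_le_sum_of_subset_of_nonneg (Finset.filter_subset _ _)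
              fun _ _ _ => by positivity
          gcongr
      _ = _ := by ring
  have h4 : ∑ m ∈ Finset.Icc 1 N', ∑ P ∈ I, (if P ∣ m then (1 : ℝ) else 0) ≤
      N / w * (1 + Real.log N) := by
    rw [Finset.sum_comm]
    calc ∑ P ∈ I, ∑ m ∈ Finset.Icc 1 N', (if P ∣ m then (1 : ℝ) else 0)
        ≤ ∑ P ∈ I, N' * (P : ℝ)⁻¹ := Finset.sum_le_sum fun P hP =>
          sum_filter_dvd_one_le N' (mem_primesIoc.1 hP).2.pos
      _ = N' * ∑ P ∈ I, (P : ℝ)⁻¹ := by rw [Finset.mul_sum]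
      _ ≤ _ := by
        have := sum_primesIoc_inv_le w N
        gcongr
  have h5 : ∑ m ∈ Finset.Icc 1 N', (m : ℝ)⁻¹ ≤ 1 + Real.log N :=
    (Finset.sum_le_sum_of_subset_of_nonneg
      (Finset.Icc_subset_Icc_right (Nat.div_le_self _ _)) fun _ _ _ => by positivity).trans
      (sum_Icc_inv_le N)
  have hS : 0 ≤ ∑ p ∈ Nat.primesLE y, (p : ℝ)⁻¹ := Finset.sum_nonneg fun _ _ => by positivity
  rw [h1]
  refine h2.trans ((Finset.sum_le_sum h3).trans ?_)
  rw [Finset.sum_add_distrib, Finset.sum_add_distrib, ← Finset.mul_sum, ← Finset.mul_sum,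
    Finset.sum_const, Nat.card_Icc, Nat.add_sub_cancel, nsmul_eq_mul]
  set S := ∑ p ∈ Nat.primesLE y, (p : ℝ)⁻¹
  calc _ ≤ y * (N / w * (1 + Real.log N)) + (4 * N * S / Real.log R * (1 + Real.log N) +
        N / w * (y * (R : ℝ) ^ 6)) := by gcongr
    _ = _ := by ring

/-- The elementary symmetric function of degree `k` in the values `f i`, `i ∈ s`. -/
def elemSymm {ι R : Type*} [CommRing R] (s : Finset ι) (f : ι → R) (k : ℕ) : R :=
  ∑ t ∈ s.powersetCard k, ∏ i ∈ t, f i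

theorem elemSymm_zero {ι R : Type*} [CommRing R] (s : Finset ι) (f : ι → R) :
    elemSymm s f 0 = 1 := by
  simp [elemSymm]

theorem elemSymm_insert_succ {ι R : Type*} [CommRing R] [DecidableEq ι] {s : Finset ι} {j : ι}
    (hj : j ∉ s) (f : ι → R) (k : ℕ) :
    elemSymm (insert j s) f (k + 1) = elemSymm s f (k + 1) + f j * elemSymm s f k := by
  have hnot : ∀ t ∈ s.powersetCard k, j ∉ t := fun t ht h =>
    hj ((Finset.mem_powersetCard.1 ht).1 h)
  rw [elemSymm, Finset.powersetCard_succ_insert hj, Finset.sum_union, Finset.sum_image]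
  · rw [elemSymm, elemSymm, Finset.mul_sum]
    congr 1
    exact Finset.sum_congr rfl fun t ht => Finset.prod_insert (hnot t ht)
  · intro t ht t' ht' h
    rw [← Finset.erase_insert (hnot t ht), ← Finset.erase_insert (hnot t' ht'), h]
  · rw [Finset.disjoint_left]
    intro t ht ht'
    obtain ⟨t', _, rfl⟩ := Finset.mem_image.1 ht'
    exact hj ((Finset.mem_powersetCard.1 ht).1 (Finset.mem_insert_self _ _))

theorem elemSymm_le_exp {ι : Type*} {s : Finset ι} {f : ι → ℝ} (hf : ∀ i ∈ s, 0 ≤ f i) (k : ℕ) :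
    elemSymm s f k ≤ Real.exp (∑ i ∈ s, f i) := by
  classical
  calc elemSymm s f k ≤ ∑ t ∈ s.powerset, ∏ i ∈ t, f i := by
        refine Finset.sum_le_sum_of_subset_of_nonneg
          (fun t ht => Finset.mem_powerset.2 (Finset.mem_powersetCard.1 ht).1) ?_
        intro t ht _
        exact Finset.prod_nonneg fun i hi => hf i (Finset.mem_powerset.1 ht hi)
    _ = ∏ i ∈ s, (1 + f i) := (Finset.prod_one_add s).symm
    _ ≤ ∏ i ∈ s, Real.exp (f i) := by
        refine Finset.prod_le_prod (fun i hi => by linarith [hf i hi]) fun i _ => ?_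
        linarith [Real.add_one_le_exp (f i)]
    _ = _ := (Real.exp_sum s f).symm

theorem norm_one_add_mul_le_one {c : ℂ} (hc : ‖1 + c‖ ≤ 1) {r : ℝ} (h0 : 0 ≤ r) (h1 : r ≤ 1) :
    ‖1 + c * r‖ ≤ 1 := by
  have e : 1 + c * r = ((1 - r : ℝ) : ℂ) + (r : ℂ) * (1 + c) := by
    push_cast
    ring
  rw [e]
  refine (norm_add_le _ _).trans ?_
  rw [norm_mul, Complex.norm_real, Complex.norm_real, Real.norm_of_nonneg h0,
    Real.norm_of_nonneg (by linarith : 0 ≤ 1 - r)]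
  nlinarith

/-- Truncating the expansion of `∏ (1 + c * f i)` costs at most the first omitted term. -/
theorem norm_prod_sub_sum_elemSymm_le {ι : Type*} {s : Finset ι} {f : ι → ℝ}
    (h0 : ∀ i ∈ s, 0 ≤ f i) (h1 : ∀ i ∈ s, f i ≤ 1) {c : ℂ} (hc : ‖1 + c‖ ≤ 1) (K : ℕ) :
    ‖∏ i ∈ s, (1 + c * f i) - ∑ k ∈ Finset.range K, c ^ k * (elemSymm s f k : ℝ)‖ ≤
      ‖c‖ ^ K * elemSymm s f K := by
  classical
  have hP : ∀ t ⊆ s, ‖∏ i ∈ t, (1 + c * f i)‖ ≤ 1 := fun t ht => by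
    rw [norm_prod]
    exact Finset.prod_le_one (fun _ _ => norm_nonneg _) fun i hi =>
      norm_one_add_mul_le_one hc (h0 i (ht hi)) (h1 i (ht hi))
  suffices H : ∀ t ⊆ s, ∀ K : ℕ,
      ‖∏ i ∈ t, (1 + c * f i) - ∑ k ∈ Finset.range K, c ^ k * (elemSymm t f k : ℝ)‖ ≤
      ‖c‖ ^ K * elemSymm t f K from H s subset_rfl K
  intro t
  induction t using Finset.induction_on with
  | empty =>
    intro _ K
    cases K with
    | zero => simp [elemSymm]
    | succ K =>
      rw [Finset.sum_range_succ']
      have : ∀ k, elemSymm (∅ : Finset ι) f (k + 1) = 0 := fun k => by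
        rw [elemSymm, Finset.powersetCard_eq_empty.2 (by simp), Finset.sum_empty]
      simp [this, elemSymm_zero]
  | insert j t hj ih =>
    intro hs K
    have hts : t ⊆ s := (Finset.subset_insert _ _).trans hs
    have hjs : j ∈ s := hs (Finset.mem_insert_self _ _)
    cases K with
    | zero => simpa [elemSymm_zero] using hP _ hs
    | succ K =>
      have e : ∏ i ∈ insert j t, (1 + c * f i) -
          ∑ k ∈ Finset.range (K + 1), c ^ k * (elemSymm (insert j t) f k : ℝ) =
          (∏ i ∈ t, (1 + c * f i) -
            ∑ k ∈ Finset.range (K + 1), c ^ k * (elemSymm t f k : ℝ)) +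
          c * f j * (∏ i ∈ t, (1 + c * f i) -
            ∑ k ∈ Finset.range K, c ^ k * (elemSymm t f k : ℝ)) := by
        rw [Finset.prod_insert hj, Finset.sum_range_succ', Finset.sum_range_succ', elemSymm_zero,
          elemSymm_zero]
        simp only [elemSymm_insert_succ hj, Complex.ofReal_add, Complex.ofReal_mul, mul_add,
          Finset.sum_add_distrib, mul_sub, Finset.mul_sum]
        have : ∑ k ∈ Finset.range K, c ^ (k + 1) * ((f j : ℂ) * (elemSymm t f k : ℝ)) =
            ∑ k ∈ Finset.range K, c * f j * (c ^ k * (elemSymm t f k : ℝ)) :=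
          Finset.sum_congr rfl fun k _ => by ring
        rw [this]
        ring
      rw [e, elemSymm_insert_succ hj]
      refine (norm_add_le _ _).trans ?_
      rw [norm_mul, norm_mul, Complex.norm_real, Real.norm_of_nonneg (h0 j hjs)]
      calc _ ≤ ‖c‖ ^ (K + 1) * elemSymm t f (K + 1) +
            ‖c‖ * f j * (‖c‖ ^ K * elemSymm t f K) := by
            have := h0 j hjs
            exact add_le_add (ih hts _) (mul_le_mul_of_nonneg_left (ih hts _) (by positivity))
        _ = _ := by ring

/-- The products of `k` distinct elements of `s`. -/
def subsetProducts (s : Finset ℕ) (k : ℕ) : Finset ℕ := (s.powersetCard k).image fun t => ∏ p ∈ t, p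

theorem totient_prod_primes {t : Finset ℕ} (ht : ∀ p ∈ t, p.Prime) :
    (∏ p ∈ t, p).totient = ∏ p ∈ t, p.totient := by
  induction t using Finset.induction_on with
  | empty => simp
  | insert j t hj ih =>
    rw [Finset.prod_insert hj, Finset.prod_insert hj, Nat.totient_mul,
      ih fun p hp => ht p (Finset.mem_insert_of_mem hp)]
    refine Nat.Coprime.prod_right fun p hp => ?_
    refine (Nat.coprime_primes (ht j (Finset.mem_insert_self _ _))
      (ht p (Finset.mem_insert_of_mem hp))).2 ?_
    rintro rfl
    exact hj hp

theorem sum_subsetProducts {s : Finset ℕ} (hs : ∀ p ∈ s, p.Prime) (k : ℕ) (g : ℕ → ℝ) :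
    ∑ d ∈ subsetProducts s k, g d = ∑ t ∈ s.powersetCard k, g (∏ p ∈ t, p) := by
  refine Finset.sum_image fun t ht t' ht' h => ?_
  have h1 : ∀ t ∈ s.powersetCard k, (∏ p ∈ t, p).primeFactors = t := fun t ht =>
    Nat.primeFactors_prod fun p hp => hs p ((Finset.mem_powersetCard.1 ht).1 hp)
  rw [← h1 t ht, ← h1 t' ht']
  exact congrArg _ h

theorem totalDefect_subsetProducts {s : Finset ℕ} (hs : ∀ p ∈ s, p.Prime) (a : ℤ) (k n : ℕ) :
    totalDefect a (subsetProducts s k) n =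
      elemSymm s (fun p => if (p : ℤ) ∣ n + a then (1 : ℝ) else 0) k -
      elemSymm s (fun p => if p.Coprime n then ((p.totient : ℝ))⁻¹ else 0) k := by
  rw [totalDefect, sum_subsetProducts hs, elemSymm, elemSymm, ← Finset.sum_sub_distrib]
  refine Finset.sum_congr rfl fun t ht => ?_
  have htp : ∀ p ∈ t, p.Prime := fun p hp => hs p ((Finset.mem_powersetCard.1 ht).1 hp)
  rw [residueDefect]
  congr 1
  · rw [Finset.prod_ite_zero]
    have : ((∏ p ∈ t, p : ℕ) : ℤ) ∣ n + a ↔ ∀ p ∈ t, (p : ℤ) ∣ n + a := by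
      constructor
      · intro h p hp
        exact (Int.natCast_dvd_natCast.2 (Finset.dvd_prod_of_mem _ hp)).trans h
      · intro h
        rw [Nat.cast_prod]
        refine Finset.prod_dvd_of_coprime (fun p hp q hq hpq => ?_) h
        exact Nat.isCoprime_iff_coprime.2 ((Nat.coprime_primes (htp p hp) (htp q hq)).2 hpq)
    simp only [this, Finset.prod_const_one]
  · rw [Finset.prod_ite_zero, totient_prod_primes htp, Nat.cast_prod, Finset.prod_inv_distrib]
    simp only [Nat.coprime_prod_left_iff]

theorem roughModuli_subsetProducts {s : Finset ℕ} {a : ℤ} (ha : a ≠ 0) {y z k : ℕ}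
    (hs : ∀ p ∈ s, p.Prime ∧ y < p ∧ p ≤ z) (hay : a.natAbs ≤ y) (hk : 2 * k ≤ y) (hz : 1 ≤ z)
    {K : ℕ} (hkK : k ≤ K) : RoughModuli a (subsetProducts s k) (z ^ K) y := by
  have key : ∀ d ∈ subsetProducts s k, ∃ t ⊆ s, t.card = k ∧ ∏ p ∈ t, p = d := by
    intro d hd
    obtain ⟨t, ht, rfl⟩ := Finset.mem_image.1 hd
    obtain ⟨h1, h2⟩ := Finset.mem_powersetCard.1 ht
    exact ⟨t, h1, h2, rfl⟩
  refine ⟨?_, ?_, ?_, ?_, ?_⟩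
  · intro d hd
    obtain ⟨t, ht, _, rfl⟩ := key d hd
    exact Finset.prod_pos fun p hp => (hs p (ht hp)).1.pos
  · intro d hd
    obtain ⟨t, ht, hc, rfl⟩ := key d hd
    refine (Finset.prod_le_pow_card _ _ z fun p hp => (hs p (ht hp)).2.2).trans ?_
    rw [hc]
    exact Nat.pow_le_pow_right hz hkK
  · intro d hd
    obtain ⟨t, ht, _, rfl⟩ := key d hd
    rw [Nat.cast_prod]
    refine IsCoprime.prod_left fun p hp => ?_
    obtain ⟨hpp, hyp, _⟩ := hs p (ht hp)
    rw [Prime.coprime_iff_not_dvd (Nat.prime_iff_prime_int.1 hpp)]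
    intro h
    have := Nat.le_of_dvd (Int.natAbs_pos.2 ha) (Int.natCast_dvd.1 h)
    omega
  · intro d hd
    obtain ⟨t, ht, hc, rfl⟩ := key d hd
    rw [totient_prod_primes fun p hp => (hs p (ht hp)).1]
    have h : ∀ u ⊆ t, (y - u.card) * ∏ p ∈ u, p ≤ y * ∏ p ∈ u, p.totient := by
      intro u
      induction u using Finset.induction_on with
      | empty => simp
      | insert j u hj ih =>
        intro hu
        obtain ⟨hjp, hyj, _⟩ := hs j (ht (hu (Finset.mem_insert_self _ _)))
        have ih' := ih ((Finset.subset_insert _ _).trans hu)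
        rw [Finset.prod_insert hj, Finset.prod_insert hj, Finset.card_insert_of_notMem hj,
          Nat.totient_prime hjp]
        have h1 : (y - (u.card + 1)) * j ≤ (y - u.card) * (j - 1) := by
          rcases le_or_gt y u.card with hc | hc
          · rw [Nat.sub_eq_zero_of_le (by omega)]
            omega
          · obtain ⟨v, hv⟩ : ∃ v, y - u.card = v + 1 := ⟨y - u.card - 1, by omega⟩
            obtain ⟨i, rfl⟩ : ∃ i, j = i + 1 := ⟨j - 1, by omega⟩
            rw [hv, Nat.add_sub_cancel, show y - (u.card + 1) = v by omega]
            have hvi : v ≤ i := by omega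
            nlinarith
        calc (y - (u.card + 1)) * (j * ∏ p ∈ u, p) = ((y - (u.card + 1)) * j) * ∏ p ∈ u, p := by
              ring
          _ ≤ ((y - u.card) * (j - 1)) * ∏ p ∈ u, p := Nat.mul_le_mul_right _ h1
          _ = (j - 1) * ((y - u.card) * ∏ p ∈ u, p) := by ring
          _ ≤ (j - 1) * (y * ∏ p ∈ u, p.totient) := Nat.mul_le_mul_left _ ih'
          _ = _ := by ring
    have h2 := h t subset_rfl
    rw [hc] at h2
    rcases Nat.eq_zero_or_pos y with hy | hy
    · have : t = ∅ := Finset.card_eq_zero.1 (by omega)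
      simp [this]
    · have h3 : y * ∏ p ∈ t, p ≤ 2 * ((y - k) * ∏ p ∈ t, p) := by
        rw [← mul_assoc]
        exact Nat.mul_le_mul_right _ (by omega)
      refine Nat.le_of_mul_le_mul_left ?_ hy
      calc _ ≤ _ := h3
        _ ≤ 2 * (y * ∏ p ∈ t, p.totient) := Nat.mul_le_mul_left _ h2
        _ = _ := by ring
  · intro d hd p hp hpd
    obtain ⟨t, ht, _, rfl⟩ := key d hd
    obtain ⟨q, hq, hpq⟩ := (Prime.dvd_finsetProd_iff (Nat.prime_iff.1 hp) _).1 hpd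
    obtain ⟨hqp, hyq, _⟩ := hs q (ht hq)
    rwa [(Nat.prime_dvd_prime_iff_eq hp hqp).1 hpq]

/-- The number of primes in `(y, z]` dividing `s + a`. -/
def windowCount (a : ℤ) (y z s : ℕ) : ℕ :=
  ((primesIoc y z).filter fun p : ℕ => (p : ℤ) ∣ s + a).card

/-- The bilinear error term, normalised by `N`. -/
noncomputable def bilinearError (D y w N : ℕ) : ℝ :=
  (1 + Real.log N) * ((Nat.log 2 N + 1) * bilinearSaving D y w + 6 * D / w)

theorem bilinearError_nonneg (D y w N : ℕ) : 0 ≤ bilinearError D y w N := by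
  have h : 0 ≤ Real.log N := Real.log_natCast_nonneg N
  have h' : 0 ≤ bilinearSaving D y w := Real.sqrt_nonneg _
  rw [bilinearError]
  positivity

theorem abs_sum_pairWeight_mul_elemSymm_sub_le {a : ℤ} (ha : a ≠ 0) {y z w k K : ℕ}
    (hay : a.natAbs ≤ y) (hk : 2 * k ≤ y) (hkK : k ≤ K) (hy : 1 ≤ y) (hz : 1 ≤ z) (hw : 1 ≤ w)
    (N : ℕ) :
    |∑ n ∈ Finset.Icc 1 N, pairWeight w N n *
      (elemSymm (primesIoc y z)
        (fun p => if (p : ℤ) ∣ n.totient + a then (1 : ℝ) else 0) k -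
      elemSymm (primesIoc y z)
        (fun p => if p.Coprime n.totient then ((p.totient : ℝ))⁻¹ else 0) k)| ≤
      N * bilinearError (z ^ K) y w N := by
  have hR : RoughModuli a (subsetProducts (primesIoc y z) k) (z ^ K) y :=
    roughModuli_subsetProducts ha (fun p hp => by
      rw [mem_primesIoc] at hp
      exact ⟨hp.2, hp.1.1, hp.1.2⟩) hay hk hz hkK
  have h := hR.abs_sum_pairWeight_mul_le hy hw N
  simp only [totalDefect_subsetProducts (fun p hp => (mem_primesIoc.1 hp).2)] at h
  refine h.trans (le_of_eq ?_)
  rw [bilinearError]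
  ring

theorem inv_totient_le {p : ℕ} (hp : p.Prime) : ((p.totient : ℝ))⁻¹ ≤ 2 * (p : ℝ)⁻¹ := by
  have h1 : (p : ℝ) ≤ 2 * p.totient := by
    rw [Nat.totient_prime hp]
    have := hp.two_le
    exact_mod_cast (by omega : p ≤ 2 * (p - 1))
  have h0 : (0 : ℝ) < p := by exact_mod_cast hp.pos
  have h2 : (0 : ℝ) < p.totient := by linarith
  rw [← div_eq_mul_inv, inv_eq_one_div, div_le_div_iff₀ h2 h0]
  linarith

theorem ite_coprime_inv_totient_mem {p : ℕ} (hp : p.Prime) (s : ℕ) :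
    0 ≤ (if p.Coprime s then ((p.totient : ℝ))⁻¹ else 0) ∧
      (if p.Coprime s then ((p.totient : ℝ))⁻¹ else 0) ≤ 1 := by
  have h1 : (1 : ℝ) ≤ p.totient := by exact_mod_cast Nat.totient_pos.2 hp.pos
  have h2 := inv_le_one_of_one_le₀ h1
  split_ifs
  · exact ⟨by positivity, h2⟩
  · exact ⟨le_rfl, zero_le_one⟩

/-- The expected value of `(1 + c) ^ windowCount a y z s`. -/
noncomputable def localProduct (c : ℂ) (y z s : ℕ) : ℂ :=
  ∏ p ∈ primesIoc y z, (1 + c * ((if p.Coprime s then ((p.totient : ℝ))⁻¹ else 0 : ℝ) : ℂ))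

theorem norm_localProduct_le {c : ℂ} (hc : ‖1 + c‖ ≤ 1) (y z s : ℕ) :
    ‖localProduct c y z s‖ ≤ 1 := by
  rw [localProduct, norm_prod]
  refine Finset.prod_le_one (fun _ _ => norm_nonneg _) fun p hp => ?_
  have := ite_coprime_inv_totient_mem (mem_primesIoc.1 hp).2 s
  exact norm_one_add_mul_le_one hc this.1 this.2

theorem one_add_pow_windowCount (c : ℂ) (a : ℤ) (y z s : ℕ) :
    (1 + c) ^ windowCount a y z s = ∏ p ∈ primesIoc y z,
      (1 + c * ((if (p : ℤ) ∣ s + a then (1 : ℝ) else 0 : ℝ) : ℂ)) := by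
  rw [windowCount, ← Finset.prod_const, Finset.prod_filter]
  refine Finset.prod_congr rfl fun p _ => ?_
  split_ifs <;> simp

theorem norm_one_add_pow_sub_localProduct_le {c : ℂ} (hc : ‖1 + c‖ ≤ 1) (a : ℤ) (y z s K : ℕ) :
    ‖(1 + c) ^ windowCount a y z s - localProduct c y z s -
      ∑ k ∈ Finset.range K, c ^ k * ((elemSymm (primesIoc y z)
        (fun p => if (p : ℤ) ∣ s + a then (1 : ℝ) else 0) k -
      elemSymm (primesIoc y z)
        (fun p => if p.Coprime s then ((p.totient : ℝ))⁻¹ else 0) k : ℝ) : ℂ)‖ ≤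
      ‖c‖ ^ K * ((elemSymm (primesIoc y z)
        (fun p => if (p : ℤ) ∣ s + a then (1 : ℝ) else 0) K -
      elemSymm (primesIoc y z)
        (fun p => if p.Coprime s then ((p.totient : ℝ))⁻¹ else 0) K) +
        2 * Real.exp (∑ p ∈ primesIoc y z, ((p.totient : ℝ))⁻¹)) := by
  have hb := fun p (hp : p ∈ primesIoc y z) =>
    ite_coprime_inv_totient_mem (mem_primesIoc.1 hp).2 s
  have h1 := norm_prod_sub_sum_elemSymm_le (s := primesIoc y z)
    (f := fun p : ℕ => if (p : ℤ) ∣ s + a then (1 : ℝ) else 0)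
    (fun p _ => by split_ifs <;> norm_num) (fun p _ => by split_ifs <;> norm_num) hc K
  have h2 := norm_prod_sub_sum_elemSymm_le (s := primesIoc y z)
    (f := fun p : ℕ => if p.Coprime s then ((p.totient : ℝ))⁻¹ else 0)
    (fun p hp => (hb p hp).1) (fun p hp => (hb p hp).2) hc K
  have h3 : elemSymm (primesIoc y z) (fun p => if p.Coprime s then ((p.totient : ℝ))⁻¹ else 0) K
      ≤ Real.exp (∑ p ∈ primesIoc y z, ((p.totient : ℝ))⁻¹) := by
    refine (elemSymm_le_exp (fun p hp => (hb p hp).1) K).trans (Real.exp_le_exp.2 ?_)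
    refine Finset.sum_le_sum fun p _ => ?_
    have : 0 ≤ ((p.totient : ℝ))⁻¹ := by positivity
    split_ifs <;> linarith
  rw [← one_add_pow_windowCount] at h1
  change ‖localProduct c y z s - _‖ ≤ _ at h2
  set e1 := elemSymm (primesIoc y z) (fun p => if (p : ℤ) ∣ s + a then (1 : ℝ) else 0)
  set e2 := elemSymm (primesIoc y z) (fun p => if p.Coprime s then ((p.totient : ℝ))⁻¹ else 0)
  have e : (1 + c) ^ windowCount a y z s - localProduct c y z s -
      ∑ k ∈ Finset.range K, c ^ k * ((e1 k - e2 k : ℝ) : ℂ) =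
      ((1 + c) ^ windowCount a y z s - ∑ k ∈ Finset.range K, c ^ k * (e1 k : ℂ)) -
      (localProduct c y z s - ∑ k ∈ Finset.range K, c ^ k * (e2 k : ℂ)) := by
    simp only [Complex.ofReal_sub, mul_sub, Finset.sum_sub_distrib]
    ring
  rw [e]
  refine (norm_sub_le _ _).trans ((add_le_add h1 h2).trans ?_)
  have := mul_le_mul_of_nonneg_left h3 (by positivity : 0 ≤ ‖c‖ ^ K)
  linarith

theorem norm_sum_pairWeight_mul_sub_localProduct_le {a : ℤ} (ha : a ≠ 0) {y z w K : ℕ}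
    (hay : a.natAbs ≤ y) (hK : 2 * K ≤ y) (hy : 1 ≤ y) (hz : 1 ≤ z) (hw : 1 ≤ w) (N : ℕ)
    {c : ℂ} (hc : ‖1 + c‖ ≤ 1) :
    ‖∑ n ∈ Finset.Icc 1 N, (pairWeight w N n : ℂ) *
      ((1 + c) ^ windowCount a y z n.totient - localProduct c y z n.totient)‖ ≤
    N * (2 ^ (K + 1) * bilinearError (z ^ K) y w N +
      2 * ‖c‖ ^ K * Real.exp (∑ p ∈ primesIoc y z, ((p.totient : ℝ))⁻¹) * primeMass w N ^ 2) := by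
  set B := bilinearError (z ^ K) y w N with hB
  have hB0 : 0 ≤ B := bilinearError_nonneg _ _ _ _
  set E := Real.exp (∑ p ∈ primesIoc y z, ((p.totient : ℝ))⁻¹)
  set F : ℕ → ℕ → ℝ := fun n k => elemSymm (primesIoc y z)
        (fun p => if (p : ℤ) ∣ n.totient + a then (1 : ℝ) else 0) k -
      elemSymm (primesIoc y z)
        (fun p => if p.Coprime n.totient then ((p.totient : ℝ))⁻¹ else 0) k with hF
  have hFk : ∀ k ≤ K, |∑ n ∈ Finset.Icc 1 N, pairWeight w N n * F n k| ≤ N * B := fun k hk =>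
    abs_sum_pairWeight_mul_elemSymm_sub_le ha hay (by omega) hk hy hz hw N
  have hc2 : ‖c‖ ≤ 2 := by
    have : c = (1 + c) - 1 := by ring
    rw [this]
    refine (norm_sub_le _ _).trans ?_
    rw [norm_one]
    linarith
  set G : ℕ → ℂ := fun n =>
    (1 + c) ^ windowCount a y z n.totient - localProduct c y z n.totient with hG
  have hGn : ∀ n, ‖G n - ∑ k ∈ Finset.range K, c ^ k * (F n k : ℂ)‖ ≤
      ‖c‖ ^ K * (F n K + 2 * E) := fun n =>
    norm_one_add_pow_sub_localProduct_le hc a y z n.totient K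
  have e : ∑ n ∈ Finset.Icc 1 N, (pairWeight w N n : ℂ) * G n =
      ∑ n ∈ Finset.Icc 1 N, (pairWeight w N n : ℂ) *
        (G n - ∑ k ∈ Finset.range K, c ^ k * (F n k : ℂ)) +
      ∑ k ∈ Finset.range K, c ^ k *
        ((∑ n ∈ Finset.Icc 1 N, pairWeight w N n * F n k : ℝ) : ℂ) := by
    simp only [Complex.ofReal_sum, Complex.ofReal_mul, Finset.mul_sum, mul_sub,
      Finset.sum_sub_distrib]
    rw [Finset.sum_comm (s := Finset.range K)]
    have : ∀ n k, (pairWeight w N n : ℂ) * (c ^ k * (F n k : ℂ)) =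
      c ^ k * ((pairWeight w N n : ℂ) * (F n k : ℂ)) := fun n k => by ring
    simp only [this]
    ring
  rw [e]
  refine (norm_add_le _ _).trans ?_
  have i1 : ‖∑ n ∈ Finset.Icc 1 N, (pairWeight w N n : ℂ) *
        (G n - ∑ k ∈ Finset.range K, c ^ k * (F n k : ℂ))‖ ≤
      ‖c‖ ^ K * (N * B + 2 * E * (N * primeMass w N ^ 2)) := by
    refine (norm_sum_le _ _).trans ?_
    calc _ ≤ ∑ n ∈ Finset.Icc 1 N, pairWeight w N n * (‖c‖ ^ K * (F n K + 2 * E)) := by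
          refine Finset.sum_le_sum fun n _ => ?_
          rw [norm_mul, Complex.norm_real, Real.norm_of_nonneg (pairWeight_nonneg _ _ _)]
          exact mul_le_mul_of_nonneg_left (hGn n) (pairWeight_nonneg _ _ _)
      _ = ‖c‖ ^ K * (∑ n ∈ Finset.Icc 1 N, pairWeight w N n * F n K +
            2 * E * ∑ n ∈ Finset.Icc 1 N, pairWeight w N n) := by
          rw [Finset.mul_sum, ← Finset.sum_add_distrib, Finset.mul_sum]
          exact Finset.sum_congr rfl fun n _ => by ring
      _ ≤ _ := by
          have h1 := (le_abs_self _).trans (hFk K le_rfl)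
          have h2 := sum_pairWeight_le w N
          have h3 : 0 ≤ E := Real.exp_nonneg _
          gcongr
  have i2 : ‖∑ k ∈ Finset.range K, c ^ k *
        ((∑ n ∈ Finset.Icc 1 N, pairWeight w N n * F n k : ℝ) : ℂ)‖ ≤
      ∑ k ∈ Finset.range K, 2 ^ k * (N * B) := by
    refine (norm_sum_le _ _).trans (Finset.sum_le_sum fun k hk => ?_)
    rw [norm_mul, norm_pow, Complex.norm_real, Real.norm_eq_abs]
    have := hFk k (Finset.mem_range.1 hk).le
    gcongr
  have i3 : ∑ k ∈ Finset.range K, (2 : ℝ) ^ k = 2 ^ K - 1 := by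
    rw [geom_sum_eq (by norm_num)]
    norm_num
  rw [← Finset.sum_mul, i3] at i2
  have i4 : ‖c‖ ^ K * (N * B) ≤ 2 ^ K * (N * B) := by gcongr
  have i5 : 0 ≤ N * B := by positivity
  calc _ ≤ _ := add_le_add i1 i2
    _ ≤ _ := by
      rw [pow_succ (2 : ℝ)]
      nlinarith

theorem norm_prod_sub_prod_le {ι : Type*} {s : Finset ι} {u v : ι → ℂ}
    (hu : ∀ i ∈ s, ‖u i‖ ≤ 1) (hv : ∀ i ∈ s, ‖v i‖ ≤ 1) :
    ‖∏ i ∈ s, u i - ∏ i ∈ s, v i‖ ≤ ∑ i ∈ s, ‖u i - v i‖ := by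
  classical
  induction s using Finset.induction_on with
  | empty => simp
  | insert j s hj ih =>
    rw [Finset.prod_insert hj, Finset.prod_insert hj, Finset.sum_insert hj]
    have h1 := ih (fun i hi => hu i (Finset.mem_insert_of_mem hi))
      (fun i hi => hv i (Finset.mem_insert_of_mem hi))
    have h2 : ‖∏ i ∈ s, u i‖ ≤ 1 := by
      rw [norm_prod]
      exact Finset.prod_le_one (fun _ _ => norm_nonneg _)
        fun i hi => hu i (Finset.mem_insert_of_mem hi)
    have h3 := hv j (Finset.mem_insert_self _ _)
    have e : u j * ∏ i ∈ s, u i - v j * ∏ i ∈ s, v i =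
      (u j - v j) * ∏ i ∈ s, u i + v j * (∏ i ∈ s, u i - ∏ i ∈ s, v i) := by ring
    rw [e]
    refine (norm_add_le _ _).trans ?_
    rw [norm_mul, norm_mul]
    exact add_le_add (mul_le_of_le_one_right (norm_nonneg _) h2)
      ((mul_le_of_le_one_left (norm_nonneg _) h3).trans h1)

theorem exists_modEq_one_of_dvd_totient {n p : ℕ} (hn : n ≠ 0) (hp : p.Prime)
    (h : p ∣ n.totient) : p ^ 2 ∣ n ∨ ∃ j, 1 ≤ j ∧ p * j + 1 ∣ n := by
  rw [Nat.totient_eq_prod_factorization hn] at h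
  obtain ⟨P, hP, hd⟩ := (Prime.dvd_finsetProd_iff (Nat.prime_iff.1 hp) _).1 h
  have hPp : P.Prime := Nat.prime_of_mem_primeFactors hP
  rcases (Nat.Prime.dvd_mul hp).1 hd with h1 | h1
  · left
    have h2 : p = P := (Nat.prime_dvd_prime_iff_eq hp hPp).1 (hp.dvd_of_dvd_pow h1)
    subst h2
    have h3 : 2 ≤ n.factorization p := by
      by_contra h4
      have : n.factorization p - 1 = 0 := by omega
      rw [this, pow_zero] at h1
      exact hp.one_lt.ne' (Nat.dvd_one.1 h1)
    exact (pow_dvd_pow p h3).trans (Nat.ordProj_dvd n p)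
  · right
    obtain ⟨j, hj⟩ := h1
    refine ⟨j, ?_, ?_⟩
    · rcases Nat.eq_zero_or_pos j with h0 | h0
      · have := hPp.two_le
        rw [h0, mul_zero] at hj
        omega
      · exact h0
    · rw [← hj, Nat.sub_add_cancel hPp.one_le]
      exact Nat.dvd_of_mem_primeFactors hP

theorem sum_dvd_totient_le {p : ℕ} (hp : p.Prime) (N : ℕ) :
    ∑ n ∈ Finset.Icc 1 N, (if p ∣ n.totient then (1 : ℝ) else 0) ≤
      N * (2 + Real.log N) * (p : ℝ)⁻¹ := by
  have hp0 : (0 : ℝ) < p := by exact_mod_cast hp.pos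
  have hp1 : (1 : ℝ) ≤ p := by exact_mod_cast hp.one_le
  have h1 : ∀ n ∈ Finset.Icc 1 N, (if p ∣ n.totient then (1 : ℝ) else 0) ≤
      (if p ^ 2 ∣ n then (1 : ℝ) else 0) +
        ∑ j ∈ Finset.Icc 1 N, if p * j + 1 ∣ n then (1 : ℝ) else 0 := by
    intro n hn
    rw [Finset.mem_Icc] at hn
    have hnn : 0 ≤ ∑ j ∈ Finset.Icc 1 N, if p * j + 1 ∣ n then (1 : ℝ) else 0 :=
      Finset.sum_nonneg fun _ _ => by split_ifs <;> norm_num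
    by_cases h : p ∣ n.totient
    · rw [if_pos h]
      rcases exists_modEq_one_of_dvd_totient (by omega) hp h with h2 | ⟨j, hj, h2⟩
      · rw [if_pos h2]
        linarith
      · have hjN : j ∈ Finset.Icc 1 N := by
          have h3 := Nat.le_of_dvd (by omega) h2
          have h4 := Nat.le_mul_of_pos_left j hp.pos
          exact Finset.mem_Icc.2 ⟨hj, by omega⟩
        have := Finset.single_le_sum
          (f := fun j => if p * j + 1 ∣ n then (1 : ℝ) else 0)
          (fun _ _ => by split_ifs <;> norm_num) hjN
        simp only [if_pos h2] at this
        split_ifs <;> linarith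
    · rw [if_neg h]
      split_ifs <;> linarith
  refine (Finset.sum_le_sum h1).trans ?_
  rw [Finset.sum_add_distrib, Finset.sum_comm]
  have h2 := sum_filter_dvd_one_le N (pow_pos hp.pos 2)
  have h3 : ∑ j ∈ Finset.Icc 1 N, ∑ n ∈ Finset.Icc 1 N, (if p * j + 1 ∣ n then (1 : ℝ) else 0) ≤
      N * (p : ℝ)⁻¹ * (1 + Real.log N) := by
    calc _ ≤ ∑ j ∈ Finset.Icc 1 N, N * (p : ℝ)⁻¹ * (j : ℝ)⁻¹ := by
          refine Finset.sum_le_sum fun j hj => ?_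
          refine (sum_filter_dvd_one_le N (Nat.succ_pos _)).trans ?_
          have hj0 : (0 : ℝ) < j := by exact_mod_cast (Finset.mem_Icc.1 hj).1
          rw [mul_assoc, ← mul_inv]
          push_cast
          gcongr
          linarith
      _ = N * (p : ℝ)⁻¹ * ∑ j ∈ Finset.Icc 1 N, (j : ℝ)⁻¹ := by rw [Finset.mul_sum]
      _ ≤ _ := by
          have := sum_Icc_inv_le N
          gcongr
  have h4 : ((p ^ 2 : ℕ) : ℝ)⁻¹ ≤ (p : ℝ)⁻¹ := by
    push_cast
    exact inv_anti₀ hp0 (by nlinarith)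
  have h5 := mul_le_mul_of_nonneg_left h4 (Nat.cast_nonneg N)
  calc _ ≤ N * (p : ℝ)⁻¹ + N * (p : ℝ)⁻¹ * (1 + Real.log N) := add_le_add (h2.trans h5) h3
    _ = _ := by ring

theorem sum_norm_localProduct_sub_le {c : ℂ} (hc : ‖1 + c‖ ≤ 1) {y : ℕ} (hy : 1 ≤ y) (z N : ℕ) :
    ∑ n ∈ Finset.Icc 1 N, ‖localProduct c y z n.totient - localProduct c y z 1‖ ≤
      N * (2 * ‖c‖ * (2 + Real.log N) / y) := by
  have hlog : 0 ≤ Real.log N := Real.log_natCast_nonneg N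
  have h1 : ∀ n : ℕ, ‖localProduct c y z n.totient - localProduct c y z 1‖ ≤
      ∑ p ∈ primesIoc y z, ‖c‖ * (2 * (p : ℝ)⁻¹) * (if p ∣ n.totient then (1 : ℝ) else 0) := by
    intro n
    have hb := fun (s p : ℕ) (hp : p ∈ primesIoc y z) =>
      ite_coprime_inv_totient_mem (mem_primesIoc.1 hp).2 s
    refine (norm_prod_sub_prod_le (fun p hp => norm_one_add_mul_le_one hc (hb _ p hp).1 (hb _ p hp).2)
      (fun p hp => norm_one_add_mul_le_one hc (hb _ p hp).1 (hb _ p hp).2)).trans ?_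
    refine Finset.sum_le_sum fun p hp => ?_
    have hpp := (mem_primesIoc.1 hp).2
    by_cases h : p ∣ n.totient
    · rw [if_neg (by rwa [Nat.Prime.coprime_iff_not_dvd hpp, not_not]), if_pos h,
        if_pos (Nat.coprime_one_right p)]
      have e : 1 + c * ((0 : ℝ) : ℂ) - (1 + c * (((p.totient : ℝ)⁻¹ : ℝ) : ℂ)) =
          -(c * (((p.totient : ℝ)⁻¹ : ℝ) : ℂ)) := by
        push_cast
        ring
      rw [e, norm_neg, norm_mul, Complex.norm_real, Real.norm_of_nonneg (by positivity), mul_one]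
      exact mul_le_mul_of_nonneg_left (inv_totient_le hpp) (norm_nonneg _)
    · rw [if_pos ((Nat.Prime.coprime_iff_not_dvd hpp).2 h), if_neg h,
        if_pos (Nat.coprime_one_right p), sub_self, norm_zero, mul_zero]
  refine (Finset.sum_le_sum fun n _ => h1 n).trans ?_
  rw [Finset.sum_comm]
  calc _ ≤ ∑ p ∈ primesIoc y z, ‖c‖ * 2 * (N * (2 + Real.log N)) * ((p : ℝ) ^ 2)⁻¹ := by
        refine Finset.sum_le_sum fun p hp => ?_
        rw [← Finset.mul_sum]
        have := sum_dvd_totient_le (mem_primesIoc.1 hp).2 N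
        calc _ ≤ ‖c‖ * (2 * (p : ℝ)⁻¹) * (N * (2 + Real.log N) * (p : ℝ)⁻¹) := by gcongr
          _ = _ := by
            rw [sq, mul_inv]
            ring
    _ = ‖c‖ * 2 * (N * (2 + Real.log N)) * ∑ p ∈ primesIoc y z, ((p : ℝ) ^ 2)⁻¹ := by
        rw [Finset.mul_sum]
    _ ≤ ‖c‖ * 2 * (N * (2 + Real.log N)) * (y : ℝ)⁻¹ := by
        have := sum_primesIoc_inv_sq_le hy z
        gcongr
    _ = _ := by ring

theorem card_primeFactors_filter_mul_log_le {n : ℕ} (hn : n ≠ 0) {z : ℕ} (hz : 2 ≤ z) :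
    ((n.primeFactors.filter (z < ·)).card : ℝ) ≤ Real.log n / Real.log z := by
  have hlz : 0 < Real.log z := Real.log_pos (by exact_mod_cast hz)
  rw [le_div_iff₀ hlz]
  calc ((n.primeFactors.filter (z < ·)).card : ℝ) * Real.log z
      = ∑ p ∈ n.primeFactors.filter (z < ·), Real.log z := by
        rw [Finset.sum_const, nsmul_eq_mul]
    _ ≤ ∑ p ∈ n.primeFactors.filter (z < ·), Real.log p := by
        refine Finset.sum_le_sum fun p hp => Real.log_le_log (by positivity) ?_
        exact_mod_cast (Finset.mem_filter.1 hp).2.le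
    _ ≤ ∑ p ∈ n.primeFactors, Real.log p :=
        Finset.sum_le_sum_of_subset_of_nonneg (Finset.filter_subset _ _)
          fun p _ _ => Real.log_natCast_nonneg p
    _ ≤ Real.log n := sum_log_primeFactors_le hn

theorem windowCount_le_card_primeFactors {a : ℤ} {s : ℕ} (h : (s : ℤ) + a ≠ 0) (y z : ℕ) :
    windowCount a y z s ≤ ((s : ℤ) + a).natAbs.primeFactors.card := by
  refine Finset.card_le_card fun p hp => ?_
  rw [Finset.mem_filter, mem_primesIoc] at hp
  exact Nat.mem_primeFactors.2 ⟨hp.1.2, Int.natCast_dvd.1 hp.2, Int.natAbs_ne_zero.2 h⟩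

theorem card_primeFactors_le_windowCount_add {a : ℤ} (ha : a ≠ 0) {s N : ℕ} (hsN : s ≤ N)
    (h : (s : ℤ) + a ≠ 0) {y z z' : ℕ} (hz' : 2 ≤ z') :
    (((s : ℤ) + a).natAbs.primeFactors.card : ℝ) ≤ windowCount a y z s + smallCount a y s +
      windowCount a z z' s + (a.natAbs + Real.log (N + a.natAbs : ℕ) / Real.log z') := by
  set n := ((s : ℤ) + a).natAbs with hn
  have hn0 : n ≠ 0 := Int.natAbs_ne_zero.2 h
  have h1 : n.primeFactors ⊆ a.natAbs.primeFactors ∪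
      (((Nat.primesLE y).filter fun p : ℕ => ¬ (p : ℤ) ∣ a).filter fun p : ℕ => (p : ℤ) ∣ s + a) ∪
      ((primesIoc y z).filter fun p : ℕ => (p : ℤ) ∣ s + a) ∪
      ((primesIoc z z').filter fun p : ℕ => (p : ℤ) ∣ s + a) ∪ n.primeFactors.filter (z' < ·) := by
    intro p hp
    obtain ⟨hpp, hpn, _⟩ := Nat.mem_primeFactors.1 hp
    have hd : (p : ℤ) ∣ s + a := Int.natCast_dvd.2 hpn
    simp only [Finset.mem_union, Finset.mem_filter, mem_primesIoc, Nat.mem_primesLE,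
      Nat.mem_primeFactors]
    by_cases hpa : (p : ℤ) ∣ a
    · have : p ∣ a.natAbs := Int.natCast_dvd.1 hpa
      simp [hpp, this, ha]
    · have h0 := hn0
      simp only [hpp, hpa, hd, hpn, not_false_iff, and_true, true_and]
      have : p ≤ y ∨ (y < p ∧ p ≤ z) ∨ (z < p ∧ p ≤ z') ∨ z' < p := by omega
      tauto
  have h2 := (Finset.card_le_card h1).trans ((Finset.card_union_le _ _).trans
    (Nat.add_le_add_right ((Finset.card_union_le _ _).trans (Nat.add_le_add_right
      ((Finset.card_union_le _ _).trans (Nat.add_le_add_right (Finset.card_union_le _ _) _)) _)) _))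
  have h3 : (n.primeFactors.card : ℝ) ≤ a.natAbs.primeFactors.card + smallCount a y s +
      windowCount a y z s + windowCount a z z' s + (n.primeFactors.filter (z' < ·)).card := by
    rw [smallCount, Finset.sum_boole]
    exact_mod_cast h2
  have h4 : (a.natAbs.primeFactors.card : ℝ) ≤ a.natAbs := by
    have : a.natAbs.primeFactors ⊆ Finset.Icc 1 a.natAbs := fun p hp =>
      Finset.mem_Icc.2 ⟨(Nat.prime_of_mem_primeFactors hp).pos,
        Nat.le_of_dvd (Int.natAbs_pos.2 ha) (Nat.dvd_of_mem_primeFactors hp)⟩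
    have := Finset.card_le_card this
    rw [Nat.card_Icc, Nat.add_sub_cancel] at this
    exact_mod_cast this
  have h5 := card_primeFactors_filter_mul_log_le hn0 hz'
  have h6 : Real.log n / Real.log z' ≤ Real.log (N + a.natAbs : ℕ) / Real.log z' := by
    refine div_le_div_of_nonneg_right (Real.log_le_log ?_ ?_) (Real.log_natCast_nonneg _)
    · exact_mod_cast Nat.pos_of_ne_zero hn0
    · exact_mod_cast (by omega : n ≤ N + a.natAbs)
  linarith

theorem sum_pairWeight_mul_windowCount_le {a : ℤ} (ha : a ≠ 0) {y z w : ℕ}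
    (hay : a.natAbs ≤ y) (hy : 2 ≤ y) (hz : 1 ≤ z) (hw : 1 ≤ w) (N : ℕ) :
    ∑ n ∈ Finset.Icc 1 N, pairWeight w N n * windowCount a y z n.totient ≤
      N * (bilinearError z y w N +
        primeMass w N ^ 2 * ∑ p ∈ primesIoc y z, ((p.totient : ℝ))⁻¹) := by
  have h := (le_abs_self _).trans
    (abs_sum_pairWeight_mul_elemSymm_sub_le ha (k := 1) (K := 1) hay (by omega) le_rfl
      (by omega : 1 ≤ y) hz hw N)
  rw [pow_one] at h
  set T := ∑ p ∈ primesIoc y z, ((p.totient : ℝ))⁻¹ with hT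
  have hT0 : 0 ≤ T := Finset.sum_nonneg fun _ _ => by positivity
  have h1 : ∀ f : ℕ → ℝ, elemSymm (primesIoc y z) f 1 = ∑ p ∈ primesIoc y z, f p := fun f => by
    rw [elemSymm, Finset.powersetCard_one, Finset.sum_map]
    simp
  simp only [h1] at h
  have h2 : ∀ n : ℕ, ∑ p ∈ primesIoc y z, (if p.Coprime n.totient then ((p.totient : ℝ))⁻¹ else 0)
      ≤ T := fun n => Finset.sum_le_sum fun p _ => by
    have : 0 ≤ ((p.totient : ℝ))⁻¹ := by positivity
    split_ifs <;> linarith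
  calc ∑ n ∈ Finset.Icc 1 N, pairWeight w N n * windowCount a y z n.totient
      ≤ ∑ n ∈ Finset.Icc 1 N, (pairWeight w N n *
        (∑ p ∈ primesIoc y z, (if (p : ℤ) ∣ n.totient + a then (1 : ℝ) else 0) -
          ∑ p ∈ primesIoc y z, (if p.Coprime n.totient then ((p.totient : ℝ))⁻¹ else 0)) +
        pairWeight w N n * T) := by
        refine Finset.sum_le_sum fun n _ => ?_
        rw [← mul_add, windowCount, ← Finset.sum_boole]
        refine mul_le_mul_of_nonneg_left ?_ (pairWeight_nonneg _ _ _)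
        linarith [h2 n]
    _ ≤ N * bilinearError z y w N + N * primeMass w N ^ 2 * T := by
        rw [Finset.sum_add_distrib, ← Finset.sum_mul]
        exact add_le_add h (mul_le_mul_of_nonneg_right (sum_pairWeight_le w N) hT0)
    _ = _ := by ring

theorem norm_pow_sub_pow_le {u : ℂ} (hu : ‖u‖ = 1) {k m : ℕ} (h : k ≤ m) :
    ‖u ^ m - u ^ k‖ ≤ ‖u - 1‖ * ((m : ℝ) - k) := by
  obtain ⟨j, rfl⟩ := Nat.exists_eq_add_of_le h
  have h1 := norm_prod_sub_prod_le (s := Finset.range j) (u := fun _ => u) (v := fun _ => 1)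
    (fun _ _ => hu.le) (fun _ _ => by simp)
  simp only [Finset.prod_const, Finset.card_range, Finset.sum_const, nsmul_eq_mul, one_pow] at h1
  have e : u ^ (k + j) - u ^ k = u ^ k * (u ^ j - 1) := by ring
  rw [e, norm_mul, norm_pow, hu, one_pow, one_mul]
  refine h1.trans (le_of_eq ?_)
  push_cast
  ring

theorem primeWeight_eq_zero_of_totient_add_eq_zero {a : ℤ} {w N n : ℕ} (haw : a.natAbs < w)
    (hn : 0 < n) (h : (n.totient : ℤ) + a = 0) : primeWeight w N n = 0 := by
  refine Finset.sum_eq_zero fun P hP => if_neg fun hd => ?_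
  rw [mem_primesIoc] at hP
  have h1 := Nat.le_of_dvd (Nat.totient_pos.2 hn) (Nat.totient_dvd_of_dvd hd)
  rw [Nat.totient_prime hP.2] at h1
  omega

/-- The total error committed in replacing the average of `(1 + c) ^ ω(|φ(n) + a|)` by the
Euler product attached to the primes in `(y, z]`. -/
noncomputable def averageError (a : ℤ) (r : ℝ) (y z z' w K R N : ℕ) : ℝ :=
  16 / primeMass w N + 10 * √(3 * primeMass w N) / primeMass w N +
  r * ((a.natAbs + Real.log (N + a.natAbs : ℕ) / Real.log z') +
    (4 * (1 + Real.log N) * (∑ p ∈ Nat.primesLE y, (p : ℝ)⁻¹) / Real.log R +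
        y * (R : ℝ) ^ 6 / w + y * (1 + Real.log N) / w) +
    bilinearError z' z w N + ∑ p ∈ primesIoc z z', ((p.totient : ℝ))⁻¹) +
  (2 ^ (K + 1) * bilinearError (z ^ K) y w N +
    2 * r ^ K * Real.exp (∑ p ∈ primesIoc y z, ((p.totient : ℝ))⁻¹)) +
  2 * r * (2 + Real.log N) / y

theorem norm_pow_card_primeFactors_sub_le {a : ℤ} (ha : a ≠ 0) {y z z' w N : ℕ}
    (hz' : 2 ≤ z') (haw : a.natAbs < w) (hM : 1 ≤ primeMass w N)
    {c : ℂ} (hc : ‖1 + c‖ = 1) {n : ℕ} (hn : n ∈ Finset.Icc 1 N) :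
    ‖(1 + c) ^ ((n.totient : ℤ) + a).natAbs.primeFactors.card -
      (1 + c) ^ windowCount a y z n.totient‖ ≤
    ‖c‖ * (a.natAbs + Real.log (N + a.natAbs : ℕ) / Real.log z') +
    (2 * (|primeWeight w N n - primeMass w N| / primeMass w N) +
      ‖c‖ * (primeWeight w N n * smallCount a y n.totient)) +
    (2 * (|pairWeight w N n - primeMass w N ^ 2| / primeMass w N ^ 2) +
      ‖c‖ * (pairWeight w N n * windowCount a z z' n.totient / primeMass w N ^ 2)) := by
  have hc0 := norm_nonneg c
  have hlz : 0 ≤ Real.log z' := Real.log_natCast_nonneg _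
  have hlN : 0 ≤ Real.log (N + a.natAbs : ℕ) := Real.log_natCast_nonneg _
  set A₀ := (a.natAbs + Real.log (N + a.natAbs : ℕ) / Real.log z' : ℝ) with hA₀
  have hA₀0 : 0 ≤ A₀ := by positivity
  set W := primeWeight w N n
  set V := pairWeight w N n
  set M := primeMass w N
  set E := smallCount a y n.totient with hE
  set E' := windowCount a z z' n.totient
  have hW : 0 ≤ W := primeWeight_nonneg _ _ _
  have hV : 0 ≤ V := pairWeight_nonneg _ _ _
  have hE0 : 0 ≤ E := smallCount_nonneg _ _ _
  have hM0 : 0 < M := by linarith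
  have hn1 := Finset.mem_Icc.1 hn
  have key : ∀ {ρ m X : ℝ}, 0 ≤ ρ → 0 < m → 0 ≤ X →
      min 2 X ≤ 2 * (|ρ - m| / m) + ρ * X / m := by
    intro ρ m X hρ hm hX
    have e : 2 * (|ρ - m| / m) + ρ * X / m = (2 * |ρ - m| + ρ * X) / m := by ring
    rw [e, le_div_iff₀ hm]
    have i1 : min 2 X ≤ 2 := min_le_left _ _
    have i2 : min 2 X ≤ X := min_le_right _ _
    have i3 : 0 ≤ min 2 X := le_min (by norm_num) hX
    rcases le_total ρ m with h | h
    · rw [abs_of_nonpos (by linarith)]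
      nlinarith
    · rw [abs_of_nonneg (by linarith)]
      nlinarith
  have htriv : ‖(1 + c) ^ ((n.totient : ℤ) + a).natAbs.primeFactors.card -
      (1 + c) ^ windowCount a y z n.totient‖ ≤ 2 := by
    refine (norm_sub_le _ _).trans ?_
    rw [norm_pow, norm_pow, hc, one_pow, one_pow]
    norm_num
  by_cases h0 : (n.totient : ℤ) + a = 0
  · have hW0 : W = 0 := primeWeight_eq_zero_of_totient_add_eq_zero haw (by omega) h0
    refine htriv.trans ?_
    rw [hW0, zero_sub, abs_neg, abs_of_pos hM0, div_self hM0.ne']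
    have : 0 ≤ ‖c‖ * A₀ + (2 * (|V - M ^ 2| / M ^ 2) + ‖c‖ * (V * E' / M ^ 2)) := by positivity
    linarith
  · have h1 := card_primeFactors_le_windowCount_add ha ((Nat.totient_le n).trans hn1.2) h0
      (y := y) (z := z) hz'
    have h2 := norm_pow_sub_pow_le hc (windowCount_le_card_primeFactors h0 y z)
    rw [add_sub_cancel_left] at h2
    have h3 := h2.trans (mul_le_mul_of_nonneg_left
      (by linarith : _ ≤ A₀ + E + (E' : ℝ)) hc0)
    have h4 : ‖(1 + c) ^ ((n.totient : ℤ) + a).natAbs.primeFactors.card -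
        (1 + c) ^ windowCount a y z n.totient‖ ≤
        ‖c‖ * A₀ + min 2 (‖c‖ * E) + min 2 (‖c‖ * E') := by
      have j0 : 0 ≤ ‖c‖ * A₀ := by positivity
      have j1 : 0 ≤ min 2 (‖c‖ * E) := le_min (by norm_num) (by positivity)
      have j2 : 0 ≤ min 2 (‖c‖ * (E' : ℝ)) := le_min (by norm_num) (by positivity)
      rcases le_total 2 (‖c‖ * E) with i | i
      · rw [min_eq_left i]
        linarith
      · rcases le_total 2 (‖c‖ * (E' : ℝ)) with i' | i'
        · rw [min_eq_left i']
          linarith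
        · rw [min_eq_right i, min_eq_right i']
          linarith
    have h5 := key hW hM0 (by positivity : 0 ≤ ‖c‖ * E)
    have h6 := key hV (by positivity : 0 < M ^ 2) (by positivity : 0 ≤ ‖c‖ * (E' : ℝ))
    have h7 : W * (‖c‖ * E) / M ≤ ‖c‖ * (W * E) := by
      rw [div_le_iff₀ hM0]
      nlinarith [(by positivity : 0 ≤ ‖c‖ * (W * E))]
    have h8 : V * (‖c‖ * (E' : ℝ)) / M ^ 2 = ‖c‖ * (V * E' / M ^ 2) := by ring
    linarith

theorem norm_sum_pow_card_primeFactors_sub_le {a : ℤ} (ha : a ≠ 0) {y z z' w K R N : ℕ}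
    (hay : a.natAbs ≤ y) (hy : 2 ≤ y) (hyz : y ≤ z) (hK : 2 * K ≤ y) (hz' : 2 ≤ z')
    (haw : a.natAbs < w) (hR : 2 ≤ R) (hRw : R ≤ w) (hM : 1 ≤ primeMass w N)
    {c : ℂ} (hc : ‖1 + c‖ = 1) :
    ‖∑ n ∈ Finset.Icc 1 N, ((1 + c) ^ ((n.totient : ℤ) + a).natAbs.primeFactors.card -
      localProduct c y z 1)‖ ≤ N * averageError a ‖c‖ y z z' w K R N := by
  have hw : 1 ≤ w := by omega
  have b1 := sum_abs_primeWeight_sub_le w N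
  have b2 := sum_abs_pairWeight_sub_le w N
  have b3 := sum_primeWeight_mul_smallCount_le a N y hR hRw
  have b4 := sum_pairWeight_mul_windowCount_le ha (hay.trans hyz) (hy.trans hyz)
    (by omega : 1 ≤ z') hw N
  have b5 := norm_sum_pairWeight_mul_sub_localProduct_le ha hay hK (by omega : 1 ≤ y)
    (by omega : 1 ≤ z) hw N hc.le
  have b6 := sum_norm_localProduct_sub_le hc.le (by omega : 1 ≤ y) z N
  have b7 : ∀ n ∈ Finset.Icc 1 N, _ := fun n hn =>
    norm_pow_card_primeFactors_sub_le ha (y := y) (z := z) hz' haw hM hc hn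
  have hB := bilinearError_nonneg z' z w N
  have hB' := bilinearError_nonneg (z ^ K) y w N
  set M := primeMass w N with hMdef
  have hM0 : 0 < M := by linarith
  have hM2 : 0 < M ^ 2 := by positivity
  have hM2' : 1 ≤ M ^ 2 := by nlinarith
  have hc0 := norm_nonneg c
  set f : ℕ → ℂ := fun n => (1 + c) ^ ((n.totient : ℤ) + a).natAbs.primeFactors.card with hf
  set g : ℕ → ℂ := fun n => (1 + c) ^ windowCount a y z n.totient with hg
  set l : ℕ → ℂ := fun n => localProduct c y z n.totient with hl
  have e : ∑ n ∈ Finset.Icc 1 N, (f n - localProduct c y z 1) =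
      ∑ n ∈ Finset.Icc 1 N, (f n - g n) +
      (∑ n ∈ Finset.Icc 1 N, (((M ^ 2 - pairWeight w N n) / M ^ 2 : ℝ) : ℂ) * (g n - l n) +
        ((M ^ 2 : ℝ) : ℂ)⁻¹ * ∑ n ∈ Finset.Icc 1 N, (pairWeight w N n : ℂ) * (g n - l n)) +
      ∑ n ∈ Finset.Icc 1 N, (l n - localProduct c y z 1) := by
    rw [Finset.mul_sum, ← Finset.sum_add_distrib, ← Finset.sum_add_distrib,
      ← Finset.sum_add_distrib]
    refine Finset.sum_congr rfl fun n _ => ?_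
    have hMc : (M : ℂ) ≠ 0 := by exact_mod_cast hM0.ne'
    push_cast
    field_simp
    ring
  have c1 : ‖∑ n ∈ Finset.Icc 1 N, (f n - g n)‖ ≤
      N * (‖c‖ * (a.natAbs + Real.log (N + a.natAbs : ℕ) / Real.log z')) +
      (2 * ((N * √(3 * M)) / M) + ‖c‖ * (N * (4 * (1 + Real.log N) *
        (∑ p ∈ Nat.primesLE y, (p : ℝ)⁻¹) / Real.log R +
        y * (R : ℝ) ^ 6 / w + y * (1 + Real.log N) / w))) +
      (2 * ((N * (4 * M + 2 * M * √(3 * M))) / M ^ 2) +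
        ‖c‖ * ((N * (bilinearError z' z w N + M ^ 2 * ∑ p ∈ primesIoc z z', ((p.totient : ℝ))⁻¹))
          / M ^ 2)) := by
    refine (norm_sum_le _ _).trans ((Finset.sum_le_sum b7).trans ?_)
    rw [Finset.sum_add_distrib, Finset.sum_add_distrib, Finset.sum_add_distrib,
      Finset.sum_add_distrib, Finset.sum_const, Nat.card_Icc, Nat.add_sub_cancel, nsmul_eq_mul,
      ← Finset.mul_sum, ← Finset.mul_sum, ← Finset.mul_sum, ← Finset.mul_sum, ← Finset.sum_div,
      ← Finset.sum_div, ← Finset.sum_div]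
    gcongr
  have c2 : ‖∑ n ∈ Finset.Icc 1 N, (((M ^ 2 - pairWeight w N n) / M ^ 2 : ℝ) : ℂ) * (g n - l n)‖ ≤
      (N * (4 * M + 2 * M * √(3 * M))) / M ^ 2 * 2 := by
    refine (norm_sum_le _ _).trans ?_
    calc _ ≤ ∑ n ∈ Finset.Icc 1 N, |pairWeight w N n - M ^ 2| / M ^ 2 * 2 := by
          refine Finset.sum_le_sum fun n _ => ?_
          rw [norm_mul, Complex.norm_real, Real.norm_eq_abs, abs_div, abs_of_pos hM2, abs_sub_comm]
          refine mul_le_mul_of_nonneg_left ?_ (by positivity)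
          refine (norm_sub_le _ _).trans ?_
          have i1 : ‖g n‖ = 1 := by rw [hg]; simp only [norm_pow, hc, one_pow]
          have i2 : ‖l n‖ ≤ 1 := norm_localProduct_le hc.le _ _ _
          linarith
      _ ≤ _ := by
          rw [← Finset.sum_mul, ← Finset.sum_div]
          gcongr
  have c3 : ‖((M ^ 2 : ℝ) : ℂ)⁻¹ * ∑ n ∈ Finset.Icc 1 N, (pairWeight w N n : ℂ) * (g n - l n)‖ ≤
      (M ^ 2)⁻¹ * (N * (2 ^ (K + 1) * bilinearError (z ^ K) y w N +
      2 * ‖c‖ ^ K * Real.exp (∑ p ∈ primesIoc y z, ((p.totient : ℝ))⁻¹) * M ^ 2)) := by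
    rw [norm_mul, norm_inv, Complex.norm_real, Real.norm_of_nonneg hM2.le]
    exact mul_le_mul_of_nonneg_left b5 (by positivity)
  have c4 : ‖∑ n ∈ Finset.Icc 1 N, (l n - localProduct c y z 1)‖ ≤
      N * (2 * ‖c‖ * (2 + Real.log N) / y) := (norm_sum_le _ _).trans b6
  rw [e]
  refine (norm_add_le _ _).trans (add_le_add ((norm_add_le _ _).trans (add_le_add c1
    ((norm_add_le _ _).trans (add_le_add c2 c3)))) c4) |>.trans ?_
  rw [averageError, ← hMdef]
  have d1 : bilinearError z' z w N / M ^ 2 ≤ bilinearError z' z w N := div_le_self hB hM2'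
  have d2 : 2 ^ (K + 1) * bilinearError (z ^ K) y w N / M ^ 2 ≤
      2 ^ (K + 1) * bilinearError (z ^ K) y w N := div_le_self (by positivity) hM2'
  have hN : (0 : ℝ) ≤ N := Nat.cast_nonneg N
  have d1' := mul_le_mul_of_nonneg_left d1 (by positivity : 0 ≤ (N : ℝ) * ‖c‖)
  have d2' := mul_le_mul_of_nonneg_left d2 hN
  set S := √(3 * M)
  set T := ∑ p ∈ primesIoc z z', ((p.totient : ℝ))⁻¹
  set B := bilinearError z' z w N
  set B' := bilinearError (z ^ K) y w N
  set X := Real.exp (∑ p ∈ primesIoc y z, ((p.totient : ℝ))⁻¹)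
  have f1 : N * (4 * M + 2 * M * S) / M ^ 2 = N * (4 / M + 2 * S / M) := by
    field_simp
  have f2 : N * (B + M ^ 2 * T) / M ^ 2 = N * (B / M ^ 2 + T) := by
    field_simp
  have f3 : (M ^ 2)⁻¹ * (N * (2 ^ (K + 1) * B' + 2 * ‖c‖ ^ K * X * M ^ 2)) =
      N * (2 ^ (K + 1) * B' / M ^ 2 + 2 * ‖c‖ ^ K * X) := by
    field_simp
  rw [f1, f2, f3]
  have f4 : N * S / M = N * (S / M) := by ring
  have f5 : 16 / M = 16 * M⁻¹ := by ring
  have f6 : 4 / M = 4 * M⁻¹ := by ring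
  have f7 : 10 * S / M = 10 * (S / M) := by ring
  have f8 : 2 * S / M = 2 * (S / M) := by ring
  rw [f4, f5, f6, f7, f8]
  linarith

/-- The integer part of `exp v`. -/
noncomputable def expFloor (v : ℝ) : ℕ := ⌊Real.exp v⌋₊

theorem expFloor_le (v : ℝ) : (expFloor v : ℝ) ≤ Real.exp v := Nat.floor_le (Real.exp_nonneg v)

theorem expFloor_mono {u v : ℝ} (h : u ≤ v) : expFloor u ≤ expFloor v :=
  Nat.floor_mono (Real.exp_le_exp.2 h)

theorem two_le_expFloor {v : ℝ} (h : 1 ≤ v) : 2 ≤ expFloor v := by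
  refine Nat.le_floor ?_
  push_cast
  linarith [Real.add_one_le_exp v]

theorem half_exp_le_expFloor {v : ℝ} (h : 1 ≤ v) : Real.exp v / 2 ≤ expFloor v := by
  have h1 : Real.exp v < expFloor v + 1 := Nat.lt_floor_add_one _
  linarith [Real.add_one_le_exp v]

theorem log_expFloor_le {v : ℝ} (h : 1 ≤ v) : Real.log (expFloor v) ≤ v := by
  have h1 := two_le_expFloor h
  have h2 : (0 : ℝ) < expFloor v := by exact_mod_cast (by omega : 0 < expFloor v)
  rw [Real.log_le_iff_le_exp h2]
  exact expFloor_le v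

theorem half_le_log_expFloor {v : ℝ} (h : 2 ≤ v) : v / 2 ≤ Real.log (expFloor v) := by
  have h1 := half_exp_le_expFloor (by linarith : 1 ≤ v)
  have h2 : Real.log (Real.exp v / 2) ≤ Real.log (expFloor v) := Real.log_le_log (by positivity) h1
  rw [Real.log_div (Real.exp_ne_zero v) two_ne_zero, Real.log_exp] at h2
  linarith [Real.log_two_lt_d9]

theorem log_log_expFloor_le {v : ℝ} (h : 2 ≤ v) : Real.log (Real.log (expFloor v)) ≤ Real.log v :=
  Real.log_le_log (by linarith [half_le_log_expFloor h]) (log_expFloor_le (by linarith))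

theorem sub_one_le_log_log_expFloor {v : ℝ} (h : 2 ≤ v) :
    Real.log v - 1 ≤ Real.log (Real.log (expFloor v)) := by
  have h2 := Real.log_le_log (by linarith) (half_le_log_expFloor h)
  rw [Real.log_div (by linarith) two_ne_zero] at h2
  linarith [Real.log_two_lt_d9]

theorem sum_primesIoc_eq_sub {u v : ℕ} (h : u ≤ v) (f : ℕ → ℝ) :
    ∑ p ∈ primesIoc u v, f p = ∑ p ∈ Nat.primesLE v, f p - ∑ p ∈ Nat.primesLE u, f p := by
  have hs : Nat.primesLE u ⊆ Nat.primesLE v := fun p hp => by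
    rw [Nat.mem_primesLE] at hp ⊢
    exact ⟨hp.1.trans h, hp.2⟩
  rw [eq_sub_iff_add_eq, ← Finset.sum_sdiff hs]
  congr 1
  refine Finset.sum_congr ?_ fun _ _ => rfl
  ext p
  rw [mem_primesIoc, Finset.mem_sdiff, Nat.mem_primesLE, Nat.mem_primesLE]
  constructor
  · rintro ⟨⟨h1, h2⟩, h3⟩
    exact ⟨⟨h2, h3⟩, fun h4 => by omega⟩
  · rintro ⟨⟨h1, h2⟩, h3⟩
    exact ⟨⟨by by_contra h4; exact h3 ⟨by omega, h2⟩, h1⟩, h2⟩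

theorem exists_mertens_expFloor : ∃ C : ℝ, 0 ≤ C ∧
    (∀ v : ℝ, 2 ≤ v → ∑ p ∈ Nat.primesLE (expFloor v), (p : ℝ)⁻¹ ≤ Real.log v + C) ∧
    ∀ u v : ℝ, 2 ≤ u → u ≤ v →
      |∑ p ∈ primesIoc (expFloor u) (expFloor v), (p : ℝ)⁻¹ - (Real.log v - Real.log u)| ≤ C := by
  obtain ⟨C, hC⟩ := exists_sum_inv_prime_le
  have hup : ∀ v : ℝ, 2 ≤ v → ∑ p ∈ Nat.primesLE (expFloor v), (p : ℝ)⁻¹ ≤ Real.log v + |C| := by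
    intro v hv
    have h1 := hC (expFloor v) (two_le_expFloor (by linarith))
    linarith [log_log_expFloor_le hv, le_abs_self C]
  have hlow : ∀ v : ℝ, 2 ≤ v → Real.log v - 3 ≤ ∑ p ∈ Nat.primesLE (expFloor v), (p : ℝ)⁻¹ := by
    intro v hv
    have h1 := log_log_le_sum_inv_prime (two_le_expFloor (by linarith : 1 ≤ v))
    linarith [sub_one_le_log_log_expFloor hv]
  refine ⟨|C| + 3, by positivity, fun v hv => by linarith [hup v hv], fun u v hu huv => ?_⟩
  rw [sum_primesIoc_eq_sub (expFloor_mono huv), abs_le]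
  have h1 := hup u hu
  have h2 := hup v (hu.trans huv)
  have h3 := hlow u hu
  have h4 := hlow v (hu.trans huv)
  constructor <;> linarith

theorem abs_sum_inv_totient_sub_le {y : ℕ} (hy : 1 ≤ y) (z : ℕ) :
    |∑ p ∈ primesIoc y z, ((p.totient : ℝ))⁻¹ - ∑ p ∈ primesIoc y z, (p : ℝ)⁻¹| ≤ 2 := by
  rw [← Finset.sum_sub_distrib]
  refine (Finset.abs_sum_le_sum_abs _ _).trans ?_
  have h1 : ∀ p ∈ primesIoc y z, |((p.totient : ℝ))⁻¹ - (p : ℝ)⁻¹| ≤ 2 * ((p : ℝ) ^ 2)⁻¹ := by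
    intro p hp
    have hpp := (mem_primesIoc.1 hp).2
    have h2 : (2 : ℝ) ≤ p := by exact_mod_cast hpp.two_le
    have h3 : ((p.totient : ℕ) : ℝ) = p - 1 := by
      rw [Nat.totient_prime hpp, Nat.cast_sub hpp.one_le, Nat.cast_one]
    have h4 : (0 : ℝ) < p - 1 := by linarith
    have e : ((p : ℝ) - 1)⁻¹ - (p : ℝ)⁻¹ = (((p : ℝ) - 1) * p)⁻¹ := by
      field_simp
      ring
    rw [h3, e, abs_of_nonneg (by positivity), inv_eq_one_div, ← div_eq_mul_inv,
      div_le_div_iff₀ (by positivity) (by positivity)]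
    nlinarith
  refine (Finset.sum_le_sum h1).trans ?_
  rw [← Finset.mul_sum]
  have h5 := sum_primesIoc_inv_sq_le hy z
  have h6 : ((y : ℝ))⁻¹ ≤ 1 := inv_le_one_of_one_le₀ (by exact_mod_cast hy)
  linarith

theorem exists_sum_inv_totient_expFloor : ∃ C : ℝ, 0 ≤ C ∧ ∀ u v : ℝ, 2 ≤ u → u ≤ v →
    |∑ p ∈ primesIoc (expFloor u) (expFloor v), ((p.totient : ℝ))⁻¹ - (Real.log v - Real.log u)|
      ≤ C := by
  obtain ⟨C, hC0, -, hC⟩ := exists_mertens_expFloor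
  refine ⟨2 + C, by linarith, fun u v hu huv => ?_⟩
  have h1 := hC u v hu huv
  have h2 := abs_sum_inv_totient_sub_le
    (by linarith [two_le_expFloor (by linarith : 1 ≤ u)] : 1 ≤ expFloor u) (expFloor v)
  exact (abs_sub_le _ _ _).trans (add_le_add h2 h1)

theorem bilinearError_le {D y w N : ℕ} {v s q : ℝ} (hs : 2 ≤ s) (hq0 : 0 ≤ q)
    (hD1 : 1 ≤ D) (hN : Real.log N ≤ s) (hD : (D : ℝ) ≤ Real.exp q) (hqs : q ≤ s)
    (hy : Real.exp v / 2 ≤ y) (hw : Real.exp (4 * q) / 2 ≤ w) :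
    bilinearError D y w N ≤ 200 * s ^ 3 * (Real.exp (-v / 2) + Real.exp (-q)) := by
  have hlN : 0 ≤ Real.log N := Real.log_natCast_nonneg N
  have hlD : Real.log D ≤ q := by
    rw [Real.log_le_iff_le_exp (by exact_mod_cast hD1)]
    exact hD
  have hlD0 : 0 ≤ Real.log D := Real.log_natCast_nonneg D
  have hv0 := Real.exp_pos v
  have hq0' := Real.exp_pos (4 * q)
  have h1 : (Nat.log 2 N : ℝ) ≤ 2 * s := by
    rcases Nat.eq_zero_or_pos N with h | h
    · subst h
      simp
      linarith
    · have h2 : ((2 : ℕ) ^ Nat.log 2 N : ℝ) ≤ N := by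
        exact_mod_cast Nat.pow_log_le_self 2 h.ne'
      have h3 := Real.log_le_log (by positivity) h2
      rw [Real.log_pow] at h3
      push_cast at h3
      have h4 : (Nat.log 2 N : ℝ) * (1 / 2) ≤ Nat.log 2 N * Real.log 2 :=
        mul_le_mul_of_nonneg_left (by linarith [Real.log_two_gt_d9]) (Nat.cast_nonneg _)
      linarith
  have h2 : (1 + Real.log D) ^ 2 / y ≤ (2 * s) ^ 2 * 2 * Real.exp (-v) := by
    calc (1 + Real.log D) ^ 2 / y ≤ (2 * s) ^ 2 / (Real.exp v / 2) := by
          gcongr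
          linarith
      _ = _ := by
          rw [Real.exp_neg]
          field_simp
  have h3 : (D : ℝ) ^ 2 / w ≤ 2 * Real.exp (-2 * q) := by
    calc (D : ℝ) ^ 2 / w ≤ Real.exp q ^ 2 / (Real.exp (4 * q) / 2) := by gcongr
      _ = 2 * (Real.exp q ^ 2 * (Real.exp (4 * q))⁻¹) := by
          field_simp
      _ = _ := by
          rw [← Real.exp_nat_mul, ← Real.exp_neg, ← Real.exp_add]
          congr 2
          push_cast
          ring
  have h3' : (D : ℝ) / w ≤ 2 * Real.exp (-q) := by
    calc (D : ℝ) / w ≤ Real.exp q / (Real.exp (4 * q) / 2) := by gcongr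
      _ = 2 * (Real.exp q * (Real.exp (4 * q))⁻¹) := by
          field_simp
      _ ≤ _ := by
          rw [← Real.exp_neg, ← Real.exp_add]
          have : Real.exp (q + -(4 * q)) ≤ Real.exp (-q) := Real.exp_le_exp.2 (by linarith)
          linarith
  have h4 : bilinearSaving D y w ≤ 9 * s * (Real.exp (-v / 2) + Real.exp (-q)) := by
    rw [bilinearSaving]
    refine Real.sqrt_le_iff.2 ⟨by positivity, ?_⟩
    have e1 : Real.exp (-v) = Real.exp (-v / 2) ^ 2 := by
      rw [← Real.exp_nat_mul]
      congr 1
      push_cast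
      ring
    have e2 : Real.exp (-2 * q) = Real.exp (-q) ^ 2 := by
      rw [← Real.exp_nat_mul]
      congr 1
      push_cast
      ring
    rw [e1] at h2
    rw [e2] at h3
    have p1 := Real.exp_pos (-v / 2)
    have p2 := Real.exp_pos (-q)
    set A := Real.exp (-v / 2)
    set B := Real.exp (-q)
    rw [mul_div_assoc 13]
    have h5 : B ^ 2 ≤ s ^ 2 * B ^ 2 := le_mul_of_one_le_left (by positivity) (by nlinarith)
    have h6 : 0 ≤ s ^ 2 * A * B := by positivity
    have h7 : 0 ≤ s ^ 2 * A ^ 2 := by positivity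
    nlinarith
  have p1 := Real.exp_pos (-v / 2)
  have p2 := Real.exp_pos (-q)
  rw [bilinearError]
  have hsav : 0 ≤ bilinearSaving D y w := Real.sqrt_nonneg _
  set A := Real.exp (-v / 2)
  set B := Real.exp (-q)
  rw [mul_div_assoc 6]
  calc (1 + Real.log N) * ((Nat.log 2 N + 1) * bilinearSaving D y w + 6 * ((D : ℝ) / w))
      ≤ (2 * s) * ((3 * s) * (9 * s * (A + B)) + 6 * (2 * B)) := by
        gcongr
        · linarith
        · linarith
    _ ≤ _ := by
        have i1 : s * B ≤ s ^ 3 * B := by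
          refine mul_le_mul_of_nonneg_right ?_ p2.le
          nlinarith [sq_nonneg s, mul_nonneg (by linarith : 0 ≤ s) (by nlinarith : 0 ≤ s ^ 2 - 1)]
        have i2 : 0 ≤ s ^ 3 * A := by positivity
        have i3 : 0 ≤ s ^ 3 * B := by positivity
        nlinarith

theorem le_div_pow_of_pow_le {l s : ℝ} (hl : 4000 ≤ l) (hs : l ^ 40 ≤ s) {k : ℕ} (hk : k ≤ 16) :
    4000 * l ^ 16 ≤ s / l ^ k := by
  have h1 : (1 : ℝ) ≤ l := by linarith
  rw [le_div_iff₀ (by positivity)]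
  calc 4000 * l ^ 16 * l ^ k ≤ l * l ^ 16 * l ^ 16 := by gcongr
    _ = l ^ 33 := by ring
    _ ≤ l ^ 40 := pow_le_pow_right₀ h1 (by norm_num)
    _ ≤ s := hs

theorem pow_four_mul_exp_le {l : ℝ} (hl : 4000 ≤ l) :
    1600 * Real.exp (l ^ 8) ^ 4 * Real.exp (-l ^ 16 / 2) ≤ 1 / l := by
  have h1 : (1 : ℝ) ≤ l := by linarith
  have hb : l ≤ l ^ 8 := le_self_pow₀ h1 (by norm_num)
  have hb2 : l ^ 16 = l ^ 8 * l ^ 8 := by ring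
  have h2 : Real.exp (-l) ≤ 1 / l := by
    rw [Real.exp_neg, ← one_div]
    exact one_div_le_one_div_of_le (by linarith) (by linarith [Real.add_one_le_exp l])
  have h3 : Real.exp (-l) ≤ 1 / 1600 :=
    h2.trans (one_div_le_one_div_of_le (by norm_num) (by linarith))
  have h4 : Real.exp (l ^ 8) ^ 4 * Real.exp (-l ^ 16 / 2) ≤ Real.exp (-l) * Real.exp (-l) := by
    rw [← Real.exp_nat_mul, ← Real.exp_add, ← Real.exp_add]
    apply Real.exp_le_exp.2
    push_cast
    nlinarith
  calc 1600 * Real.exp (l ^ 8) ^ 4 * Real.exp (-l ^ 16 / 2)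
      = 1600 * (Real.exp (l ^ 8) ^ 4 * Real.exp (-l ^ 16 / 2)) := by ring
    _ ≤ 1600 * (Real.exp (-l) * Real.exp (-l)) := by gcongr
    _ ≤ 1600 * (1 / 1600 * (1 / l)) := by gcongr
    _ = 1 / l := by ring

theorem bilinearError_scale_le {l s : ℝ} (hl : 4000 ≤ l) (hs : l ^ 40 ≤ s)
    (hsl : s = Real.exp (l ^ 8)) {D y : ℕ} (hD1 : 1 ≤ D) (hD : (D : ℝ) ≤ Real.exp (s / (4 * l)))
    (hy : expFloor (l ^ 16) ≤ y) :
    4 * s * bilinearError D y (expFloor (s / l)) (expFloor s) ≤ 1 / l := by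
  have h1 : (1 : ℝ) ≤ l := by linarith
  have h16 : 1 ≤ l ^ 16 := one_le_pow₀ h1
  have hk1 := le_div_pow_of_pow_le hl hs (k := 1) (by norm_num)
  have hk0 := le_div_pow_of_pow_le hl hs (k := 0) (by norm_num)
  simp only [pow_one, pow_zero, div_one] at hk1 hk0
  have e4 : s / (4 * l) = s / l / 4 := by field_simp
  have hyr : (expFloor (l ^ 16) : ℝ) ≤ y := by exact_mod_cast hy
  have hsl' : s / l ≤ s := div_le_self (by linarith) h1
  have h := bilinearError_le (D := D) (y := y) (w := expFloor (s / l)) (N := expFloor s)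
    (v := l ^ 16) (s := s) (q := s / (4 * l)) (by linarith) (by rw [e4]; linarith) hD1
    (log_expFloor_le (by linarith)) hD (by rw [e4]; linarith)
    ((half_exp_le_expFloor h16).trans hyr)
    (by
      have : 4 * (s / (4 * l)) = s / l := by rw [e4]; ring
      rw [this]
      exact half_exp_le_expFloor (by linarith))
  have h2 : Real.exp (-(s / (4 * l))) ≤ Real.exp (-l ^ 16 / 2) := by
    apply Real.exp_le_exp.2
    rw [e4]; linarith
  have h3 := pow_four_mul_exp_le hl
  rw [← hsl] at h3
  have hs0 : 0 ≤ s := by linarith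
  calc 4 * s * bilinearError D y (expFloor (s / l)) (expFloor s)
      ≤ 4 * s * (200 * s ^ 3 * (Real.exp (-l ^ 16 / 2) + Real.exp (-l ^ 16 / 2))) := by
        gcongr
        refine h.trans ?_
        gcongr
    _ = 1600 * s ^ 4 * Real.exp (-l ^ 16 / 2) := by ring
    _ ≤ 1 / l := h3

theorem smallTerm_scale_le {l s C : ℝ} (hl : 4000 ≤ l) (hs : l ^ 40 ≤ s)
    (hsl : s = Real.exp (l ^ 8)) (hCl : C ≤ l)
    (hC : ∑ p ∈ Nat.primesLE (expFloor (l ^ 16)), (p : ℝ)⁻¹ ≤ Real.log (l ^ 16) + C) :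
    4 * (1 + Real.log (expFloor s)) * (∑ p ∈ Nat.primesLE (expFloor (l ^ 16)), (p : ℝ)⁻¹) /
        Real.log (expFloor (s / (8 * l))) +
      (expFloor (l ^ 16) : ℝ) * (expFloor (s / (8 * l)) : ℝ) ^ 6 / expFloor (s / l) +
      (expFloor (l ^ 16) : ℝ) * (1 + Real.log (expFloor s)) / expFloor (s / l) ≤
    2176 * l ^ 2 + 1 + 1 := by
  have h1 : (1 : ℝ) ≤ l := by linarith
  have hb : l ≤ l ^ 8 := le_self_pow₀ h1 (by norm_num)
  have hb2 : l ^ 16 = l ^ 8 * l ^ 8 := by ring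
  have h16 : 1 ≤ l ^ 16 := one_le_pow₀ h1
  have hk1 := le_div_pow_of_pow_le hl hs (k := 1) (by norm_num)
  have hk0 := le_div_pow_of_pow_le hl hs (k := 0) (by norm_num)
  simp only [pow_one, pow_zero, div_one] at hk1 hk0
  have hs0 : 0 < s := by linarith
  have hl0 : 0 < l := by linarith
  have hN : Real.log (expFloor s) ≤ s := log_expFloor_le (by linarith)
  have hN0 : 0 ≤ Real.log (expFloor s) := Real.log_natCast_nonneg _
  have e8 : s / (8 * l) = s / l / 8 := by field_simp
  have hR : s / (16 * l) ≤ Real.log (expFloor (s / (8 * l))) := by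
    have := half_le_log_expFloor (v := s / (8 * l)) (by rw [e8]; linarith)
    have e : s / (16 * l) = s / (8 * l) / 2 := by field_simp; norm_num
    rw [e]; exact this
  have hS : ∑ p ∈ Nat.primesLE (expFloor (l ^ 16)), (p : ℝ)⁻¹ ≤ 17 * l := by
    refine hC.trans ?_
    rw [Real.log_pow]
    have := Real.log_le_sub_one_of_pos hl0
    push_cast
    linarith
  have hS0 : 0 ≤ ∑ p ∈ Nat.primesLE (expFloor (l ^ 16)), (p : ℝ)⁻¹ :=
    Finset.sum_nonneg fun _ _ => by positivity
  have hw : Real.exp (s / l) / 2 ≤ expFloor (s / l) := half_exp_le_expFloor (by linarith)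
  have hy : (expFloor (l ^ 16) : ℝ) ≤ Real.exp (l ^ 16) := expFloor_le _
  have hR6 : (expFloor (s / (8 * l)) : ℝ) ≤ Real.exp (s / (8 * l)) := expFloor_le _
  have hexp : (4 : ℝ) ≤ Real.exp (l ^ 8) := by linarith [Real.add_one_le_exp (l ^ 8)]
  gcongr ?_ + ?_ + ?_
  · calc _ ≤ 4 * (s + s) * (17 * l) / (s / (16 * l)) := by
          gcongr; linarith
      _ = 2176 * l ^ 2 := by field_simp; norm_num
  · calc _ ≤ Real.exp (l ^ 16) * Real.exp (s / (8 * l)) ^ 6 / (Real.exp (s / l) / 2) := by gcongr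
      _ = 2 * Real.exp (l ^ 16 + 6 * (s / (8 * l)) - s / l) := by
          rw [Real.exp_sub, Real.exp_add, ← Real.exp_nat_mul]
          push_cast
          field_simp
      _ ≤ 2 * Real.exp (-l ^ 8) := by
          gcongr
          rw [e8]
          nlinarith
      _ ≤ 1 := by
          rw [Real.exp_neg, ← div_eq_mul_inv, div_le_one (by positivity)]
          linarith
  · calc _ ≤ Real.exp (l ^ 16) * (s + s) / (Real.exp (s / l) / 2) := by
          gcongr; linarith
      _ = 4 * Real.exp (l ^ 16 + l ^ 8 - s / l) := by
          rw [Real.exp_sub, Real.exp_add, ← hsl]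
          field_simp
          norm_num
      _ ≤ 4 * Real.exp (-l ^ 8) := by
          gcongr
          nlinarith
      _ ≤ 1 := by
          rw [Real.exp_neg, ← div_eq_mul_inv, div_le_one (by positivity)]
          linarith

theorem log_add_div_log_expFloor_le {k : ℕ} {l s : ℝ} (hk : (k : ℝ) ≤ s) (h1 : 1 ≤ l)
    (hs : 4 ≤ s) (hl : 2 ≤ s / l ^ 2) :
    Real.log (expFloor s + k : ℕ) / Real.log (expFloor (s / l ^ 2)) ≤ 4 * l ^ 2 := by
  have hz := half_le_log_expFloor hl
  have hz0 : 0 < s / l ^ 2 / 2 := by positivity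
  have hs1 : 1 ≤ s := by linarith
  have hl0 : 0 < l := by linarith
  have hN2 : Real.log (expFloor s + k : ℕ) ≤ 2 * s := by
    have hNpos : (2 : ℝ) ≤ expFloor s := by exact_mod_cast two_le_expFloor hs1
    have hkN : (k : ℝ) ≤ expFloor s := by
      have h5 := half_exp_le_expFloor hs1
      have h6 := Real.quadratic_le_exp_of_nonneg (by linarith : 0 ≤ s)
      nlinarith
    calc Real.log (expFloor s + k : ℕ) ≤ Real.log (2 * expFloor s) := by
          apply Real.log_le_log
          · push_cast; linarith
          · push_cast; linarith
      _ = Real.log 2 + Real.log (expFloor s) := Real.log_mul (by norm_num) (by linarith)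
      _ ≤ 2 * s := by linarith [Real.log_two_lt_d9, log_expFloor_le hs1]
  calc _ ≤ 2 * s / (s / l ^ 2 / 2) := by gcongr
    _ = 4 * l ^ 2 := by field_simp; norm_num

set_option maxHeartbeats 1000000 in
theorem exists_averageError_scale_le : ∃ C : ℝ, 0 ≤ C ∧ ∀ (a : ℤ) (l s : ℝ),
    4000 + a.natAbs + C ≤ l → l ^ 40 ≤ s → s = Real.exp (l ^ 8) →
    Real.log l - C ≤ primeMass (expFloor (s / l)) (expFloor s) ∧
    ∀ r : ℝ, 0 ≤ r → Real.exp 1 * r ≤ 1 →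
      averageError a r (expFloor (l ^ 16)) (expFloor (s / l ^ 16)) (expFloor (s / l ^ 2))
        (expFloor (s / l)) ⌈l ^ 8⌉₊ (expFloor (s / (8 * l))) (expFloor s) ≤
      16 / primeMass (expFloor (s / l)) (expFloor s) +
        10 * √(3 * primeMass (expFloor (s / l)) (expFloor s)) /
          primeMass (expFloor (s / l)) (expFloor s) + r * l ^ 3 + C * r + 1 / l := by
  obtain ⟨C₁, hC₁0, hsum, hmass⟩ := exists_mertens_expFloor
  obtain ⟨C₂, hC₂0, htot⟩ := exists_sum_inv_totient_expFloor
  refine ⟨C₁ + C₂ + 2 * Real.exp C₂ * Real.exp 1 + 1, by positivity, fun a l s hal hs hsl => ?_⟩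
  have hE0 : 0 ≤ 2 * Real.exp C₂ * Real.exp 1 := by positivity
  have ha0 : (0 : ℝ) ≤ a.natAbs := by positivity
  have hl : 4000 ≤ l := by linarith
  have h1 : (1 : ℝ) ≤ l := by linarith
  have hl0 : 0 < l := by linarith
  have hb : l ≤ l ^ 8 := le_self_pow₀ h1 (by norm_num)
  have hb16 : l ^ 8 ≤ l ^ 16 := pow_le_pow_right₀ h1 (by norm_num)
  have hb2 : l ^ 16 = l ^ 8 * l ^ 8 := by ring
  have h16 : 1 ≤ l ^ 16 := one_le_pow₀ h1
  have hk0 := le_div_pow_of_pow_le hl hs (k := 0) (by norm_num)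
  have hk1 := le_div_pow_of_pow_le hl hs (k := 1) (by norm_num)
  have hk2 := le_div_pow_of_pow_le hl hs (k := 2) (by norm_num)
  have hk16 := le_div_pow_of_pow_le hl hs (k := 16) (by norm_num)
  simp only [pow_one, pow_zero, div_one] at hk0 hk1
  have hs0 : 0 < s := by linarith
  have hs1 : 1 ≤ s := by linarith
  have hlogs : Real.log s = l ^ 8 := by rw [hsl, Real.log_exp]
  have hlogl0 : 0 ≤ Real.log l := Real.log_nonneg h1
  have hlogl : Real.log l ≤ l := by linarith [Real.log_le_sub_one_of_pos hl0]
  have hdiv : ∀ k : ℕ, Real.log (s / l ^ k) = l ^ 8 - k * Real.log l := by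
    intro k
    rw [Real.log_div hs0.ne' (by positivity), hlogs, Real.log_pow]
  refine ⟨?_, fun r hr0 hr1 => ?_⟩
  · have h := (abs_le.1 (hmass (s / l) s (by linarith) (div_le_self hs0.le h1))).1
    rw [hlogs] at h
    have h2 := hdiv 1
    simp only [pow_one] at h2
    rw [h2] at h
    rw [primeMass]
    push_cast at h
    linarith
  set M := primeMass (expFloor (s / l)) (expFloor s) with hM
  set K := ⌈l ^ 8⌉₊ with hK
  have hKl : l ^ 8 ≤ K := Nat.le_ceil _
  have hKu : (K : ℝ) ≤ l ^ 8 + 1 := (Nat.ceil_lt_add_one (by linarith)).le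
  have hK1 : 1 ≤ K := by
    have : (1 : ℝ) ≤ K := by linarith
    exact_mod_cast this
  have e4 : s / (4 * l) = s / l / 4 := by field_simp
  -- the rough window
  have t1 : bilinearError (expFloor (s / l ^ 2)) (expFloor (s / l ^ 16)) (expFloor (s / l))
      (expFloor s) ≤ 1 := by
    have h := bilinearError_scale_le hl hs hsl (D := expFloor (s / l ^ 2))
      (y := expFloor (s / l ^ 16)) (by linarith [two_le_expFloor (v := s / l ^ 2) (by linarith)])
      ((expFloor_le _).trans (Real.exp_le_exp.2 (by gcongr; nlinarith)))
      (expFloor_mono (by linarith))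
    have hl1 : 1 / l ≤ 1 := by rw [div_le_one hl0]; exact h1
    nlinarith [bilinearError_nonneg (expFloor (s / l ^ 2)) (expFloor (s / l ^ 16))
      (expFloor (s / l)) (expFloor s)]
  have t2 : 2 ^ (K + 1) * bilinearError (expFloor (s / l ^ 16) ^ K) (expFloor (l ^ 16))
      (expFloor (s / l)) (expFloor s) ≤ 1 / l := by
    have hz1 : 1 ≤ expFloor (s / l ^ 16) := by
      linarith [two_le_expFloor (v := s / l ^ 16) (by linarith)]
    have h := bilinearError_scale_le hl hs hsl (D := expFloor (s / l ^ 16) ^ K)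
      (y := expFloor (l ^ 16)) (Nat.one_le_pow _ _ hz1) (by
        push_cast
        calc (expFloor (s / l ^ 16) : ℝ) ^ K ≤ Real.exp (s / l ^ 16) ^ K := by
              gcongr; exact expFloor_le _
          _ = Real.exp (K * (s / l ^ 16)) := by rw [Real.exp_nat_mul]
          _ ≤ Real.exp (s / (4 * l)) := by
              apply Real.exp_le_exp.2
              rw [← mul_div_assoc, div_le_div_iff₀ (by positivity) (by positivity)]
              have : (K : ℝ) * (4 * l) ≤ l ^ 16 := by
                have hl9 : l ^ 16 = l * (l ^ 8 * l ^ 7) := by ring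
                have hl7 : l ≤ l ^ 7 := le_self_pow₀ h1 (by norm_num)
                rw [hl9]
                nlinarith [mul_le_mul_of_nonneg_left hl7 (by linarith : 0 ≤ l ^ 8)]
              nlinarith) le_rfl
    refine le_trans ?_ h
    gcongr
    · exact bilinearError_nonneg _ _ _ _
    · rw [← Real.rpow_natCast]
      calc (2 : ℝ) ^ ((K + 1 : ℕ) : ℝ) ≤ 2 ^ (l ^ 8 + 2) :=
            Real.rpow_le_rpow_of_exponent_le (by norm_num) (by push_cast; linarith)
        _ = 4 * 2 ^ (l ^ 8) := by
            rw [Real.rpow_add (by norm_num)]; norm_num; ring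
        _ ≤ 4 * Real.exp 1 ^ (l ^ 8) := by
            gcongr
            linarith [Real.add_one_le_exp (1 : ℝ)]
        _ = 4 * s := by rw [← Real.exp_mul, one_mul, hsl]
  have t3 : 2 * r ^ K * Real.exp (∑ p ∈ primesIoc (expFloor (l ^ 16)) (expFloor (s / l ^ 16)),
      ((p.totient : ℝ))⁻¹) ≤ 2 * Real.exp C₂ * Real.exp 1 * r := by
    have h := (abs_le.1 (htot (l ^ 16) (s / l ^ 16) (by linarith) (by linarith))).2
    rw [hdiv, Real.log_pow] at h
    push_cast at h
    calc _ ≤ 2 * r ^ K * Real.exp (K + C₂) := by gcongr; linarith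
      _ = 2 * Real.exp C₂ * (Real.exp 1 * r) ^ K := by
          rw [Real.exp_add, mul_pow, ← Real.exp_nat_mul, mul_one]; ring
      _ ≤ 2 * Real.exp C₂ * (Real.exp 1 * r) := by
          gcongr
          exact pow_le_of_le_one (by positivity) hr1 (by omega)
      _ = _ := by ring
  have t4 : ∑ p ∈ primesIoc (expFloor (s / l ^ 16)) (expFloor (s / l ^ 2)),
      ((p.totient : ℝ))⁻¹ ≤ 14 * l + C₂ := by
    have h := (abs_le.1 (htot (s / l ^ 16) (s / l ^ 2) (by linarith)
      (by gcongr; norm_num))).2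
    rw [hdiv, hdiv] at h
    push_cast at h
    linarith
  have t5 := smallTerm_scale_le hl hs hsl (by linarith : C₁ ≤ l) (hsum _ (by linarith))
  have hN : Real.log (expFloor s) ≤ s := log_expFloor_le (by linarith)
  have t6 := log_add_div_log_expFloor_le (by linarith) h1 (by linarith) (by linarith : 2 ≤ s / l ^ 2)
    (k := a.natAbs)
  have t7 : 2 * r * (2 + Real.log (expFloor s)) / expFloor (l ^ 16) ≤ r := by
    have hy : Real.exp (l ^ 16) / 2 ≤ expFloor (l ^ 16) := half_exp_le_expFloor h16
    have h3 := Real.quadratic_le_exp_of_nonneg (x := l ^ 8) (by linarith)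
    have h5 : 8 * s ≤ Real.exp (l ^ 16) := by
      calc 8 * s ≤ s * s := by nlinarith
        _ = Real.exp (l ^ 8 + l ^ 8) := by rw [Real.exp_add, hsl]
        _ ≤ Real.exp (l ^ 16) := Real.exp_le_exp.2 (by nlinarith)
    rw [div_le_iff₀ (lt_of_lt_of_le (by positivity) hy)]
    have : 2 * (2 + Real.log (expFloor s)) ≤ expFloor (l ^ 16) := by linarith
    nlinarith
  rw [averageError]
  have hmain : r * ((a.natAbs + Real.log (expFloor s + a.natAbs : ℕ) /
      Real.log (expFloor (s / l ^ 2))) +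
      (4 * (1 + Real.log (expFloor s)) *
        (∑ p ∈ Nat.primesLE (expFloor (l ^ 16)), (p : ℝ)⁻¹) /
        Real.log (expFloor (s / (8 * l))) +
      (expFloor (l ^ 16) : ℝ) * (expFloor (s / (8 * l)) : ℝ) ^ 6 / expFloor (s / l) +
      (expFloor (l ^ 16) : ℝ) * (1 + Real.log (expFloor s)) / expFloor (s / l)) +
      bilinearError (expFloor (s / l ^ 2)) (expFloor (s / l ^ 16)) (expFloor (s / l))
      (expFloor s) + ∑ p ∈ primesIoc (expFloor (s / l ^ 16)) (expFloor (s / l ^ 2)),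
      ((p.totient : ℝ))⁻¹) ≤ r * l ^ 3 := by
    gcongr
    have hl3 : (4000 + a.natAbs + C₂) * l ^ 2 ≤ l ^ 3 := by
      rw [pow_succ' l 2]
      gcongr
      linarith
    have hl2 : l ≤ l ^ 2 := le_self_pow₀ h1 (by norm_num)
    have hal2 : a.natAbs * 1 ≤ (a.natAbs : ℝ) * l ^ 2 := by gcongr; linarith
    have hCl2 : C₂ * 1 ≤ C₂ * l ^ 2 := by gcongr; linarith
    have e : (4000 + a.natAbs + C₂) * l ^ 2 = 4000 * l ^ 2 + a.natAbs * l ^ 2 + C₂ * l ^ 2 := by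
      ring
    linarith
  have hC : 0 ≤ (C₁ + C₂) * r := by positivity
  have e : (C₁ + C₂ + 2 * Real.exp C₂ * Real.exp 1 + 1) * r =
      (C₁ + C₂) * r + 2 * Real.exp C₂ * Real.exp 1 * r + r := by ring
  rw [e]
  linarith

theorem norm_localProduct_sub_exp_le {c : ℂ} (hc : ‖1 + c‖ ≤ 1) (hc1 : ‖c‖ ≤ 1) {y : ℕ}
    (hy : 1 ≤ y) (z : ℕ) :
    ‖localProduct c y z 1 -
        Complex.exp (c * ((∑ p ∈ primesIoc y z, ((p.totient : ℝ))⁻¹ : ℝ) : ℂ))‖ ≤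
      ‖c‖ ^ 2 * (∑ p ∈ primesIoc y z, ((p.totient : ℝ))⁻¹) / y := by
  have hyr : (1 : ℝ) ≤ y := by exact_mod_cast hy
  have hinv : ∀ p ∈ primesIoc y z, ((p.totient : ℝ))⁻¹ ≤ (y : ℝ)⁻¹ := by
    intro p hp
    obtain ⟨⟨h1, -⟩, h3⟩ := mem_primesIoc.1 hp
    have h4 : y ≤ p.totient := by rw [Nat.totient_prime h3]; omega
    have h5 : (y : ℝ) ≤ p.totient := by exact_mod_cast h4
    exact inv_anti₀ (by linarith) h5
  have hy1 : (y : ℝ)⁻¹ ≤ 1 := inv_le_one_of_one_le₀ hyr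
  have hre : c.re ≤ 0 := by
    have := (Complex.re_le_norm (1 + c)).trans hc
    simpa using this
  have e1 : localProduct c y z 1 =
      ∏ p ∈ primesIoc y z, (1 + c * (((p.totient : ℝ)⁻¹ : ℝ) : ℂ)) := by
    rw [localProduct]
    refine Finset.prod_congr rfl fun p _ => ?_
    rw [if_pos (Nat.coprime_one_right p)]
  rw [e1, Complex.ofReal_sum, Finset.mul_sum, Complex.exp_sum]
  refine (norm_prod_sub_prod_le ?_ ?_).trans ?_
  · intro p hp
    exact norm_one_add_mul_le_one hc (by positivity) ((hinv p hp).trans hy1)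
  · intro p hp
    rw [Complex.norm_exp, Real.exp_le_one_iff, Complex.re_mul_ofReal]
    exact mul_nonpos_of_nonpos_of_nonneg hre (by positivity)
  · rw [Finset.mul_sum, Finset.sum_div]
    refine Finset.sum_le_sum fun p hp => ?_
    have h0 : 0 ≤ ((p.totient : ℝ))⁻¹ := by positivity
    have hn : ‖c * (((p.totient : ℝ)⁻¹ : ℝ) : ℂ)‖ = ‖c‖ * (p.totient : ℝ)⁻¹ := by
      rw [norm_mul, Complex.norm_real, Real.norm_of_nonneg h0]
    have hle : ‖c‖ * (p.totient : ℝ)⁻¹ ≤ 1 :=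
      mul_le_one₀ hc1 h0 ((hinv p hp).trans hy1)
    have h := Complex.norm_exp_sub_one_sub_id_le (hn.trans_le hle)
    rw [hn] at h
    rw [norm_sub_rev]
    calc _ = ‖Complex.exp (c * (((p.totient : ℝ)⁻¹ : ℝ) : ℂ)) - 1 -
          c * (((p.totient : ℝ)⁻¹ : ℝ) : ℂ)‖ := by congr 1; ring
      _ ≤ _ := h
      _ = ‖c‖ ^ 2 * (p.totient : ℝ)⁻¹ * (p.totient : ℝ)⁻¹ := by ring
      _ ≤ ‖c‖ ^ 2 * (p.totient : ℝ)⁻¹ * (y : ℝ)⁻¹ := by exact mul_le_mul_of_nonneg_left (hinv p hp) (by positivity)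
      _ = _ := by rw [div_eq_mul_inv]

theorem norm_exp_mul_I_sub_le {θ : ℝ} (h : |θ| ≤ 1) :
    ‖Complex.exp (θ * Complex.I) - 1 - θ * Complex.I + θ ^ 2 / 2‖ ≤ |θ| ^ 3 := by
  have hn : ‖(θ * Complex.I : ℂ)‖ = |θ| := by simp
  have h3 := Complex.exp_bound (hn.trans_le h) (n := 3) (by norm_num)
  rw [hn] at h3
  have e : ∑ m ∈ Finset.range 3, (θ * Complex.I : ℂ) ^ m / (m.factorial : ℂ) =
      1 + θ * Complex.I - θ ^ 2 / 2 := by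
    simp only [Finset.sum_range_succ, Finset.range_zero, Finset.sum_empty, mul_pow, Complex.I_sq]
    norm_num [Nat.factorial]
    ring
  rw [e] at h3
  calc _ = ‖Complex.exp (θ * Complex.I) - (1 + θ * Complex.I - θ ^ 2 / 2)‖ := by congr 1; ring
    _ ≤ _ := h3
    _ ≤ |θ| ^ 3 * 1 := by
      gcongr
      norm_num [Nat.factorial]
    _ = _ := mul_one _

theorem tendsto_mass_error :
    Tendsto (fun M : ℝ => 16 / M + 10 * √(3 * M) / M) atTop (nhds 0) := by
  have h1 : Tendsto (fun M : ℝ => 16 / M) atTop (nhds 0) := tendsto_const_nhds.div_atTop tendsto_id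
  have h2 : Tendsto (fun M : ℝ => 10 * √3 * (√M)⁻¹) atTop (nhds (10 * √3 * 0)) :=
    (tendsto_inv_atTop_zero.comp Real.tendsto_sqrt_atTop).const_mul _
  have h := h1.add h2
  simp only [mul_zero, add_zero] at h
  refine h.congr' ?_
  filter_upwards [eventually_gt_atTop 0] with M hM
  rw [Real.sqrt_mul (by norm_num), ← one_div, ← Real.sqrt_div_self']
  ring

theorem eventually_pow_le_exp_pow : ∀ᶠ l : ℝ in atTop, l ^ 40 ≤ Real.exp (l ^ 8) := by
  have h := (Real.tendsto_pow_mul_exp_neg_atTop_nhds_zero 5).comp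
    (tendsto_pow_atTop (α := ℝ) (n := 8) (by norm_num))
  filter_upwards [h.eventually (gt_mem_nhds (zero_lt_one : (0 : ℝ) < 1))] with l hl
  simp only [Function.comp, Real.exp_neg] at hl
  rw [← div_eq_mul_inv, div_lt_one (Real.exp_pos _), ← pow_mul] at hl
  exact hl.le

/-- The multiplier `exp (i t / l ^ 4) - 1`. -/
noncomputable def charMultiplier (t l : ℝ) : ℂ :=
  Complex.exp ((t / l ^ 4 : ℝ) * Complex.I) - 1

theorem norm_one_add_charMultiplier (t l : ℝ) : ‖1 + charMultiplier t l‖ = 1 := by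
  rw [charMultiplier, add_sub_cancel, Complex.norm_exp_ofReal_mul_I]

theorem norm_charMultiplier_le (t : ℝ) {l : ℝ} (hl : 0 < l) :
    ‖charMultiplier t l‖ ≤ |t| / l ^ 4 := by
  have h := Real.norm_exp_I_mul_ofReal_sub_one_le (x := t / l ^ 4)
  rw [mul_comm, Real.norm_eq_abs, abs_div, abs_of_pos (by positivity : 0 < l ^ 4)] at h
  exact h

theorem tendsto_charMultiplier_exponent (t : ℝ) {m : ℝ → ℝ} {C : ℝ}
    (hm : ∀ᶠ l : ℝ in atTop, |m l - l ^ 8| ≤ 32 * Real.log l + C) :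
    Tendsto (fun l : ℝ => charMultiplier t l * (m l : ℂ) - t * l ^ 4 * Complex.I) atTop
      (nhds (-(t ^ 2 / 2 : ℝ))) := by
  rw [tendsto_iff_norm_sub_tendsto_zero]
  have hlim : Tendsto (fun l : ℝ => (|t| ^ 3 + |t| * (32 + |C|)) / l) atTop (nhds 0) :=
    tendsto_const_nhds.div_atTop tendsto_id
  refine squeeze_zero' (Eventually.of_forall fun _ => norm_nonneg _) ?_ hlim
  filter_upwards [hm, eventually_ge_atTop (1 + |t|)] with l hml hl
  have ht0 := abs_nonneg t
  have h1 : 1 ≤ l := by linarith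
  have hl0 : 0 < l := by linarith
  have hl4 : l ≤ l ^ 4 := le_self_pow₀ h1 (by norm_num)
  have hθ : |t / l ^ 4| ≤ 1 := by
    rw [abs_div, abs_of_pos (by positivity : 0 < l ^ 4), div_le_one (by positivity)]
    linarith
  have hb := norm_exp_mul_I_sub_le hθ
  have hc := norm_charMultiplier_le t hl0
  have hlC : (l : ℂ) ≠ 0 := by exact_mod_cast hl0.ne'
  have e : charMultiplier t l * (m l : ℂ) - t * l ^ 4 * Complex.I - (-(t ^ 2 / 2 : ℝ) : ℂ) =
      (Complex.exp ((t / l ^ 4 : ℝ) * Complex.I) - 1 - (t / l ^ 4 : ℝ) * Complex.I +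
        ((t / l ^ 4 : ℝ) : ℂ) ^ 2 / 2) * ((l ^ 8 : ℝ) : ℂ) +
      charMultiplier t l * ((m l - l ^ 8 : ℝ) : ℂ) := by
    rw [charMultiplier]
    push_cast
    field_simp
    ring
  rw [e]
  refine (norm_add_le _ _).trans ?_
  rw [norm_mul, norm_mul, Complex.norm_real, Complex.norm_real, Real.norm_eq_abs,
    Real.norm_eq_abs, abs_of_pos (by positivity : 0 < l ^ 8)]
  have hlog := Real.log_le_sub_one_of_pos hl0
  calc _ ≤ |t / l ^ 4| ^ 3 * l ^ 8 + |t| / l ^ 4 * (32 * l + |C| * l) := by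
        gcongr
        refine hml.trans ?_
        have : |C| ≤ |C| * l := le_mul_of_one_le_right (abs_nonneg C) h1
        linarith [le_abs_self C]
    _ = |t| ^ 3 / l ^ 4 + |t| * (32 + |C|) * l / l ^ 4 := by
        rw [abs_div, abs_of_pos (by positivity : 0 < l ^ 4)]
        field_simp
    _ ≤ |t| ^ 3 / l + |t| * (32 + |C|) * l / l ^ 2 := by
        have hl2 : l ^ 2 ≤ l ^ 4 := pow_le_pow_right₀ h1 (by norm_num)
        gcongr
    _ = _ := by field_simp

theorem tendsto_mean_exp_scale {a : ℤ} (ha : a ≠ 0) (t : ℝ) :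
    Tendsto (fun l : ℝ => (∑ n ∈ Finset.Icc 1 (expFloor (Real.exp (l ^ 8))),
      Complex.exp (t * ((((n.totient : ℤ) + a).natAbs.primeFactors.card - l ^ 8) / l ^ 4 : ℝ) *
        Complex.I)) / (expFloor (Real.exp (l ^ 8)) : ℂ)) atTop
      (nhds (Complex.exp (-(t ^ 2 / 2 : ℝ)))) := by
  obtain ⟨C, hC0, hC⟩ := exists_averageError_scale_le
  obtain ⟨C₂, hC₂0, htot⟩ := exists_sum_inv_totient_expFloor
  set N : ℝ → ℕ := fun l => expFloor (Real.exp (l ^ 8)) with hN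
  set s : ℝ → ℝ := fun l => Real.exp (l ^ 8) with hs
  set M : ℝ → ℝ := fun l => primeMass (expFloor (s l / l)) (expFloor (s l)) with hM
  set m : ℝ → ℝ := fun l => ∑ p ∈ primesIoc (expFloor (l ^ 16)) (expFloor (s l / l ^ 16)),
    ((p.totient : ℝ))⁻¹ with hm
  set P : ℝ → ℂ := fun l => localProduct (charMultiplier t l) (expFloor (l ^ 16))
    (expFloor (s l / l ^ 16)) 1 with hP
  set G : ℝ → ℂ := fun l => (∑ n ∈ Finset.Icc 1 (N l), ((1 + charMultiplier t l) ^
    ((n.totient : ℤ) + a).natAbs.primeFactors.card - P l)) / (N l : ℂ) with hG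
  set e : ℝ → ℂ := fun l => Complex.exp (-(t * l ^ 4 * Complex.I)) with he
  have hen : ∀ l, ‖e l‖ = 1 := by
    intro l
    have : -(t * l ^ 4 * Complex.I : ℂ) = ((-(t * l ^ 4) : ℝ) : ℂ) * Complex.I := by
      push_cast; ring
    simp only [he, this, Complex.norm_exp_ofReal_mul_I]
  have hbig := eventually_ge_atTop (4000 + a.natAbs + C + Real.exp 1 * |t| : ℝ)
  have hMlow : ∀ᶠ l in atTop, Real.log l - C ≤ M l := by
    filter_upwards [hbig, eventually_pow_le_exp_pow] with l hl hp
    exact (hC a l (s l) (by linarith [mul_nonneg (Real.exp_pos 1).le (abs_nonneg t)]) hp rfl).1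
  have hMtop : Tendsto M atTop atTop :=
    tendsto_atTop_mono' _ hMlow (tendsto_atTop_add_const_right _ _ Real.tendsto_log_atTop)
  have hmb : ∀ᶠ l : ℝ in atTop, |m l - l ^ 8| ≤ 32 * Real.log l + C₂ := by
    filter_upwards [hbig, eventually_pow_le_exp_pow] with l hl hp
    have ht := mul_nonneg (Real.exp_pos 1).le (abs_nonneg t)
    have hl' : 4000 ≤ l := by
      have : (0 : ℝ) ≤ a.natAbs := by positivity
      linarith
    have h1 : 1 ≤ l := by linarith
    have h16 : 1 ≤ l ^ 16 := one_le_pow₀ h1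
    have hk16 := le_div_pow_of_pow_le hl' hp (k := 16) (by norm_num)
    have hl16 : l ≤ l ^ 16 := le_self_pow₀ h1 (by norm_num)
    have h := htot (l ^ 16) (s l / l ^ 16) (by linarith) (by linarith)
    rw [Real.log_div (Real.exp_pos _).ne' (by positivity), Real.log_exp, Real.log_pow] at h
    have hlog := Real.log_nonneg h1
    push_cast at h
    rw [abs_le] at h ⊢
    constructor <;> linarith [h.1, h.2]
  -- the three contributions
  have l1 : Tendsto (fun l => G l * e l) atTop (nhds 0) := by
    rw [tendsto_zero_iff_norm_tendsto_zero]
    have hlim1 : Tendsto (fun l : ℝ => (|t| + C * |t| + 1) / l) atTop (nhds 0) :=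
      tendsto_const_nhds.div_atTop tendsto_id
    have hlim := (tendsto_mass_error.comp hMtop).add hlim1
    rw [add_zero] at hlim
    refine squeeze_zero' (Eventually.of_forall fun _ => norm_nonneg _) ?_ hlim
    filter_upwards [hbig, eventually_pow_le_exp_pow, hMtop.eventually_ge_atTop 1] with l hl hp hM1
    have ht := mul_nonneg (Real.exp_pos 1).le (abs_nonneg t)
    have ha0 : (0 : ℝ) ≤ a.natAbs := by positivity
    have hl' : 4000 ≤ l := by linarith
    have h1 : 1 ≤ l := by linarith
    have hl0 : 0 < l := by linarith
    have h16 : 1 ≤ l ^ 16 := one_le_pow₀ h1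
    have hl16 : l ≤ l ^ 16 := le_self_pow₀ h1 (by norm_num)
    have hk0 := le_div_pow_of_pow_le hl' hp (k := 0) (by norm_num)
    have hk1 := le_div_pow_of_pow_le hl' hp (k := 1) (by norm_num)
    have hk2 := le_div_pow_of_pow_le hl' hp (k := 2) (by norm_num)
    have hk16 := le_div_pow_of_pow_le hl' hp (k := 16) (by norm_num)
    simp only [pow_one, pow_zero, div_one] at hk0 hk1
    have hc := norm_charMultiplier_le t hl0
    have hl4 : l ≤ l ^ 4 := le_self_pow₀ h1 (by norm_num)
    have hc1 : Real.exp 1 * ‖charMultiplier t l‖ ≤ 1 := by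
      calc _ ≤ Real.exp 1 * (|t| / l ^ 4) := by gcongr
        _ = Real.exp 1 * |t| / l ^ 4 := by ring
        _ ≤ 1 := by rw [div_le_one (by positivity)]; linarith
    have hquad := Real.quadratic_le_exp_of_nonneg (by positivity : 0 ≤ l ^ 16)
    have hyl : 2 * l ^ 16 ≤ expFloor (l ^ 16) := by
      have := half_exp_le_expFloor h16
      nlinarith
    have hwl : l ≤ expFloor (s l / l) := by
      have h5 := half_exp_le_expFloor (v := s l / l) (by linarith)
      have h6 := Real.quadratic_le_exp_of_nonneg (x := s l / l) (by linarith)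
      nlinarith
    have hay : (a.natAbs : ℝ) ≤ expFloor (l ^ 16) := by linarith
    have haw : (a.natAbs : ℝ) < expFloor (s l / l) := by linarith
    have hK : (2 * ⌈l ^ 8⌉₊ : ℝ) ≤ expFloor (l ^ 16) := by
      have hce := Nat.ceil_lt_add_one (by positivity : 0 ≤ l ^ 8)
      have hl8 : l ^ 16 = l ^ 8 * l ^ 8 := by ring
      have hl8' : l ≤ l ^ 8 := le_self_pow₀ h1 (by norm_num)
      nlinarith
    have e8 : s l / (8 * l) = s l / l / 8 := by field_simp
    have h := norm_sum_pow_card_primeFactors_sub_le ha (y := expFloor (l ^ 16))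
      (z := expFloor (s l / l ^ 16)) (z' := expFloor (s l / l ^ 2)) (w := expFloor (s l / l))
      (K := ⌈l ^ 8⌉₊) (R := expFloor (s l / (8 * l))) (N := N l)
      (by exact_mod_cast hay) (two_le_expFloor h16) (expFloor_mono (by linarith))
      (by exact_mod_cast hK) (two_le_expFloor (by linarith)) (by exact_mod_cast haw)
      (two_le_expFloor (by rw [e8]; linarith)) (expFloor_mono (by rw [e8]; linarith))
      hM1 (norm_one_add_charMultiplier t l)
    have hA := (hC a l (s l) (by linarith) hp rfl).2 _ (norm_nonneg (charMultiplier t l)) hc1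
    have hNpos : (0 : ℝ) < N l := by
      have := two_le_expFloor (v := Real.exp (l ^ 8)) (by linarith)
      have h2 : 0 < N l := by simp only [hN]; omega
      exact_mod_cast h2
    rw [norm_mul, hen, mul_one]
    simp only [hG]
    rw [norm_div, Complex.norm_natCast, div_le_iff₀ hNpos, mul_comm]
    refine h.trans ?_
    refine mul_le_mul_of_nonneg_left (hA.trans ?_) hNpos.le
    have hr3 : ‖charMultiplier t l‖ * l ^ 3 ≤ |t| / l := by
      calc _ ≤ |t| / l ^ 4 * l ^ 3 := by gcongr
        _ = |t| / l := by field_simp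
    have hr1 : C * ‖charMultiplier t l‖ ≤ C * |t| / l := by
      rw [mul_div_assoc]
      gcongr
      exact hc.trans (by gcongr)
    simp only [Function.comp, add_div]
    linarith
  have l2 : Tendsto (fun l => (P l - Complex.exp (charMultiplier t l * (m l : ℂ))) * e l) atTop
      (nhds 0) := by
    rw [tendsto_zero_iff_norm_tendsto_zero]
    have hlim : Tendsto (fun l : ℝ => t ^ 2 * (33 + C₂) / l) atTop (nhds 0) :=
      tendsto_const_nhds.div_atTop tendsto_id
    refine squeeze_zero' (Eventually.of_forall fun _ => norm_nonneg _) ?_ hlim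
    filter_upwards [hmb, eventually_ge_atTop (1 + |t|)] with l hml hl
    have ht0 := abs_nonneg t
    have h1 : 1 ≤ l := by linarith
    have hl0 : 0 < l := by linarith
    have hl4 : l ≤ l ^ 4 := le_self_pow₀ h1 (by norm_num)
    have h16 : 1 ≤ l ^ 16 := one_le_pow₀ h1
    have hl16 : l ≤ l ^ 16 := le_self_pow₀ h1 (by norm_num)
    have hc := norm_charMultiplier_le t hl0
    have hc1 : ‖charMultiplier t l‖ ≤ 1 := by
      refine hc.trans ?_
      rw [div_le_one (by positivity)]
      linarith
    have hy : l ≤ expFloor (l ^ 16) := by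
      have h5 := half_exp_le_expFloor h16
      have h6 := Real.quadratic_le_exp_of_nonneg (by positivity : 0 ≤ l ^ 16)
      nlinarith
    have h := norm_localProduct_sub_exp_le (norm_one_add_charMultiplier t l).le hc1
      (by linarith [two_le_expFloor h16] : 1 ≤ expFloor (l ^ 16)) (expFloor (s l / l ^ 16))
    rw [norm_mul, hen, mul_one]
    refine h.trans ?_
    have hm8 : m l ≤ (33 + C₂) * l ^ 8 := by
      have h8 : l ≤ l ^ 8 := le_self_pow₀ h1 (by norm_num)
      have hlog := Real.log_le_sub_one_of_pos hl0
      have := (abs_le.1 hml).2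
      nlinarith
    have hm0 : 0 ≤ m l := Finset.sum_nonneg fun _ _ => by positivity
    calc _ ≤ (|t| / l ^ 4) ^ 2 * ((33 + C₂) * l ^ 8) / l := by
          gcongr
      _ = _ := by
          rw [div_pow, sq_abs]
          field_simp
  have l3 : Tendsto (fun l : ℝ => Complex.exp (charMultiplier t l * (m l : ℂ)) * e l) atTop
      (nhds (Complex.exp (-(t ^ 2 / 2 : ℝ)))) := by
    have h := (Complex.continuous_exp.tendsto _).comp (tendsto_charMultiplier_exponent t hmb)
    refine h.congr fun l => ?_
    simp only [Function.comp, he]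
    rw [← Complex.exp_add, sub_eq_add_neg]
  have h := (l1.add l2).add l3
  simp only [zero_add] at h
  refine h.congr' ?_
  filter_upwards [eventually_gt_atTop 0] with l hl0
  have hNpos : (N l : ℂ) ≠ 0 := by
    have := two_le_expFloor (v := Real.exp (l ^ 8)) (Real.one_le_exp (by positivity))
    have h2 : N l ≠ 0 := by simp only [hN]; omega
    exact_mod_cast h2
  have hsum : G l = (∑ n ∈ Finset.Icc 1 (N l), (1 + charMultiplier t l) ^
      ((n.totient : ℤ) + a).natAbs.primeFactors.card) / (N l : ℂ) - P l := by
    simp only [hG]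
    rw [Finset.sum_sub_distrib, sub_div, Finset.sum_const, Nat.card_Icc, Nat.add_sub_cancel,
      nsmul_eq_mul, mul_div_cancel_left₀ _ hNpos]
  rw [← add_mul, ← add_mul, hsum, sub_add_sub_cancel, sub_add_cancel, div_mul_eq_mul_div,
    Finset.sum_mul]
  congr 1
  refine Finset.sum_congr rfl fun n _ => ?_
  rw [charMultiplier, add_sub_cancel, ← Complex.exp_nat_mul, he, ← Complex.exp_add]
  congr 1
  have hlC : (l : ℂ) ≠ 0 := by exact_mod_cast hl0.ne'
  push_cast
  field_simp
  ring

open MeasureTheory ProbabilityTheory in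
theorem tendsto_card_filter_le_of_tendsto_mean_exp {N : ℕ → ℕ} (hN : ∀ k, 1 ≤ N k)
    {f : ℕ → ℕ → ℝ}
    (h : ∀ t : ℝ, Tendsto (fun k => (∑ n ∈ Finset.Icc 1 (N k),
      Complex.exp (t * (f k n : ℝ) * Complex.I)) / (N k : ℂ)) atTop
      (nhds (Complex.exp (-(t ^ 2 / 2 : ℝ))))) (u : ℝ) :
    Tendsto (fun k => (((Finset.Icc 1 (N k)).filter fun n => f k n ≤ u).card : ℝ) / N k) atTop
      (nhds ((Real.sqrt (2 * Real.pi))⁻¹ * ∫ t in Set.Iic u, Real.exp (-t ^ 2 / 2))) := by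
  have hN0 : ∀ k, (N k : ENNReal) ≠ 0 := fun k => by
    have := hN k
    exact_mod_cast (by omega : N k ≠ 0)
  let ν : ℕ → Measure ℝ := fun k =>
    (N k : ENNReal)⁻¹ • ∑ n ∈ Finset.Icc 1 (N k), Measure.dirac (f k n)
  have hν : ∀ k, IsProbabilityMeasure (ν k) := fun k => by
    constructor
    simp only [ν, Measure.smul_apply, Measure.finsetSum_apply, measure_univ, Finset.sum_const,
      Nat.card_Icc, Nat.add_sub_cancel, nsmul_eq_mul, mul_one, smul_eq_mul]
    exact ENNReal.inv_mul_cancel (hN0 k) (ENNReal.natCast_ne_top _)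
  let μ : ℕ → ProbabilityMeasure ℝ := fun k => ⟨ν k, hν k⟩
  let γ : ProbabilityMeasure ℝ := ⟨gaussianReal 0 1, inferInstance⟩
  have hμ : Tendsto μ atTop (nhds γ) := by
    rw [ProbabilityMeasure.tendsto_iff_tendsto_charFun]
    intro t
    have e0 : charFun (γ : Measure ℝ) t = Complex.exp (-(t ^ 2 / 2 : ℝ)) := by
      change charFun (gaussianReal 0 1) t = _
      rw [charFun_gaussianReal]
      congr 1
      push_cast
      simp
    rw [e0]
    refine (h t).congr fun k => ?_
    change _ = charFun (ν k) t
    rw [charFun_apply_real]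
    simp only [ν]
    rw [integral_smul_measure, integral_finsetSum_measure fun i _ => integrable_dirac (by finiteness)]
    simp only [integral_dirac, ENNReal.toReal_inv, ENNReal.toReal_natCast]
    rw [div_eq_inv_mul, Complex.real_smul]
    push_cast
    rfl
  have hfr : (γ : Measure ℝ) (frontier (Set.Iic u)) = 0 := by
    rw [frontier_Iic]
    change gaussianReal 0 1 {u} = 0
    have := nullSingletonClass_gaussianReal (μ := 0) (v := 1) one_ne_zero
    exact measure_singleton u
  have hlim := ProbabilityMeasure.tendsto_measure_of_null_frontier_of_tendsto' hμ hfr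
  have hγ : (γ : Measure ℝ) (Set.Iic u) = ENNReal.ofReal
      ((Real.sqrt (2 * Real.pi))⁻¹ * ∫ t in Set.Iic u, Real.exp (-t ^ 2 / 2)) := by
    change gaussianReal 0 1 (Set.Iic u) = _
    rw [gaussianReal_apply_eq_integral _ one_ne_zero]
    simp only [gaussianPDFReal, NNReal.coe_one, mul_one, sub_zero]
    rw [integral_const_mul]
  have hr := (ENNReal.tendsto_toReal (by rw [hγ]; exact ENNReal.ofReal_ne_top)).comp hlim
  rw [hγ, ENNReal.toReal_ofReal (by positivity)] at hr
  refine hr.congr fun k => ?_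
  change (ν k (Set.Iic u)).toReal = _
  simp only [ν, Measure.smul_apply, Measure.finsetSum_apply, smul_eq_mul, ENNReal.toReal_mul,
    ENNReal.toReal_inv, ENNReal.toReal_natCast, Measure.dirac_apply' _ measurableSet_Iic]
  rw [div_eq_inv_mul, ENNReal.toReal_sum fun n _ => by
    by_cases hn : f k n ∈ Set.Iic u <;> simp [hn]]
  congr 1
  rw [Finset.card_filter]
  push_cast
  refine Finset.sum_congr rfl fun n _ => ?_
  by_cases hn : f k n ≤ u <;> simp [hn]

/-- Erdős–Kac law for ω(|φ(n) + a|) for a fixed nonzero integer `a`.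
(The finitely many n with φ(n) + a = 0 give ω(0) = 0 and do not affect the limit.) -/
theorem erdosKac_shifted_totient (a : ℤ) (ha : a ≠ 0) (u : ℝ) :
    Tendsto (fun x : ℝ =>
      (((Finset.Icc 2 ⌊x⌋₊).filter (fun n : ℕ =>
        ((((n.totient : ℤ) + a).natAbs.primeFactors.card : ℝ)) - Real.log (Real.log x)
          ≤ u * Real.sqrt (Real.log (Real.log x)))).card : ℝ) / x)
      atTop
      (nhds ((Real.sqrt (2 * Real.pi))⁻¹ * ∫ t in Set.Iic u, Real.exp (-t ^ 2 / 2))) := by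
  let N : ℝ → ℕ := fun l => expFloor (Real.exp (l ^ 8))
  let f : ℝ → ℕ → ℝ := fun l n =>
    (((n.totient : ℤ) + a).natAbs.primeFactors.card - l ^ 8) / l ^ 4
  have hscale : Tendsto (fun l : ℝ =>
      (((Finset.Icc 1 (N l)).filter fun n => f l n ≤ u).card : ℝ) / N l) atTop
      (nhds ((Real.sqrt (2 * Real.pi))⁻¹ * ∫ t in Set.Iic u, Real.exp (-t ^ 2 / 2))) := by
    refine tendsto_of_seq_tendsto fun l hl => ?_
    refine tendsto_card_filter_le_of_tendsto_mean_exp (N := fun k => N (l k))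
      (f := fun k => f (l k)) (fun k => ?_) (fun t => (tendsto_mean_exp_scale ha t).comp hl) u
    exact (by norm_num : 1 ≤ 2).trans (two_le_expFloor (Real.one_le_exp (by positivity)))
  have hlog : Tendsto (fun x : ℝ => Real.log (Real.log x)) atTop atTop :=
    Real.tendsto_log_atTop.comp Real.tendsto_log_atTop
  have hl : Tendsto (fun x : ℝ => Real.log (Real.log x) ^ (1 / 8 : ℝ)) atTop atTop :=
    (tendsto_rpow_atTop (by norm_num)).comp hlog
  have hA := (hscale.comp hl).mul (tendsto_nat_floor_div_atTop (R := ℝ))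
  rw [mul_one] at hA
  have h1 : Tendsto (fun x : ℝ => (1 : ℝ) / x) atTop (nhds 0) :=
    tendsto_const_nhds.div_atTop tendsto_id
  have hB := hA.sub h1
  rw [sub_zero] at hB
  refine tendsto_of_tendsto_of_tendsto_of_le_of_le' hB hA ?_ ?_
  all_goals
    filter_upwards [hlog.eventually_gt_atTop 0, eventually_ge_atTop (Real.exp 1)] with x hx0 hxe
    have hxpos : 0 < x := (Real.exp_pos 1).trans_le hxe
    have hx1 : 1 ≤ x := (Real.one_le_exp zero_le_one).trans hxe
    have hlx : 1 ≤ Real.log x := (Real.le_log_iff_exp_le hxpos).2 hxe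
    set l := Real.log (Real.log x) ^ (1 / 8 : ℝ) with hldef
    have hlpos : 0 < l := Real.rpow_pos_of_pos hx0 _
    have hl8 : l ^ 8 = Real.log (Real.log x) := by
      rw [hldef, ← Real.rpow_natCast, ← Real.rpow_mul hx0.le]
      norm_num
    have hl4 : l ^ 4 = √(Real.log (Real.log x)) := by
      rw [← hl8, show l ^ 8 = (l ^ 4) ^ 2 by ring, Real.sqrt_sq (by positivity)]
    have hNx : N l = ⌊x⌋₊ := by
      simp only [N, expFloor]
      rw [hl8, Real.exp_log (by linarith), Real.exp_log hxpos]
    have hNpos : (0 : ℝ) < ⌊x⌋₊ := by exact_mod_cast Nat.floor_pos.2 hx1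
    have hset : (Finset.Icc 2 ⌊x⌋₊).filter (fun n : ℕ =>
        ((((n.totient : ℤ) + a).natAbs.primeFactors.card : ℝ)) - Real.log (Real.log x)
          ≤ u * Real.sqrt (Real.log (Real.log x))) =
        ((Finset.Icc 1 (N l)).filter fun n => f l n ≤ u).erase 1 := by
      ext n
      simp only [Finset.mem_filter, Finset.mem_erase, Finset.mem_Icc, hNx, f, hl8, hl4,
        div_le_iff₀ (Real.sqrt_pos.2 hx0)]
      constructor
      · rintro ⟨⟨h2, h3⟩, h4⟩
        exact ⟨by omega, ⟨by omega, h3⟩, h4⟩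
      · rintro ⟨h2, ⟨h3, h4⟩, h5⟩
        exact ⟨⟨by omega, h4⟩, h5⟩
    have hAx : ((((Finset.Icc 1 (N l)).filter fun n => f l n ≤ u).card : ℝ) / N l) *
        ((⌊x⌋₊ : ℝ) / x) = (((Finset.Icc 1 (N l)).filter fun n => f l n ≤ u).card : ℝ) / x := by
      rw [hNx]
      field_simp
    simp only [Function.comp]
    rw [← hldef, hset, hAx]
  · rw [← sub_div]
    gcongr
    have := Finset.pred_card_le_card_erase (s := (Finset.Icc 1 (N l)).filter fun n => f l n ≤ u)
      (a := 1)
    rw [sub_le_iff_le_add]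
    exact_mod_cast (by omega)
  · gcongr
    exact Finset.erase_subset _ _
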